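/- Let n ≥ 3, let σ be a smooth asymptotically flat Riemannian metric on ℝⁿ, let h > 0, ε > 0, C₀ > 0, and let r₀ = r₀(σ,h) be as in the boundary gradient estimate. Then there is a constant c ≥ 1, depending only on n, the asymptotic-flatness data of σ, C₀, ε and h but not on R or T, such that the following holds for all sufficiently large R. Suppose σ_R is a smooth Riemannian metric on ℝⁿ equal to σ on B_{R−1}(0) and to δ outside B_R(0), whose Ricci curvature satisfies |Ric_{σ_R}(w,w)| ≤ C₀|w|²_{σ_R} for all tangent vectors w; suppose u_{0,R} ∈ C¹(ℝⁿ) satisfies |u_{0,R}| ≤ h, |∇u_{0,R}|_{σ_R} ≤ 1−ε, and u_{0,R} = 0 outside B_R(0); and suppose u_R solves the graphical mean curvature flow ∂_t u_R = g^{ij}(σ_R,∇u_R)(∇²_{σ_R} u_R)_{ij} on B_{R²}(0)×(0,T) with initial value u_{0,R} and zero boundary values on ∂B_{R²}(0)×[0,T). Then v := (1 − |∇u_R|²_{σ_R})^{−1/2} satisfies sup_{B_{R²}(0)×[0,T)} v ≤ c. -/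

import Mathlib

noncomputable section
open Real Set Filter MeasureTheory Metric ENNReal

/-- Partial derivative of `f` at `x` in the `i`-th coordinate direction. -/
def pd {n : ℕ} (i : Fin n) (f : EuclideanSpace ℝ (Fin n) → ℝ) (x : EuclideanSpace ℝ (Fin n)) : ℝ :=
  fderiv ℝ f x (EuclideanSpace.single i 1)

/-- `|∇u|²_σ = σ^{ij} ∂_i u ∂_j u`. -/
def gradSq {n : ℕ} (σ : EuclideanSpace ℝ (Fin n) → Matrix (Fin n) (Fin n) ℝ)
    (u : EuclideanSpace ℝ (Fin n) → ℝ) (x : EuclideanSpace ℝ (Fin n)) : ℝ :=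
  ∑ i, ∑ j, (σ x)⁻¹ i j * pd i u x * pd j u x

/-- Christoffel symbols `Γ^k_{ij}` of the metric `σ`. -/
def christoffel {n : ℕ} (σ : EuclideanSpace ℝ (Fin n) → Matrix (Fin n) (Fin n) ℝ)
    (k i j : Fin n) (x : EuclideanSpace ℝ (Fin n)) : ℝ :=
  (1 / 2) * ∑ l, (σ x)⁻¹ k l *
    (pd j (fun y => σ y l i) x + pd i (fun y => σ y l j) x - pd l (fun y => σ y i j) x)

/-- Covariant Hessian `(∇²_σ u)_{ij} = ∂_i ∂_j u − Γ^k_{ij} ∂_k u`. -/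
def covHess {n : ℕ} (σ : EuclideanSpace ℝ (Fin n) → Matrix (Fin n) (Fin n) ℝ)
    (u : EuclideanSpace ℝ (Fin n) → ℝ) (i j : Fin n) (x : EuclideanSpace ℝ (Fin n)) : ℝ :=
  pd i (fun y => pd j u y) x - ∑ k, christoffel σ k i j x * pd k u x

/-- `g^{ij}(σ,∇u) = σ^{ij} + σ^{ik}σ^{jl}∂_k u ∂_l u/(1 − |∇u|²_σ)`. -/
def ginv {n : ℕ} (σ : EuclideanSpace ℝ (Fin n) → Matrix (Fin n) (Fin n) ℝ)
    (u : EuclideanSpace ℝ (Fin n) → ℝ) (i j : Fin n) (x : EuclideanSpace ℝ (Fin n)) : ℝ :=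
  (σ x)⁻¹ i j + (∑ k, ∑ l, (σ x)⁻¹ i k * (σ x)⁻¹ j l * pd k u x * pd l u x) / (1 - gradSq σ u x)

/-- Graphical mean curvature operator `g^{ij}(σ,∇u)(∇²_σ u)_{ij}`. -/
def mcfOp {n : ℕ} (σ : EuclideanSpace ℝ (Fin n) → Matrix (Fin n) (Fin n) ℝ)
    (u : EuclideanSpace ℝ (Fin n) → ℝ) (x : EuclideanSpace ℝ (Fin n)) : ℝ :=
  ∑ i, ∑ j, ginv σ u i j x * covHess σ u i j x

/-- `σ` is a smooth asymptotically flat Riemannian metric on ℝⁿ with data `(R₀, C, ω)`. -/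
def IsAsympFlat {n : ℕ} (σ : EuclideanSpace ℝ (Fin n) → Matrix (Fin n) (Fin n) ℝ)
    (R₀ C : ℝ) (ω : ℝ → ℝ) : Prop :=
  0 < R₀ ∧ 0 < C ∧
  (∀ i j, ContDiff ℝ (⊤ : ℕ∞) fun x => σ x i j) ∧
  (∀ x, (σ x).PosDef) ∧
  (∃ B, ∀ ξ, R₀ < ξ → 0 < ω ξ ∧ ω ξ ≤ B) ∧
  Tendsto ω atTop (nhds 0) ∧
  ∀ x : EuclideanSpace ℝ (Fin n), R₀ ≤ ‖x‖ →
    (∀ i j, |σ x i j - (1 : Matrix (Fin n) (Fin n) ℝ) i j| ≤ C * ω ‖x‖) ∧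
    (∀ i j k, |pd k (fun y => σ y i j) x| ≤ C * ω ‖x‖ / ‖x‖)

/-- Ricci curvature of `σ` in coordinates:
`R_{jl} = ∂_iΓ^i_{jl} − ∂_jΓ^i_{il} + Γ^i_{ip}Γ^p_{jl} − Γ^i_{jp}Γ^p_{il}`. -/
def ricci {n : ℕ} (σ : EuclideanSpace ℝ (Fin n) → Matrix (Fin n) (Fin n) ℝ)
    (j l : Fin n) (x : EuclideanSpace ℝ (Fin n)) : ℝ :=
  (∑ i, pd i (fun y => christoffel σ i j l y) x)
    - (∑ i, pd j (fun y => christoffel σ i i l y) x)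
    + (∑ i, ∑ p, christoffel σ i i p x * christoffel σ p j l x)
    - (∑ i, ∑ p, christoffel σ i j p x * christoffel σ p i l x)

set_option linter.unusedSectionVars false
set_option maxSynthPendingDepth 5
set_option synthInstance.maxHeartbeats 200000

section Taylor

variable {X Y : Type*} [NormedAddCommGroup X] [NormedSpace ℝ X] [NormedAddCommGroup Y]
  [NormedSpace ℝ Y]

/-- A continuous function is bounded on closed balls. -/
theorem exists_bound_closedBall [ProperSpace X] {F : X → Y} (hF : Continuous F) (r : ℝ) :
    ∃ C, 0 ≤ C ∧ ∀ m, ‖m‖ ≤ r → ‖F m‖ ≤ C := by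
  obtain ⟨C, hC⟩ := (isCompact_closedBall (0 : X) r).exists_bound_of_continuousOn
    hF.continuousOn
  exact ⟨max C 0, le_max_right _ _, fun m hm =>
    (hC m (by simpa using hm)).trans (le_max_left _ _)⟩

theorem ContDiff.fderiv_smooth {F : X → Y} (hF : ContDiff ℝ (⊤ : ℕ∞) F) :
    ContDiff ℝ (⊤ : ℕ∞) (fderiv ℝ F) :=
  hF.fderiv_right (by simp)

theorem ContDiff.hasFDerivAt_smooth {F : X → Y} (hF : ContDiff ℝ (⊤ : ℕ∞) F) (x : X) :
    HasFDerivAt F (fderiv ℝ F x) x :=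
  (hF.differentiable (by simp) x).hasFDerivAt

theorem hasDerivAt_comp_line {F : X → Y} {F' : X →L[ℝ] Y} {x v : X} {s : ℝ}
    (hF : HasFDerivAt F F' (x + s • v)) : HasDerivAt (fun s : ℝ => F (x + s • v)) (F' v) s := by
  have h : HasDerivAt (fun s : ℝ => x + s • v) v s := by
    simpa using ((hasDerivAt_id s).smul_const v).const_add x
  exact hF.comp_hasDerivAt s h

theorem exists_taylor_one [ProperSpace X] {F : X → Y} (hF : ContDiff ℝ (⊤ : ℕ∞) F) (r : ℝ) :
    ∃ C, 0 ≤ C ∧ ∀ m v, ‖m‖ ≤ r → ‖v‖ ≤ 1 → ‖F (m + v) - F m‖ ≤ C * ‖v‖ := by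
  obtain ⟨C, hC0, hC⟩ := exists_bound_closedBall (hF.fderiv_smooth.continuous) (r + 1)
  refine ⟨C, hC0, fun m v hm hv => ?_⟩
  have h := norm_image_sub_le_of_norm_deriv_le_segment_01'
    (f := fun s : ℝ => F (m + s • v)) (f' := fun s => fderiv ℝ F (m + s • v) v) (C := C * ‖v‖)
    (fun s _ => (hasDerivAt_comp_line (hF.hasFDerivAt_smooth _)).hasDerivWithinAt) ?_
  · simpa using h
  · intro s hs
    refine (ContinuousLinearMap.le_opNorm _ _).trans ?_
    gcongr
    refine hC _ ((norm_add_le _ _).trans (add_le_add hm ?_))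
    rw [norm_smul, Real.norm_of_nonneg hs.1]
    nlinarith [hs.1, hs.2, norm_nonneg v]

theorem norm_smul_le_of_mem_Ico {s : ℝ} (hs : s ∈ Ico (0 : ℝ) 1) (v : X) : ‖s • v‖ ≤ ‖v‖ := by
  rw [norm_smul, Real.norm_of_nonneg hs.1]
  nlinarith [hs.1, hs.2, norm_nonneg v]

theorem exists_taylor_two [ProperSpace X] {F : X → Y} (hF : ContDiff ℝ (⊤ : ℕ∞) F) (r : ℝ) :
    ∃ C, 0 ≤ C ∧ ∀ m v, ‖m‖ ≤ r → ‖v‖ ≤ 1 →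
      ‖F (m + v) - F m - fderiv ℝ F m v‖ ≤ C * ‖v‖ ^ 2 := by
  obtain ⟨C, hC0, hC⟩ := exists_taylor_one hF.fderiv_smooth r
  refine ⟨C, hC0, fun m v hm hv => ?_⟩
  have h := norm_image_sub_le_of_norm_deriv_le_segment_01'
    (f := fun s : ℝ => F (m + s • v) - s • fderiv ℝ F m v)
    (f' := fun s => fderiv ℝ F (m + s • v) v - fderiv ℝ F m v) (C := C * ‖v‖ ^ 2)
    (fun s _ => ((hasDerivAt_comp_line (hF.hasFDerivAt_smooth _)).sub
      (by simpa using (hasDerivAt_id s).smul_const (fderiv ℝ F m v))).hasDerivWithinAt) ?_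
  · simpa [sub_right_comm] using h
  · intro s hs
    rw [← sub_apply]
    refine (ContinuousLinearMap.le_opNorm _ _).trans ?_
    rw [pow_two, ← mul_assoc]
    have hsv := norm_smul_le_of_mem_Ico hs v
    gcongr
    exact (hC _ _ hm (hsv.trans hv)).trans (by gcongr)

theorem exists_taylor_odd [ProperSpace X] {F : X → Y} (hF : ContDiff ℝ (⊤ : ℕ∞) F) (r : ℝ) :
    ∃ C, 0 ≤ C ∧ ∀ m v, ‖m‖ ≤ r → ‖v‖ ≤ 1 →
      ‖F (m + v) - F (m - v) - (2 : ℝ) • fderiv ℝ F m v‖ ≤ C * ‖v‖ ^ 3 := by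
  obtain ⟨C, hC0, hC⟩ := exists_taylor_two hF.fderiv_smooth r
  refine ⟨2 * C, by positivity, fun m v hm hv => ?_⟩
  have h := norm_image_sub_le_of_norm_deriv_le_segment_01'
    (f := fun s : ℝ => F (m + s • v) - F (m + s • (-v)) - s • ((2 : ℝ) • fderiv ℝ F m v))
    (f' := fun s => fderiv ℝ F (m + s • v) v - fderiv ℝ F (m + s • (-v)) (-v)
      - (2 : ℝ) • fderiv ℝ F m v) (C := 2 * C * ‖v‖ ^ 3)
    (fun s _ => (((hasDerivAt_comp_line (hF.hasFDerivAt_smooth _)).sub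
      (hasDerivAt_comp_line (hF.hasFDerivAt_smooth _))).sub (by
        simpa using (hasDerivAt_id s).smul_const
          ((2 : ℝ) • fderiv ℝ F m v))).hasDerivWithinAt) ?_
  · simp only [one_smul, zero_smul, add_zero, sub_self, sub_zero, ← sub_eq_add_neg] at h
    exact h
  · intro s hs
    have hsv := norm_smul_le_of_mem_Ico hs v
    have h1 := hC m (s • v) hm (hsv.trans hv)
    have h2 := hC m (-(s • v)) hm (by rw [norm_neg]; exact hsv.trans hv)
    rw [norm_neg] at h2
    have e : fderiv ℝ F (m + s • v) v - fderiv ℝ F (m + s • (-v)) (-v)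
        - (2 : ℝ) • fderiv ℝ F m v =
        ((fderiv ℝ F (m + s • v) - fderiv ℝ F m - fderiv ℝ (fderiv ℝ F) m (s • v)) +
          (fderiv ℝ F (m + -(s • v)) - fderiv ℝ F m - fderiv ℝ (fderiv ℝ F) m (-(s • v)))) v := by
      simp only [smul_neg, map_neg, add_apply, sub_apply,
        neg_apply, two_smul]
      abel
    rw [e]
    refine (ContinuousLinearMap.le_opNorm _ _).trans ?_
    calc _ ≤ (C * ‖s • v‖ ^ 2 + C * ‖s • v‖ ^ 2) * ‖v‖ := by
          gcongr
          exact (norm_add_le _ _).trans (add_le_add h1 h2)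
      _ ≤ (C * ‖v‖ ^ 2 + C * ‖v‖ ^ 2) * ‖v‖ := by gcongr
      _ = 2 * C * ‖v‖ ^ 3 := by ring

end Taylor

section Order

variable {P X Y Z W : Type*} [NormedAddCommGroup X] [NormedSpace ℝ X]
  [NormedAddCommGroup Y] [NormedSpace ℝ Y] [NormedAddCommGroup Z] [NormedSpace ℝ Z]

/-- `f` is `O(‖ξ‖ᵏ)` along `l`. -/
def BigOrd (l : Filter P) (ξ : P → X) (k : ℕ) (f : P → Y) : Prop :=
  f =O[l] fun p => ‖ξ p‖ ^ k

namespace BigOrd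

variable {l : Filter P} {ξ : P → X} {j k : ℕ} {f g : P → Y}

theorem add (hf : BigOrd l ξ k f) (hg : BigOrd l ξ k g) : BigOrd l ξ k (fun p => f p + g p) :=
  Asymptotics.IsBigO.add hf hg

theorem sub (hf : BigOrd l ξ k f) (hg : BigOrd l ξ k g) : BigOrd l ξ k (fun p => f p - g p) :=
  Asymptotics.IsBigO.sub hf hg

theorem neg (hf : BigOrd l ξ k f) : BigOrd l ξ k (fun p => -f p) :=
  Asymptotics.IsBigO.neg_left hf

theorem smul (c : ℝ) (hf : BigOrd l ξ k f) : BigOrd l ξ k (fun p => c • f p) :=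
  Asymptotics.IsBigO.const_smul_left hf c

theorem const_mul (c : ℝ) {f : P → ℝ} (hf : BigOrd l ξ k f) : BigOrd l ξ k (fun p => c * f p) :=
  Asymptotics.IsBigO.const_mul_left hf c

theorem mul {f g : P → ℝ} (hf : BigOrd l ξ j f) (hg : BigOrd l ξ k g) :
    BigOrd l ξ (j + k) (fun p => f p * g p) := by
  simpa only [BigOrd, pow_add] using Asymptotics.IsBigO.mul hf hg

theorem ap {A : P → Y →L[ℝ] Z} {v : P → Y} (hA : BigOrd l ξ j A) (hv : BigOrd l ξ k v) :
    BigOrd l ξ (j + k) (fun p => A p (v p)) := by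
  have h : BigOrd l ξ (j + k) (fun p => ‖A p‖ * ‖v p‖) :=
    BigOrd.mul (Asymptotics.IsBigO.norm_left hA) (Asymptotics.IsBigO.norm_left hv)
  refine Asymptotics.IsBigO.trans (Asymptotics.IsBigO.of_norm_le fun p => ?_) h
  exact (A p).le_opNorm _

theorem self (l : Filter P) (ξ : P → X) : BigOrd l ξ 1 ξ := by
  refine Asymptotics.IsBigO.of_norm_le fun p => by simp

theorem mono (hξ : Tendsto ξ l (nhds 0)) (hf : BigOrd l ξ k f) (hjk : j ≤ k) : BigOrd l ξ j f := by
  refine Asymptotics.IsBigO.trans hf ?_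
  refine Asymptotics.IsBigO.of_bound 1 ?_
  have : ∀ᶠ p in l, ‖ξ p‖ ≤ 1 := by
    filter_upwards [hξ (Metric.closedBall_mem_nhds 0 one_pos)] with p hp
    simpa using hp
  filter_upwards [this] with p hp
  simp only [norm_pow, norm_norm, one_mul]
  exact pow_le_pow_of_le_one (norm_nonneg _) hp hjk

theorem congr (hf : BigOrd l ξ k f) (h : ∀ p, g p = f p) : BigOrd l ξ k g := by
  rwa [show g = f from funext h]

theorem congr' (hf : BigOrd l ξ k f) (h : ∀ᶠ p in l, g p = f p) : BigOrd l ξ k g :=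
  Asymptotics.IsBigO.congr' hf (h.mono fun _ => Eq.symm) (Eventually.of_forall fun _ => rfl)

theorem eventually_le {X' : Type*} [NormedAddCommGroup X'] {v : P → X'} {C : ℝ}
    (h : ∀ᶠ p in l, ‖v p‖ ≤ C * ‖ξ p‖ ^ k) : v =O[l] fun p => ‖ξ p‖ ^ k := by
  refine Asymptotics.IsBigO.of_bound C ?_
  simpa using h

end BigOrd

/-- The filter of parameters in `A` for which `ξ` tends to zero. -/
def smallFilter (A : Set P) (ξ : P → X) : Filter P := comap ξ (nhds 0) ⊓ 𝓟 A

theorem tendsto_smallFilter (A : Set P) (ξ : P → X) :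
    Tendsto ξ (smallFilter A ξ) (nhds 0) :=
  tendsto_comap.mono_left inf_le_left

theorem eventually_smallFilter_mem (A : Set P) (ξ : P → X) :
    ∀ᶠ p in smallFilter A ξ, p ∈ A :=
  mem_inf_of_right (mem_principal_self A)

theorem eventually_smallFilter {A : Set P} {ξ : P → X} {q : P → Prop}
    (h : ∀ᶠ p in smallFilter A ξ, q p) : ∃ δ > 0, ∀ p ∈ A, ‖ξ p‖ ≤ δ → q p := by
  rw [smallFilter, eventually_inf_principal, eventually_comap] at h
  obtain ⟨δ, hδ, H⟩ := Metric.eventually_nhds_iff.1 h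
  exact ⟨δ / 2, by positivity, fun p hp hpδ => H (by rw [dist_zero_right]; linarith) p rfl hp⟩

theorem BigOrd.exists_bound {A : Set P} {ξ : P → X} {k : ℕ} {f : P → Y}
    (h : BigOrd (smallFilter A ξ) ξ k f) :
    ∃ C δ, 0 ≤ C ∧ 0 < δ ∧ ∀ p ∈ A, ‖ξ p‖ ≤ δ → ‖f p‖ ≤ C * ‖ξ p‖ ^ k := by
  obtain ⟨C, hC, hb⟩ := Asymptotics.IsBigO.exists_nonneg h
  obtain ⟨δ, hδ, H⟩ := eventually_smallFilter hb.bound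
  exact ⟨C, δ, hC, hδ, fun p hp hpδ => by simpa using H p hp hpδ⟩

section Smooth

variable [ProperSpace X] {l : Filter P} {m ξ : P → X} {F : X → Y} {r : ℝ}

theorem BigOrd.eval (hF : Continuous F) (hm : ∀ᶠ p in l, ‖m p‖ ≤ r) :
    BigOrd l ξ 0 (fun p => F (m p)) := by
  obtain ⟨C, -, hC⟩ := exists_bound_closedBall hF r
  exact BigOrd.eventually_le (C := C) (hm.mono fun p hp => by simpa using hC _ hp)

theorem BigOrd.bound_smul (hm : ∀ᶠ p in l, ‖m p‖ ≤ r) (hξ : Tendsto ξ l (nhds 0)) (c : ℝ) :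
    ∀ᶠ p in l, ‖m p‖ ≤ r ∧ ‖c • ξ p‖ ≤ 1 := by
  have h : Tendsto (fun p => c • ξ p) l (nhds 0) := by simpa using hξ.const_smul c
  filter_upwards [hm, h (Metric.closedBall_mem_nhds 0 one_pos)] with p h1 h2
  exact ⟨h1, by simpa using h2⟩

theorem BigOrd.shift (hF : ContDiff ℝ (⊤ : ℕ∞) F) (hm : ∀ᶠ p in l, ‖m p‖ ≤ r)
    (hξ : Tendsto ξ l (nhds 0)) (c : ℝ) :
    BigOrd l ξ 0 (fun p => F (m p + c • ξ p)) := by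
  refine BigOrd.eval (r := r + 1) hF.continuous ?_
  filter_upwards [BigOrd.bound_smul hm hξ c] with p hp
  exact (norm_add_le _ _).trans (add_le_add hp.1 hp.2)

theorem BigOrd.taylor_one (hF : ContDiff ℝ (⊤ : ℕ∞) F) (hm : ∀ᶠ p in l, ‖m p‖ ≤ r)
    (hξ : Tendsto ξ l (nhds 0)) (c : ℝ) :
    BigOrd l ξ 1 (fun p => F (m p + c • ξ p) - F (m p)) := by
  obtain ⟨C, -, hC⟩ := exists_taylor_one hF r
  refine BigOrd.eventually_le (C := C * |c|) ((BigOrd.bound_smul hm hξ c).mono fun p hp => ?_)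
  refine (hC _ _ hp.1 hp.2).trans (le_of_eq ?_)
  rw [norm_smul, Real.norm_eq_abs]; ring

theorem BigOrd.taylor_two (hF : ContDiff ℝ (⊤ : ℕ∞) F) (hm : ∀ᶠ p in l, ‖m p‖ ≤ r)
    (hξ : Tendsto ξ l (nhds 0)) (c : ℝ) :
    BigOrd l ξ 2 (fun p => F (m p + c • ξ p) - F (m p) - c • fderiv ℝ F (m p) (ξ p)) := by
  obtain ⟨C, -, hC⟩ := exists_taylor_two hF r
  refine BigOrd.eventually_le (C := C * |c| ^ 2) ((BigOrd.bound_smul hm hξ c).mono fun p hp => ?_)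
  have := hC _ _ hp.1 hp.2
  rw [map_smul] at this
  refine this.trans (le_of_eq ?_)
  rw [norm_smul, Real.norm_eq_abs]; ring

theorem BigOrd.taylor_odd (hF : ContDiff ℝ (⊤ : ℕ∞) F) (hm : ∀ᶠ p in l, ‖m p‖ ≤ r)
    (hξ : Tendsto ξ l (nhds 0)) (c : ℝ) :
    BigOrd l ξ 3 (fun p => F (m p + c • ξ p) - F (m p + (-c) • ξ p)
      - (2 * c) • fderiv ℝ F (m p) (ξ p)) := by
  obtain ⟨C, -, hC⟩ := exists_taylor_odd hF r
  refine BigOrd.eventually_le (C := C * |c| ^ 3) ((BigOrd.bound_smul hm hξ c).mono fun p hp => ?_)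
  have := hC _ _ hp.1 hp.2
  rw [map_smul, smul_smul] at this
  rw [neg_smul, ← sub_eq_add_neg]
  refine this.trans (le_of_eq ?_)
  rw [norm_smul, Real.norm_eq_abs]; ring

end Smooth
end Order

/-- A smooth field of inner products together with its Levi-Civita connection coefficients. -/
structure MetricPair (X : Type*) [NormedAddCommGroup X] [NormedSpace ℝ X] where
  /-- the inner products -/
  S : X → X →L[ℝ] X →L[ℝ] ℝ
  /-- the connection coefficients -/
  Γ : X → X →L[ℝ] X →L[ℝ] X
  contDiff_S : ContDiff ℝ (⊤ : ℕ∞) S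
  contDiff_Γ : ContDiff ℝ (⊤ : ℕ∞) Γ
  S_symm : ∀ x a b, S x a b = S x b a
  Γ_symm : ∀ x a b, Γ x a b = Γ x b a
  compat : ∀ x c a b, fderiv ℝ S x c a b = S x (Γ x c a) b + S x a (Γ x c b)
  pos : ∀ x a, a ≠ 0 → 0 < S x a a

namespace MetricPair

variable {X : Type*} [NormedAddCommGroup X] [NormedSpace ℝ X] (M : MetricPair X)

/-- The differential in the endpoint `m + ξ/2` of the squared midpoint distance. -/
def dE (m ξ a : X) : ℝ := 2⁻¹ * fderiv ℝ M.S m a ξ ξ + 2 * M.S m ξ a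

/-- The first variation of the squared midpoint distance. -/
def E1 (m ξ V W : X) : ℝ := fderiv ℝ M.S m ((2⁻¹ : ℝ) • (V + W)) ξ ξ + 2 * M.S m ξ (V - W)

/-- The covariant second variation of the squared midpoint distance. -/
def E2 (m ξ V W : X) : ℝ :=
  fderiv ℝ (fderiv ℝ M.S) m ((2⁻¹ : ℝ) • (V + W)) ((2⁻¹ : ℝ) • (V + W)) ξ ξ
    + 4 * fderiv ℝ M.S m ((2⁻¹ : ℝ) • (V + W)) ξ (V - W) + 2 * M.S m (V - W) (V - W)
    - M.dE m ξ (M.Γ (m + (2⁻¹ : ℝ) • ξ) V V) - M.dE m (-ξ) (M.Γ (m + (-2⁻¹ : ℝ) • ξ) W W)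

/-- Approximate parallel transport from `m + ξ/2` to `m - ξ/2`. -/
def transp (m ξ V : X) : X := V + M.Γ m ξ V + (2⁻¹ : ℝ) • M.Γ m ξ (M.Γ m ξ V)

/-- The curvature operator `R(V, ξ) Z`. -/
def curv (x V ξ Z : X) : X :=
  fderiv ℝ M.Γ x V ξ Z - fderiv ℝ M.Γ x ξ V Z + M.Γ x V (M.Γ x ξ Z) - M.Γ x ξ (M.Γ x V Z)

theorem fderiv_fderiv_S (m c d a b : X) :
    fderiv ℝ (fderiv ℝ M.S) m c d a b =
      fderiv ℝ M.S m c (M.Γ m d a) b + M.S m (fderiv ℝ M.Γ m c d a) b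
        + (fderiv ℝ M.S m c a (M.Γ m d b) + M.S m a (fderiv ℝ M.Γ m c d b)) := by
  have hS := M.contDiff_S.hasFDerivAt_smooth m
  have hΓ := M.contDiff_Γ.hasFDerivAt_smooth m
  have h1 := (((M.contDiff_S.fderiv_smooth.hasFDerivAt_smooth m).clm_apply
    (hasFDerivAt_const d m)).clm_apply (hasFDerivAt_const a m)).clm_apply (hasFDerivAt_const b m)
  have h2 := ((hS.clm_apply ((hΓ.clm_apply (hasFDerivAt_const d m)).clm_apply
    (hasFDerivAt_const a m))).clm_apply (hasFDerivAt_const b m)).add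
    ((hS.clm_apply (hasFDerivAt_const a m)).clm_apply ((hΓ.clm_apply
        (hasFDerivAt_const d m)).clm_apply
    (hasFDerivAt_const b m)))
  have h3 : (fun x => fderiv ℝ M.S x d a b) =
      (fun x => M.S x (M.Γ x d a) b) + fun x => M.S x a (M.Γ x d b) :=
    funext fun x => M.compat x d a b
  rw [h3] at h1
  have := DFunLike.congr_fun (h1.unique h2) c
  simp at this
  linarith

theorem fderiv_Γ_symm (m c a b : X) : fderiv ℝ M.Γ m c a b = fderiv ℝ M.Γ m c b a := by
  have h1 := ((M.contDiff_Γ.hasFDerivAt_smooth m).clm_apply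
    (hasFDerivAt_const a m)).clm_apply (hasFDerivAt_const b m)
  have h2 := ((M.contDiff_Γ.hasFDerivAt_smooth m).clm_apply
    (hasFDerivAt_const b m)).clm_apply (hasFDerivAt_const a m)
  simp only [M.Γ_symm _ b a] at h2
  simpa using DFunLike.congr_fun (h1.unique h2) c

theorem fderiv_S_symm (m c a b : X) : fderiv ℝ M.S m c a b = fderiv ℝ M.S m c b a := by
  rw [M.compat, M.compat, M.S_symm m (M.Γ m c a), M.S_symm m a]; ring

theorem curv_skew (x V ξ a b : X) :
    M.S x (M.curv x V ξ a) b + M.S x a (M.curv x V ξ b) = 0 := by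
  have hs := (M.contDiff_S.contDiffAt (x := x)).isSymmSndFDerivAt
      (by simp; exact WithTop.coe_le_coe.2 le_top) V ξ
  have h := congrArg (fun A => A a b) hs
  simp only [fderiv_fderiv_S, M.compat] at h
  simp only [curv, map_add, map_sub, add_apply, sub_apply]
  linarith

end MetricPair

namespace MetricPair

variable {X : Type*} [NormedAddCommGroup X] [NormedSpace ℝ X] [ProperSpace X] (M : MetricPair X)

section Asymptotics

variable {P : Type*} {l : Filter P} {m ξ V r ν : P → X} {ρ : ℝ} {j : ℕ}

theorem ord_transp_norm (hm : ∀ᶠ p in l, ‖m p‖ ≤ ρ) (hξ : Tendsto ξ l (nhds 0))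
    (hV : BigOrd l ξ 0 V) :
    BigOrd l ξ 3 fun p =>
      M.S (m p + (-2⁻¹ : ℝ) • ξ p) (M.transp (m p) (ξ p) (V p)) (M.transp (m p) (ξ p) (V p))
        - M.S (m p + (2⁻¹ : ℝ) • ξ p) (V p) (V p) := by
  have hΓ : BigOrd l ξ 0 fun p => M.Γ (m p) := BigOrd.eval M.contDiff_Γ.continuous hm
  have ha := (hΓ.ap (BigOrd.self l ξ)).ap hV
  have hb := (hΓ.ap (BigOrd.self l ξ)).ap ha
  have h1 := BigOrd.taylor_odd M.contDiff_S hm hξ 2⁻¹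
  have h2 := BigOrd.taylor_two M.contDiff_S hm hξ (-2⁻¹)
  have h3 := BigOrd.taylor_one M.contDiff_S hm hξ (-2⁻¹)
  have h4 := BigOrd.shift M.contDiff_S hm hξ (-2⁻¹)
  refine ((((((h1.ap hV).ap hV).neg.add (((h2.ap hV).ap ha).const_mul 2)).add
    ((h3.ap ha).ap ha)).add ((h3.ap hV).ap hb)).add
    ((((h4.ap ha).ap hb)).add
      ((((h4.ap hb).ap hb).const_mul 4⁻¹).mono hξ (by norm_num : 3 ≤ _)))).congr fun p => ?_
  have c1 := M.compat (m p) (ξ p) (V p) (V p)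
  have c2 := M.compat (m p) (ξ p) (V p) (M.Γ (m p) (ξ p) (V p))
  have s := M.S_symm (m p + (-2⁻¹ : ℝ) • ξ p)
  have s' := M.S_symm (m p)
  simp only [transp, map_add, map_smul, add_apply, sub_apply, smul_apply, smul_eq_mul]
  rw [s (M.Γ (m p) (ξ p) (V p)) (V p), s (M.Γ (m p) (ξ p) (M.Γ (m p) (ξ p) (V p))) (V p),
    s (M.Γ (m p) (ξ p) (M.Γ (m p) (ξ p) (V p))) (M.Γ (m p) (ξ p) (V p))]
  rw [s' (M.Γ (m p) (ξ p) (V p)) (V p)] at c1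
  linear_combination -c1 - c2

theorem ord_curv_sub (hm : ∀ᶠ p in l, ‖m p‖ ≤ ρ) (hξ : Tendsto ξ l (nhds 0))
    (hV : BigOrd l ξ j V) :
    BigOrd l ξ (3 + 2 * j) fun p =>
      M.S (m p) (ξ p) (M.curv (m p) (V p) (ξ p) (V p)) -
        M.S (m p + (2⁻¹ : ℝ) • ξ p) (ξ p)
          (M.curv (m p + (2⁻¹ : ℝ) • ξ p) (V p) (ξ p) (V p)) := by
  have hx := BigOrd.self l ξ
  have hS : BigOrd l ξ 0 fun p => M.S (m p) := BigOrd.eval M.contDiff_S.continuous hm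
  have hΓ : BigOrd l ξ 0 fun p => M.Γ (m p) := BigOrd.eval M.contDiff_Γ.continuous hm
  have hS1 := BigOrd.taylor_one M.contDiff_S hm hξ 2⁻¹
  have hΓ1 := BigOrd.taylor_one M.contDiff_Γ hm hξ 2⁻¹
  have hD1 := BigOrd.taylor_one M.contDiff_Γ.fderiv_smooth hm hξ 2⁻¹
  have hΓ' := BigOrd.shift M.contDiff_Γ hm hξ 2⁻¹
  have hD' := BigOrd.shift M.contDiff_Γ.fderiv_smooth hm hξ 2⁻¹
  have hdiff : BigOrd l ξ (2 + 2 * j) fun p =>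
      M.curv (m p + (2⁻¹ : ℝ) • ξ p) (V p) (ξ p) (V p) - M.curv (m p) (V p) (ξ p) (V p) := by
    refine (((((((hD1.ap hV).ap hx).ap hV).mono hξ (by omega : 2 + 2 * j ≤ _)).sub
      ((((hD1.ap hx).ap hV).ap hV).mono hξ (by omega))).add
      ((((hΓ1.ap hV).ap ((hΓ'.ap hx).ap hV)).mono hξ (by omega : 2 + 2 * j ≤ _)).add
       (((hΓ.ap hV).ap ((hΓ1.ap hx).ap hV)).mono hξ (by omega)))).sub
      ((((hΓ1.ap hx).ap ((hΓ'.ap hV).ap hV)).mono hξ (by omega : 2 + 2 * j ≤ _)).add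
       (((hΓ.ap hx).ap ((hΓ1.ap hV).ap hV)).mono hξ (by omega)))).congr fun p => ?_
    simp only [curv, map_sub, sub_apply]
    abel
  have hc : BigOrd l ξ (1 + 2 * j) fun p =>
      M.curv (m p + (2⁻¹ : ℝ) • ξ p) (V p) (ξ p) (V p) := by
    exact (((((((hD'.ap hV).ap hx).ap hV).mono hξ (by omega : 1 + 2 * j ≤ _)).sub
      ((((hD'.ap hx).ap hV).ap hV).mono hξ (by omega))).add
      (((hΓ'.ap hV).ap ((hΓ'.ap hx).ap hV)).mono hξ (by omega))).sub
      (((hΓ'.ap hx).ap ((hΓ'.ap hV).ap hV)).mono hξ (by omega)))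
  refine (((((hS1.ap hx).ap hc).mono hξ (by omega : 3 + 2 * j ≤ _)).add
    (((hS.ap hx).ap hdiff).mono hξ (by omega))).neg).congr fun p => ?_
  simp only [map_sub, sub_apply]
  ring

set_option maxHeartbeats 2000000 in
theorem ord_E2 (hm : ∀ᶠ p in l, ‖m p‖ ≤ ρ) (hξ : Tendsto ξ l (nhds 0))
    (hV : BigOrd l ξ j V) (hr : BigOrd l ξ (2 + j) r) :
    BigOrd l ξ (3 + 2 * j) fun p =>
      M.E2 (m p) (ξ p) (V p) (M.transp (m p) (ξ p) (V p) + r p)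
        - 2 * M.S (m p + (2⁻¹ : ℝ) • ξ p) (ξ p)
          (M.curv (m p + (2⁻¹ : ℝ) • ξ p) (V p) (ξ p) (V p)) := by
  have hx := BigOrd.self l ξ
  have hS : BigOrd l ξ 0 fun p => M.S (m p) := BigOrd.eval M.contDiff_S.continuous hm
  have hΓ : BigOrd l ξ 0 fun p => M.Γ (m p) := BigOrd.eval M.contDiff_Γ.continuous hm
  have hD : BigOrd l ξ 0 fun p => fderiv ℝ M.S (m p) :=
    BigOrd.eval M.contDiff_S.fderiv_smooth.continuous hm
  have hDD : BigOrd l ξ 0 fun p => fderiv ℝ (fderiv ℝ M.S) (m p) :=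
    BigOrd.eval M.contDiff_S.fderiv_smooth.fderiv_smooth.continuous hm
  have ha : BigOrd l ξ (1 + j) fun p => M.Γ (m p) (ξ p) (V p) :=
    ((hΓ.ap hx).ap hV).mono hξ (by omega)
  have hb : BigOrd l ξ (2 + j) fun p => M.Γ (m p) (ξ p) (M.Γ (m p) (ξ p) (V p)) :=
    ((hΓ.ap hx).ap ha).mono hξ (by omega)
  have hg : BigOrd l ξ (2 + j) fun p =>
      (2⁻¹ : ℝ) • M.Γ (m p) (ξ p) (M.Γ (m p) (ξ p) (V p)) + r p := (hb.smul _).add hr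
  have hag : BigOrd l ξ (1 + j) fun p => M.Γ (m p) (ξ p) (V p) +
      ((2⁻¹ : ℝ) • M.Γ (m p) (ξ p) (M.Γ (m p) (ξ p) (V p)) + r p) :=
    ha.add (hg.mono hξ (by omega))
  have hW : BigOrd l ξ j fun p => V p + (M.Γ (m p) (ξ p) (V p) +
      ((2⁻¹ : ℝ) • M.Γ (m p) (ξ p) (M.Γ (m p) (ξ p) (V p)) + r p)) :=
    hV.add (hag.mono hξ (by omega))
  have hΓy := BigOrd.taylor_one M.contDiff_Γ hm hξ 2⁻¹
  have hΓx := BigOrd.taylor_one M.contDiff_Γ hm hξ (-2⁻¹)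
  have hΓo := BigOrd.taylor_odd M.contDiff_Γ hm hξ 2⁻¹
  have T1 : BigOrd l ξ (3 + 2 * j) _ :=
    (((((hDD.ap hag).ap hV).ap hx).ap hx).mono hξ (by omega))
  have T1' : BigOrd l ξ (3 + 2 * j) _ :=
    (((((hDD.ap hV).ap hag).ap hx).ap hx).mono hξ (by omega))
  have T1'' : BigOrd l ξ (3 + 2 * j) _ :=
    (((((hDD.ap hag).ap hag).ap hx).ap hx).mono hξ (by omega))
  have T2 : BigOrd l ξ (3 + 2 * j) _ := (((hD.ap hag).ap hx).ap hag).mono hξ (by omega)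
  have T2' : BigOrd l ξ (3 + 2 * j) _ := (((hD.ap hV).ap hx).ap hg).mono hξ (by omega)
  have T3 : BigOrd l ξ (3 + 2 * j) _ := ((hS.ap ha).ap hg).mono hξ (by omega)
  have T3' : BigOrd l ξ (3 + 2 * j) _ := ((hS.ap hg).ap hg).mono hξ (by omega)
  have T4 : BigOrd l ξ (3 + 2 * j) _ :=
    (((hD.ap ((hΓy.ap hV).ap hV)).ap hx).ap hx).mono hξ (by omega)
  have T5 : BigOrd l ξ (3 + 2 * j) _ :=
    (((hD.ap ((hΓx.ap hW).ap hW)).ap hx).ap hx).mono hξ (by omega)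
  have T5' : BigOrd l ξ (3 + 2 * j) _ :=
    (((hD.ap ((hΓ.ap hag).ap hV)).ap hx).ap hx).mono hξ (by omega)
  have T5'' : BigOrd l ξ (3 + 2 * j) _ :=
    (((hD.ap ((hΓ.ap hag).ap hag)).ap hx).ap hx).mono hξ (by omega)
  have T6 : BigOrd l ξ (3 + 2 * j) _ := ((hS.ap hx).ap ((hΓo.ap hV).ap hV)).mono hξ (by omega)
  have T7 : BigOrd l ξ (3 + 2 * j) _ := ((hS.ap hx).ap ((hΓx.ap hag).ap hV)).mono hξ (by omega)
  have T7' : BigOrd l ξ (3 + 2 * j) _ := ((hS.ap hx).ap ((hΓx.ap hag).ap hag)).mono hξ (by omega)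
  have T8 : BigOrd l ξ (3 + 2 * j) _ := ((hS.ap hx).ap ((hΓ.ap hV).ap hg)).mono hξ (by omega)
  have T8' : BigOrd l ξ (3 + 2 * j) _ := ((hS.ap hx).ap ((hΓ.ap hag).ap hag)).mono hξ (by omega)
  have T9 := M.ord_curv_sub hm hξ hV
  refine (((((((T1.const_mul 2⁻¹).add (T1'.const_mul 2⁻¹)).add (T1''.const_mul 4⁻¹)).add
    ((T2.const_mul (-2)).add (T2'.const_mul (-4)))).add
    ((T3.const_mul 4).add (T3'.const_mul 2))).add
    ((T4.const_mul (-2⁻¹)).add ((T5.const_mul (-2⁻¹)).add ((T5'.const_mul (-1)).add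
      (T5''.const_mul (-2⁻¹)))))).add
    (((T6.const_mul (-2)).add ((T7.const_mul 4).add (T7'.const_mul 2))).add
      ((T8.const_mul 4).add ((T8'.const_mul 2).add (T9.const_mul 2))))).congr fun p => ?_
  generalize hgg : (2⁻¹ : ℝ) • M.Γ (m p) (ξ p) (M.Γ (m p) (ξ p) (V p)) + r p = g
  have hWW : M.transp (m p) (ξ p) (V p) + r p = V p + (M.Γ (m p) (ξ p) (V p) + g) := by
    rw [← hgg, transp]; abel
  rw [hWW]
  have s' := M.S_symm (m p)
  have c2 := M.fderiv_fderiv_S (m p) (V p) (V p) (ξ p) (ξ p)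
  have c4 := M.compat (m p) (V p) (ξ p) (M.Γ (m p) (V p) (ξ p))
  have c5 := M.compat (m p) (M.Γ (m p) (V p) (V p)) (ξ p) (ξ p)
  rw [M.fderiv_S_symm, M.Γ_symm _ (V p) (ξ p), M.fderiv_Γ_symm _ _ (V p), s' _ (ξ p)] at c2
  rw [M.Γ_symm _ (V p) (ξ p)] at c4
  rw [M.Γ_symm _ _ (ξ p), s' _ (ξ p)] at c5
  simp only [dE, E2, curv, map_add, map_sub, map_smul, map_neg, add_apply, sub_apply, smul_apply,
    neg_apply, smul_eq_mul, smul_add]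
  clear * - c2 c4 c5 s'
  generalize M.Γ (m p) (ξ p) (V p) = a at *
  simp only [M.Γ_symm _ (V p) a, M.Γ_symm _ (V p) g, M.Γ_symm _ g a, s' g a] at *
  generalize m p = m at *
  linear_combination c2 - 2 * c4 - c5

end Asymptotics
end MetricPair

namespace MetricPair

variable {X : Type*} [NormedAddCommGroup X] [NormedSpace ℝ X] [ProperSpace X] (M : MetricPair X)

theorem E2_swap (m ξ V W : X) : M.E2 m (-ξ) W V = M.E2 m ξ V W := by
  simp only [E2, neg_neg, smul_neg, neg_smul, add_comm W V, ← neg_sub V W, map_neg, neg_apply]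
  ring

theorem E1_swap (m ξ V W : X) : M.E1 m (-ξ) W V = M.E1 m ξ V W := by
  simp only [E1, add_comm W V, ← neg_sub V W, map_neg, neg_apply]
  ring

theorem E2_neg_neg (m ξ V W : X) : M.E2 m ξ (-V) (-W) = M.E2 m ξ V W := by
  simp only [E2, dE, ← neg_add, neg_sub_neg, smul_neg, map_neg, neg_apply, neg_neg,
    ← neg_sub V W]

theorem E2_smul_zero (m ξ V : X) (c : ℝ) : M.E2 m ξ (c • V) 0 = c ^ 2 * M.E2 m ξ V 0 := by
  simp only [E2, dE, add_zero, sub_zero, map_smul, smul_apply, smul_eq_mul, map_zero, mul_zero,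
    zero_apply]
  ring

theorem E1_zero (m ξ ν : X) : M.E1 m ξ ν 0 = M.dE m ξ ν := by
  simp only [E1, dE, add_zero, sub_zero, map_smul, smul_apply, smul_eq_mul]

theorem transp_smul (m ξ V : X) (c : ℝ) : M.transp m ξ (c • V) = c • M.transp m ξ V := by
  simp only [transp, map_smul, smul_add, smul_comm c]

theorem exists_coercive (ρ : ℝ) :
    ∃ c, 0 < c ∧ ∀ z a, ‖z‖ ≤ ρ → c * ‖a‖ ^ 2 ≤ M.S z a a := by
  have hK : IsCompact (closedBall (0 : X) ρ ×ˢ sphere (0 : X) 1) :=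
    (isCompact_closedBall 0 ρ).prod (isCompact_sphere 0 1)
  have hcont : Continuous fun q : X × X => M.S q.1 q.2 q.2 :=
    ((M.contDiff_S.continuous.comp continuous_fst).clm_apply continuous_snd).clm_apply
      continuous_snd
  rcases (closedBall (0 : X) ρ ×ˢ sphere (0 : X) 1).eq_empty_or_nonempty with he | hne
  · refine ⟨1, one_pos, fun z a hz => ?_⟩
    by_cases ha : a = 0
    · simp [ha]
    · exfalso
      have : (z, ‖a‖⁻¹ • a) ∈ closedBall (0 : X) ρ ×ˢ sphere (0 : X) 1 := by
        simp [hz, norm_smul, ha]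
      rw [he] at this
      exact this
  · obtain ⟨q, hq, hmin⟩ := hK.exists_isMinOn hne hcont.continuousOn
    have hq2 : q.2 ≠ 0 := by
      intro h0
      have := hq.2
      simp [h0] at this
    refine ⟨M.S q.1 q.2 q.2, M.pos _ _ hq2, fun z a hz => ?_⟩
    by_cases ha : a = 0
    · simp [ha]
    · have hmem : (z, ‖a‖⁻¹ • a) ∈ closedBall (0 : X) ρ ×ˢ sphere (0 : X) 1 := by
        simp [hz, norm_smul, ha]
      have h1 : M.S q.1 q.2 q.2 ≤ M.S z (‖a‖⁻¹ • a) (‖a‖⁻¹ • a) := hmin hmem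
      simp only [map_smul, smul_apply, smul_eq_mul] at h1
      have hpos : 0 < ‖a‖ := norm_pos_iff.2 ha
      calc _ ≤ (‖a‖⁻¹ * (‖a‖⁻¹ * M.S z a a)) * ‖a‖ ^ 2 := by gcongr
        _ = M.S z a a := by field_simp

section Asymptotics

variable {P : Type*} {l : Filter P} {m ξ V r ν z w : P → X} {ρ : ℝ} {j k : ℕ}

theorem ord_of_S (hz : ∀ᶠ p in l, ‖z p‖ ≤ ρ) (h : BigOrd l ξ k fun p => M.S (z p) (w p)) :
    BigOrd l ξ k w := by
  obtain ⟨c, hc, H⟩ := M.exists_coercive ρ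
  refine Asymptotics.IsBigO.trans (Asymptotics.IsBigO.of_bound c⁻¹ ?_) h
  filter_upwards [hz] with p hp
  have h1 := H (z p) (w p) hp
  have h2 : M.S (z p) (w p) (w p) ≤ ‖M.S (z p) (w p)‖ * ‖w p‖ :=
    (le_abs_self _).trans ((M.S (z p) (w p)).le_opNorm _)
  by_cases h0 : ‖w p‖ = 0
  · rw [h0]; positivity
  · have hpos : 0 < ‖w p‖ := lt_of_le_of_ne (norm_nonneg _) (Ne.symm h0)
    rw [inv_mul_eq_div, le_div_iff₀ hc]
    nlinarith

theorem ord_nu (hm : ∀ᶠ p in l, ‖m p‖ ≤ ρ) (hξ : Tendsto ξ l (nhds 0))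
    (hν : ∀ᶠ p in l, ∀ a, M.S (m p + (2⁻¹ : ℝ) • ξ p) (ν p) a = 2⁻¹ * M.dE (m p) (ξ p) a) :
    BigOrd l ξ 3 fun p => ν p - (ξ p - (2⁻¹ : ℝ) • M.Γ (m p) (ξ p) (ξ p)) := by
  have hx := BigOrd.self l ξ
  have hΓ : BigOrd l ξ 0 fun p => M.Γ (m p) := BigOrd.eval M.contDiff_Γ.continuous hm
  have h1 := BigOrd.taylor_one M.contDiff_S hm hξ 2⁻¹
  have h2 := BigOrd.taylor_two M.contDiff_S hm hξ 2⁻¹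
  have hz : ∀ᶠ p in l, ‖m p + (2⁻¹ : ℝ) • ξ p‖ ≤ ρ + 1 :=
    (BigOrd.bound_smul hm hξ 2⁻¹).mono fun p hp =>
      (norm_add_le _ _).trans (add_le_add hp.1 hp.2)
  refine M.ord_of_S hz ?_
  refine ((h2.ap hx).neg.add ((h1.ap ((hΓ.ap hx).ap hx)).smul 2⁻¹)).congr' ?_
  filter_upwards [hν] with p hp
  ext a
  have c1 := M.compat (m p) (ξ p) (ξ p) a
  have c2 := M.compat (m p) a (ξ p) (ξ p)
  rw [M.Γ_symm _ a, M.S_symm _ _ (ξ p)] at c2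
  simp only [map_sub, map_smul, sub_apply, add_apply, neg_apply, smul_apply,
    smul_eq_mul, hp, dE]
  linear_combination -2⁻¹ * c1 + 4⁻¹ * c2

theorem ord_nu_norm (hm : ∀ᶠ p in l, ‖m p‖ ≤ ρ) (hξ : Tendsto ξ l (nhds 0))
    (hν : ∀ᶠ p in l, ∀ a, M.S (m p + (2⁻¹ : ℝ) • ξ p) (ν p) a = 2⁻¹ * M.dE (m p) (ξ p) a) :
    BigOrd l ξ 4 fun p =>
      M.S (m p + (2⁻¹ : ℝ) • ξ p) (ν p) (ν p) - M.S (m p) (ξ p) (ξ p) := by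
  have hx := BigOrd.self l ξ
  have hS : BigOrd l ξ 0 fun p => M.S (m p) := BigOrd.eval M.contDiff_S.continuous hm
  have hD : BigOrd l ξ 0 fun p => fderiv ℝ M.S (m p) :=
    BigOrd.eval M.contDiff_S.fderiv_smooth.continuous hm
  have hΓ : BigOrd l ξ 0 fun p => M.Γ (m p) := BigOrd.eval M.contDiff_Γ.continuous hm
  have hr := M.ord_nu hm hξ hν
  have T1 : BigOrd l ξ 4 _ := ((hD.ap ((hΓ.ap hx).ap hx)).ap hx).ap hx
  have T2 : BigOrd l ξ 4 _ := (((hD.ap hr).ap hx).ap hx).mono hξ (by omega)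
  have T3 : BigOrd l ξ 4 _ := (hS.ap hx).ap hr
  refine ((T1.const_mul (-8⁻¹)).add ((T2.const_mul 4⁻¹).add T3)).congr' ?_
  filter_upwards [hν] with p hp
  have c1 := M.compat (m p) (ξ p) (ξ p) (ξ p)
  rw [M.S_symm _ _ (ξ p)] at c1
  rw [hp]
  simp only [dE, map_sub, map_smul, sub_apply, smul_apply, smul_eq_mul]
  linear_combination 4⁻¹ * c1

theorem ord_E2_nu_zero (hm : ∀ᶠ p in l, ‖m p‖ ≤ ρ) (hξ : Tendsto ξ l (nhds 0))
    (hν : ∀ᶠ p in l, ∀ a, M.S (m p + (2⁻¹ : ℝ) • ξ p) (ν p) a = 2⁻¹ * M.dE (m p) (ξ p) a) :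
    BigOrd l ξ 4 fun p => M.E2 (m p) (ξ p) (ν p) 0 - 2 * M.S (m p) (ξ p) (ξ p) := by
  have hx := BigOrd.self l ξ
  have hS : BigOrd l ξ 0 fun p => M.S (m p) := BigOrd.eval M.contDiff_S.continuous hm
  have hD : BigOrd l ξ 0 fun p => fderiv ℝ M.S (m p) :=
    BigOrd.eval M.contDiff_S.fderiv_smooth.continuous hm
  have hDD : BigOrd l ξ 0 fun p => fderiv ℝ (fderiv ℝ M.S) (m p) :=
    BigOrd.eval M.contDiff_S.fderiv_smooth.fderiv_smooth.continuous hm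
  have hΓ : BigOrd l ξ 0 fun p => M.Γ (m p) := BigOrd.eval M.contDiff_Γ.continuous hm
  have hΓ' := BigOrd.shift M.contDiff_Γ hm hξ 2⁻¹
  have hΓ1 := BigOrd.taylor_one M.contDiff_Γ hm hξ 2⁻¹
  have hg : BigOrd l ξ 2 fun p => M.Γ (m p) (ξ p) (ξ p) := (hΓ.ap hx).ap hx
  have hr := M.ord_nu hm hξ hν
  have he : BigOrd l ξ 2 fun p => ν p - ξ p :=
    ((hr.mono hξ (by omega : 2 ≤ 3)).sub (hg.smul 2⁻¹)).congr fun p => by abel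
  have hn : BigOrd l ξ 1 ν := ((he.mono hξ (by omega : 1 ≤ 2)).add hx).congr fun p => by abel
  have T1 : BigOrd l ξ 4 _ := (((hDD.ap hn).ap hn).ap hx).ap hx
  have T2 : BigOrd l ξ 4 _ := ((hD.ap he).ap hx).ap hn
  have T3 : BigOrd l ξ 4 _ := ((hD.ap hx).ap hx).ap he
  have T4 : BigOrd l ξ 4 _ := (hS.ap he).ap he
  have T5 : BigOrd l ξ 4 _ := (hS.ap hx).ap hr
  have T6 : BigOrd l ξ 4 _ := (((hD.ap ((hΓ'.ap hn).ap hn)).ap hx).ap hx)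
  have T7 : BigOrd l ξ 4 _ := (hS.ap hx).ap ((hΓ1.ap hn).ap hn)
  have T8 : BigOrd l ξ 4 _ := (hS.ap hx).ap ((hΓ.ap he).ap hn)
  have T9 : BigOrd l ξ 4 _ := (hS.ap hx).ap ((hΓ.ap hx).ap he)
  refine (((T1.const_mul 4⁻¹).add ((T2.const_mul 2).add (T3.const_mul 2))).add
    (((T4.const_mul 2).add (T5.const_mul 4)).add ((T6.const_mul (-2⁻¹)).add
      ((T7.const_mul (-2)).add ((T8.const_mul (-2)).add (T9.const_mul (-2))))))).congr fun p => ?_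
  have c1 := M.compat (m p) (ξ p) (ξ p) (ξ p)
  rw [M.S_symm _ _ (ξ p)] at c1
  have s' := M.S_symm (m p) (ν p) (ξ p)
  simp only [E2, dE, add_zero, sub_zero, map_zero, mul_zero, map_sub, map_smul, sub_apply,
    smul_apply, smul_eq_mul, zero_apply]
  linear_combination 2 * c1 + 2 * s'

theorem ord_nu_transp (hm : ∀ᶠ p in l, ‖m p‖ ≤ ρ) (hξ : Tendsto ξ l (nhds 0))
    (hν : ∀ᶠ p in l, ∀ a, M.S (m p + (2⁻¹ : ℝ) • ξ p) (ν p) a = 2⁻¹ * M.dE (m p) (ξ p) a)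
    (hw : ∀ᶠ p in l, ∀ a, M.S (m p + (2⁻¹ : ℝ) • (-ξ p)) (-w p) a
      = 2⁻¹ * M.dE (m p) (-ξ p) a) :
    BigOrd l ξ 3 fun p => w p - M.transp (m p) (ξ p) (ν p) := by
  have hx := BigOrd.self l ξ
  have hΓ : BigOrd l ξ 0 fun p => M.Γ (m p) := BigOrd.eval M.contDiff_Γ.continuous hm
  have hξ' : Tendsto (fun p => -ξ p) l (nhds 0) := by simpa using hξ.neg
  have hr := M.ord_nu hm hξ hν
  have hr' : BigOrd l ξ 3
      fun p => -w p - (-ξ p - (2⁻¹ : ℝ) • M.Γ (m p) (-ξ p) (-ξ p)) := by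
    simpa only [BigOrd, norm_neg] using M.ord_nu hm hξ' hw
  have hg : BigOrd l ξ 2 fun p => M.Γ (m p) (ξ p) (ξ p) := (hΓ.ap hx).ap hx
  have he : BigOrd l ξ 2 fun p => ν p - ξ p :=
    ((hr.mono hξ (by omega : 2 ≤ 3)).sub (hg.smul 2⁻¹)).congr fun p => by abel
  have hn : BigOrd l ξ 1 ν := ((he.mono hξ (by omega : 1 ≤ 2)).add hx).congr fun p => by abel
  have T1 : BigOrd l ξ 3 _ := (hΓ.ap hx).ap he
  have T2 : BigOrd l ξ 3 _ := (hΓ.ap hx).ap ((hΓ.ap hx).ap hn)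
  refine ((hr'.neg.sub hr).sub (T1.add (T2.smul 2⁻¹))).congr fun p => ?_
  simp only [transp, map_sub, map_neg, neg_apply]
  module

theorem ord_E2_nu (hm : ∀ᶠ p in l, ‖m p‖ ≤ ρ) (hξ : Tendsto ξ l (nhds 0))
    (hν : ∀ᶠ p in l, ∀ a, M.S (m p + (2⁻¹ : ℝ) • ξ p) (ν p) a = 2⁻¹ * M.dE (m p) (ξ p) a)
    (hw : ∀ᶠ p in l, ∀ a, M.S (m p + (2⁻¹ : ℝ) • (-ξ p)) (-w p) a
      = 2⁻¹ * M.dE (m p) (-ξ p) a) :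
    BigOrd l ξ 5 fun p => M.E2 (m p) (ξ p) (ν p) (w p) := by
  have hx := BigOrd.self l ξ
  have hΓ : BigOrd l ξ 0 fun p => M.Γ (m p) := BigOrd.eval M.contDiff_Γ.continuous hm
  have hS' := BigOrd.shift M.contDiff_S hm hξ 2⁻¹
  have hΓ' := BigOrd.shift M.contDiff_Γ hm hξ 2⁻¹
  have hD' := BigOrd.shift M.contDiff_Γ.fderiv_smooth hm hξ 2⁻¹
  have hr := M.ord_nu hm hξ hν
  have hg : BigOrd l ξ 2 fun p => M.Γ (m p) (ξ p) (ξ p) := (hΓ.ap hx).ap hx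
  have he : BigOrd l ξ 2 fun p => ν p - ξ p :=
    ((hr.mono hξ (by omega : 2 ≤ 3)).sub (hg.smul 2⁻¹)).congr fun p => by abel
  have hn : BigOrd l ξ 1 ν := ((he.mono hξ (by omega : 1 ≤ 2)).add hx).congr fun p => by abel
  have h2 := M.ord_E2 hm hξ hn ((M.ord_nu_transp hm hξ hν hw).congr fun p => rfl)
  have hc : BigOrd l ξ 4 fun p =>
      M.curv (m p + (2⁻¹ : ℝ) • ξ p) (ν p - ξ p) (ξ p) (ν p) :=
    (((((hD'.ap he).ap hx).ap hn).sub (((hD'.ap hx).ap he).ap hn)).add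
      ((hΓ'.ap he).ap ((hΓ'.ap hx).ap hn))).sub ((hΓ'.ap hx).ap ((hΓ'.ap he).ap hn))
  have hT : BigOrd l ξ 5 _ := (hS'.ap hx).ap hc
  refine (BigOrd.add h2 (hT.const_mul 2)).congr fun p => ?_
  have : M.curv (m p + (2⁻¹ : ℝ) • ξ p) (ν p - ξ p) (ξ p) (ν p) =
      M.curv (m p + (2⁻¹ : ℝ) • ξ p) (ν p) (ξ p) (ν p) := by
    simp only [curv, map_sub, sub_apply]; abel
  rw [this, add_sub_cancel]
  ring

theorem ord_E2_zero (hm : ∀ᶠ p in l, ‖m p‖ ≤ ρ) (hξ : Tendsto ξ l (nhds 0))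
    (hV : BigOrd l ξ 0 V) : BigOrd l ξ 0 fun p => M.E2 (m p) (ξ p) (V p) 0 := by
  have hx : BigOrd l ξ 0 ξ := (BigOrd.self l ξ).mono hξ zero_le_one
  have hS : BigOrd l ξ 0 fun p => M.S (m p) := BigOrd.eval M.contDiff_S.continuous hm
  have hD : BigOrd l ξ 0 fun p => fderiv ℝ M.S (m p) :=
    BigOrd.eval M.contDiff_S.fderiv_smooth.continuous hm
  have hDD : BigOrd l ξ 0 fun p => fderiv ℝ (fderiv ℝ M.S) (m p) :=
    BigOrd.eval M.contDiff_S.fderiv_smooth.fderiv_smooth.continuous hm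
  have hΓ' := BigOrd.shift M.contDiff_Γ hm hξ 2⁻¹
  have hh := hV.smul 2⁻¹
  have T1 : BigOrd l ξ 0 _ := (((hDD.ap hh).ap hh).ap hx).ap hx
  have T2 : BigOrd l ξ 0 _ := ((hD.ap hh).ap hx).ap hV
  have T3 : BigOrd l ξ 0 _ := (hS.ap hV).ap hV
  have hg : BigOrd l ξ 0 _ := (hΓ'.ap hV).ap hV
  have T4 : BigOrd l ξ 0 _ := ((hD.ap hg).ap hx).ap hx
  have T5 : BigOrd l ξ 0 _ := (hS.ap hx).ap hg
  refine (((T1.add (T2.const_mul 4)).add (T3.const_mul 2)).sub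
    ((T4.const_mul 2⁻¹).add (T5.const_mul 2))).congr fun p => ?_
  simp only [E2, dE, add_zero, sub_zero, map_zero, zero_apply, mul_zero]

theorem ord_S_endpoint (hm : ∀ᶠ p in l, ‖m p‖ ≤ ρ) (hξ : Tendsto ξ l (nhds 0)) (c : ℝ) :
    BigOrd l ξ 3 fun p => M.S (m p + c • ξ p) (ξ p) (ξ p) - M.S (m p) (ξ p) (ξ p) := by
  have hx := BigOrd.self l ξ
  exact (((BigOrd.taylor_one M.contDiff_S hm hξ c).ap hx).ap hx).congr fun p => by
    simp only [sub_apply]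

theorem ord_S_midpoint (hm : ∀ᶠ p in l, ‖m p‖ ≤ ρ) (hξ : Tendsto ξ l (nhds 0)) (c : ℝ) :
    BigOrd l ξ 4 fun p => M.S (m p + c • ξ p) (ξ p) (ξ p) + M.S (m p + (-c) • ξ p) (ξ p) (ξ p)
      - 2 * M.S (m p) (ξ p) (ξ p) := by
  have hx := BigOrd.self l ξ
  have T1 : BigOrd l ξ 4 _ := ((BigOrd.taylor_two M.contDiff_S hm hξ c).ap hx).ap hx
  have T2 : BigOrd l ξ 4 _ := ((BigOrd.taylor_two M.contDiff_S hm hξ (-c)).ap hx).ap hx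
  refine (T1.add T2).congr fun p => ?_
  simp only [sub_apply, smul_apply, smul_eq_mul]
  ring

end Asymptotics
end MetricPair

namespace MetricPair

variable {X : Type*} [NormedAddCommGroup X] [NormedSpace ℝ X] [ProperSpace X] (M : MetricPair X)

/-- `ν` is half the `S`-gradient at `m + ξ/2` of the squared midpoint distance. -/
def IsNu (m ξ ν : X) : Prop :=
  ∀ a, M.S (m + (2⁻¹ : ℝ) • ξ) ν a = 2⁻¹ * M.dE m ξ a

/-- Uniform estimates for the squared midpoint distance at short scales. -/
structure IsUniform (ρ K δ : ℝ) : Prop where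
  K_pos : 0 < K
  δ_pos : 0 < δ
  transp_norm : ∀ m ξ V, ‖m‖ ≤ ρ → ‖ξ‖ ≤ δ →
    |M.S (m + (-2⁻¹ : ℝ) • ξ) (M.transp m ξ V) (M.transp m ξ V)
      - M.S (m + (2⁻¹ : ℝ) • ξ) V V| ≤ K * ‖ξ‖ ^ 3 * M.S (m + (2⁻¹ : ℝ) • ξ) V V
  E2_transp : ∀ m ξ V, ‖m‖ ≤ ρ → ‖ξ‖ ≤ δ → M.S (m + (2⁻¹ : ℝ) • ξ) V V ≤ 1 →
    M.E2 m ξ V (M.transp m ξ V) ≤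
      2 * M.S (m + (2⁻¹ : ℝ) • ξ) ξ (M.curv (m + (2⁻¹ : ℝ) • ξ) V ξ V) + K * ‖ξ‖ ^ 3
  E2_zero : ∀ m ξ V, ‖m‖ ≤ ρ → ‖ξ‖ ≤ δ → M.E2 m ξ V 0 ≤ K * M.S (m + (2⁻¹ : ℝ) • ξ) V V
  sq_le : ∀ m ξ, ‖m‖ ≤ ρ → ‖ξ‖ ^ 2 ≤ K * M.S m ξ ξ
  le_sq : ∀ m ξ, ‖m‖ ≤ ρ → M.S m ξ ξ ≤ K * ‖ξ‖ ^ 2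
  S_endpoint : ∀ m ξ, ‖m‖ ≤ ρ → ‖ξ‖ ≤ δ →
    |M.S (m + (2⁻¹ : ℝ) • ξ) ξ ξ - M.S m ξ ξ| ≤ K * ‖ξ‖ ^ 3
  S_quarter : ∀ m ξ, ‖m‖ ≤ ρ → ‖ξ‖ ≤ δ →
    |M.S (m + (4⁻¹ : ℝ) • ξ) ξ ξ - M.S m ξ ξ| ≤ K * ‖ξ‖ ^ 3
  S_midpoint : ∀ m ξ, ‖m‖ ≤ ρ → ‖ξ‖ ≤ δ →
    |M.S (m + (4⁻¹ : ℝ) • ξ) ξ ξ + M.S (m + (-4⁻¹ : ℝ) • ξ) ξ ξ - 2 * M.S m ξ ξ| ≤ K * ‖ξ‖ ^ 4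
  nu_norm : ∀ m ξ ν, ‖m‖ ≤ ρ → ‖ξ‖ ≤ δ → M.IsNu m ξ ν →
    |M.S (m + (2⁻¹ : ℝ) • ξ) ν ν - M.S m ξ ξ| ≤ K * ‖ξ‖ ^ 4
  E2_nu_zero : ∀ m ξ ν, ‖m‖ ≤ ρ → ‖ξ‖ ≤ δ → M.IsNu m ξ ν →
    |M.E2 m ξ ν 0 - 2 * M.S m ξ ξ| ≤ K * ‖ξ‖ ^ 4
  E2_nu : ∀ m ξ ν w, ‖m‖ ≤ ρ → ‖ξ‖ ≤ δ → M.IsNu m ξ ν → M.IsNu m (-ξ) (-w) →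
    |M.E2 m ξ ν w| ≤ K * ‖ξ‖ ^ 5

theorem exists_S_le (ρ : ℝ) : ∃ C, 0 < C ∧ ∀ z a, ‖z‖ ≤ ρ → M.S z a a ≤ C * ‖a‖ ^ 2 := by
  obtain ⟨C, hC0, hC⟩ := exists_bound_closedBall M.contDiff_S.continuous ρ
  refine ⟨C + 1, by positivity, fun z a hz => ?_⟩
  calc M.S z a a ≤ ‖M.S z a a‖ := le_abs_self _
    _ ≤ ‖M.S z‖ * ‖a‖ * ‖a‖ := (M.S z).le_opNorm₂ a a
    _ ≤ (C + 1) * ‖a‖ * ‖a‖ := by gcongr; linarith [hC z hz]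
    _ = _ := by ring

theorem norm_shift_le {m ξ : X} {ρ c : ℝ} (hm : ‖m‖ ≤ ρ) (hξ : ‖ξ‖ ≤ 1) (hc : |c| ≤ 1) :
    ‖m + c • ξ‖ ≤ ρ + 1 := by
  refine (norm_add_le _ _).trans (add_le_add hm ?_)
  rw [norm_smul, Real.norm_eq_abs]
  calc |c| * ‖ξ‖ ≤ 1 * 1 := by gcongr
    _ = 1 := one_mul 1

theorem exists_transp_norm (ρ : ℝ) : ∃ C δ, 0 ≤ C ∧ 0 < δ ∧ ∀ m ξ V, ‖m‖ ≤ ρ → ‖ξ‖ ≤ δ →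
    |M.S (m + (-2⁻¹ : ℝ) • ξ) (M.transp m ξ V) (M.transp m ξ V)
      - M.S (m + (2⁻¹ : ℝ) • ξ) V V| ≤ C * ‖ξ‖ ^ 3 * ‖V‖ ^ 2 := by
  let A : Set (X × X × X) := {p | ‖p.1‖ ≤ ρ ∧ ‖p.2.2‖ ≤ 1}
  have hA := eventually_smallFilter_mem A (fun p => p.2.1)
  have hV : BigOrd (smallFilter A fun p => p.2.1) (fun p => p.2.1) 0 (fun p => p.2.2) :=
    BigOrd.eventually_le (C := 1) (hA.mono fun p hp => by simpa using hp.2)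
  obtain ⟨C, δ, hC, hδ, H⟩ := (M.ord_transp_norm (m := fun p => p.1) (hA.mono fun p hp => hp.1)
    (tendsto_smallFilter A fun p => p.2.1) hV).exists_bound
  refine ⟨C, δ, hC, hδ, fun m ξ V hm hξ => ?_⟩
  by_cases h0 : V = 0
  · simp [h0, transp]
  · have hpos : 0 < ‖V‖ := norm_pos_iff.2 h0
    have := H (m, ξ, ‖V‖⁻¹ • V) ⟨hm, by simp [norm_smul, h0]⟩ hξ
    simp only [transp_smul, map_smul, smul_apply, smul_eq_mul, ← mul_sub] at this
    rw [norm_mul, norm_mul, norm_inv, norm_norm, Real.norm_eq_abs] at this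
    rw [inv_mul_le_iff₀ hpos, inv_mul_le_iff₀ hpos] at this
    exact this.trans (le_of_eq (by ring))

theorem exists_E2_transp (ρ B : ℝ) : ∃ C δ, 0 ≤ C ∧ 0 < δ ∧ ∀ m ξ V, ‖m‖ ≤ ρ → ‖ξ‖ ≤ δ →
    ‖V‖ ≤ B → M.E2 m ξ V (M.transp m ξ V) ≤
      2 * M.S (m + (2⁻¹ : ℝ) • ξ) ξ (M.curv (m + (2⁻¹ : ℝ) • ξ) V ξ V) + C * ‖ξ‖ ^ 3 := by
  let A : Set (X × X × X) := {p | ‖p.1‖ ≤ ρ ∧ ‖p.2.2‖ ≤ B}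
  have hA := eventually_smallFilter_mem A (fun p => p.2.1)
  have hV : BigOrd (smallFilter A fun p => p.2.1) (fun p => p.2.1) 0 (fun p => p.2.2) :=
    BigOrd.eventually_le (C := B) (hA.mono fun p hp => by simpa using hp.2)
  have h0 : BigOrd (smallFilter A fun p => p.2.1) (fun p => p.2.1) (2 + 0) (fun _ => (0 : X)) :=
    BigOrd.eventually_le (C := 0) (by simp)
  obtain ⟨C, δ, hC, hδ, H⟩ := (M.ord_E2 (m := fun p => p.1) (hA.mono fun p hp => hp.1)
    (tendsto_smallFilter A fun p => p.2.1) hV h0).exists_bound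
  refine ⟨C, δ, hC, hδ, fun m ξ V hm hξ hB => ?_⟩
  have := H (m, ξ, V) ⟨hm, hB⟩ hξ
  simp only [add_zero, mul_zero] at this
  linarith [le_of_abs_le this]

theorem exists_E2_zero (ρ : ℝ) : ∃ C δ, 0 ≤ C ∧ 0 < δ ∧ ∀ m ξ V, ‖m‖ ≤ ρ → ‖ξ‖ ≤ δ →
    M.E2 m ξ V 0 ≤ C * ‖V‖ ^ 2 := by
  let A : Set (X × X × X) := {p | ‖p.1‖ ≤ ρ ∧ ‖p.2.2‖ ≤ 1}
  have hA := eventually_smallFilter_mem A (fun p => p.2.1)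
  have hV : BigOrd (smallFilter A fun p => p.2.1) (fun p => p.2.1) 0 (fun p => p.2.2) :=
    BigOrd.eventually_le (C := 1) (hA.mono fun p hp => by simpa using hp.2)
  obtain ⟨C, δ, hC, hδ, H⟩ := (M.ord_E2_zero (m := fun p => p.1) (hA.mono fun p hp => hp.1)
    (tendsto_smallFilter A fun p => p.2.1) hV).exists_bound
  refine ⟨C, δ, hC, hδ, fun m ξ V hm hξ => ?_⟩
  by_cases h0 : V = 0
  · have := M.E2_smul_zero m ξ 0 0
    simp only [smul_zero, ne_eq, OfNat.ofNat_ne_zero, not_false_eq_true, zero_pow, zero_mul] at this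
    rw [h0, this]; positivity
  · have hpos : 0 < ‖V‖ := norm_pos_iff.2 h0
    have := le_of_abs_le (H (m, ξ, ‖V‖⁻¹ • V) ⟨hm, by simp [norm_smul, h0]⟩ hξ)
    simp only [E2_smul_zero, pow_zero, mul_one, inv_pow] at this
    rw [inv_mul_le_iff₀ (by positivity)] at this
    exact this.trans (le_of_eq (by ring))

theorem exists_S_endpoint (ρ c : ℝ) : ∃ C δ, 0 ≤ C ∧ 0 < δ ∧ ∀ m ξ, ‖m‖ ≤ ρ → ‖ξ‖ ≤ δ →
    |M.S (m + c • ξ) ξ ξ - M.S m ξ ξ| ≤ C * ‖ξ‖ ^ 3 := by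
  let A : Set (X × X) := {p | ‖p.1‖ ≤ ρ}
  have hA := eventually_smallFilter_mem A (fun p => p.2)
  obtain ⟨C, δ, hC, hδ, H⟩ := (M.ord_S_endpoint (m := fun p => p.1) (hA.mono fun p hp => hp)
    (tendsto_smallFilter A fun p => p.2) c).exists_bound
  exact ⟨C, δ, hC, hδ, fun m ξ hm hξ => H (m, ξ) hm hξ⟩

theorem exists_S_midpoint (ρ c : ℝ) : ∃ C δ, 0 ≤ C ∧ 0 < δ ∧ ∀ m ξ, ‖m‖ ≤ ρ → ‖ξ‖ ≤ δ →
    |M.S (m + c • ξ) ξ ξ + M.S (m + (-c) • ξ) ξ ξ - 2 * M.S m ξ ξ| ≤ C * ‖ξ‖ ^ 4 := by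
  let A : Set (X × X) := {p | ‖p.1‖ ≤ ρ}
  have hA := eventually_smallFilter_mem A (fun p => p.2)
  obtain ⟨C, δ, hC, hδ, H⟩ := (M.ord_S_midpoint (m := fun p => p.1) (hA.mono fun p hp => hp)
    (tendsto_smallFilter A fun p => p.2) c).exists_bound
  exact ⟨C, δ, hC, hδ, fun m ξ hm hξ => H (m, ξ) hm hξ⟩

theorem exists_nu (ρ : ℝ) : ∃ C δ, 0 ≤ C ∧ 0 < δ ∧ ∀ m ξ ν, ‖m‖ ≤ ρ → ‖ξ‖ ≤ δ → M.IsNu m ξ ν →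
    |M.S (m + (2⁻¹ : ℝ) • ξ) ν ν - M.S m ξ ξ| ≤ C * ‖ξ‖ ^ 4 ∧
    |M.E2 m ξ ν 0 - 2 * M.S m ξ ξ| ≤ C * ‖ξ‖ ^ 4 := by
  let A : Set (X × X × X) := {p | ‖p.1‖ ≤ ρ ∧ M.IsNu p.1 p.2.1 p.2.2}
  have hA := eventually_smallFilter_mem A (fun p => p.2.1)
  obtain ⟨C, δ, hC, hδ, H⟩ := (M.ord_nu_norm (m := fun p : X × X × X => p.1)
      (ν := fun p : X × X × X => p.2.2)
    (hA.mono fun p hp => hp.1) (tendsto_smallFilter A fun p => p.2.1)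
    (hA.mono fun p hp => hp.2)).exists_bound
  obtain ⟨C', δ', hC', hδ', H'⟩ := (M.ord_E2_nu_zero (m := fun p : X × X × X => p.1)
      (ν := fun p : X × X × X => p.2.2)
    (hA.mono fun p hp => hp.1) (tendsto_smallFilter A fun p => p.2.1)
    (hA.mono fun p hp => hp.2)).exists_bound
  refine ⟨max C C', min δ δ', hC.trans (le_max_left _ _), lt_min hδ hδ', fun m ξ ν hm hξ hν => ?_⟩
  refine ⟨(H (m, ξ, ν) ⟨hm, hν⟩ (hξ.trans (min_le_left _ _))).trans ?_,
    (H' (m, ξ, ν) ⟨hm, hν⟩ (hξ.trans (min_le_right _ _))).trans ?_⟩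
  · gcongr; exact le_max_left _ _
  · gcongr; exact le_max_right _ _

theorem exists_E2_nu (ρ : ℝ) : ∃ C δ, 0 ≤ C ∧ 0 < δ ∧ ∀ m ξ ν w, ‖m‖ ≤ ρ → ‖ξ‖ ≤ δ →
    M.IsNu m ξ ν → M.IsNu m (-ξ) (-w) → |M.E2 m ξ ν w| ≤ C * ‖ξ‖ ^ 5 := by
  let A : Set (X × X × X × X) :=
    {p | ‖p.1‖ ≤ ρ ∧ M.IsNu p.1 p.2.1 p.2.2.1 ∧ M.IsNu p.1 (-p.2.1) (-p.2.2.2)}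
  have hA := eventually_smallFilter_mem A (fun p => p.2.1)
  obtain ⟨C, δ, hC, hδ, H⟩ := (M.ord_E2_nu (m := fun p : X × X × X × X => p.1)
      (ν := fun p : X × X × X × X => p.2.2.1)
    (w := fun p : X × X × X × X => p.2.2.2) (hA.mono fun p hp => hp.1)
        (tendsto_smallFilter A fun p => p.2.1)
    (hA.mono fun p hp => hp.2.1) (hA.mono fun p hp => hp.2.2)).exists_bound
  exact ⟨C, δ, hC, hδ, fun m ξ ν w hm hξ hν hw => H (m, ξ, ν, w) ⟨hm, hν, hw⟩ hξ⟩

theorem exists_isUniform (ρ : ℝ) : ∃ K δ, M.IsUniform ρ K δ := by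
  obtain ⟨c, hc, hcoer⟩ := M.exists_coercive (ρ + 1)
  obtain ⟨C0, hC0, hle⟩ := M.exists_S_le (ρ + 1)
  obtain ⟨C1, δ1, hC1, hδ1, H1⟩ := M.exists_transp_norm ρ
  obtain ⟨C2, δ2, hC2, hδ2, H2⟩ := M.exists_E2_transp ρ (c⁻¹ + 1)
  obtain ⟨C3, δ3, hC3, hδ3, H3⟩ := M.exists_E2_zero ρ
  obtain ⟨C4, δ4, hC4, hδ4, H4⟩ := M.exists_S_endpoint ρ 2⁻¹
  obtain ⟨C5, δ5, hC5, hδ5, H5⟩ := M.exists_S_endpoint ρ 4⁻¹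
  obtain ⟨C6, δ6, hC6, hδ6, H6⟩ := M.exists_S_midpoint ρ 4⁻¹
  obtain ⟨C7, δ7, hC7, hδ7, H7⟩ := M.exists_nu ρ
  obtain ⟨C8, δ8, hC8, hδ8, H8⟩ := M.exists_E2_nu ρ
  set K := c⁻¹ + C0 + C1 * c⁻¹ + C2 + C3 * c⁻¹ + C4 + C5 + C6 + C7 + C8 with hK
  obtain ⟨δ, hδ, hl⟩ : ∃ δ, 0 < δ ∧ (δ ≤ 1 ∧ δ ≤ δ1 ∧ δ ≤ δ2 ∧ δ ≤ δ3 ∧ δ ≤ δ4 ∧ δ ≤ δ5 ∧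
      δ ≤ δ6 ∧ δ ≤ δ7 ∧ δ ≤ δ8) := by
    have : ∀ᶠ δ : ℝ in nhdsWithin 0 (Ioi 0), 0 < δ ∧ (δ ≤ 1 ∧ δ ≤ δ1 ∧ δ ≤ δ2 ∧ δ ≤ δ3 ∧
        δ ≤ δ4 ∧ δ ≤ δ5 ∧ δ ≤ δ6 ∧ δ ≤ δ7 ∧ δ ≤ δ8) := by
      have h : ∀ {b : ℝ}, 0 < b → ∀ᶠ δ : ℝ in nhdsWithin 0 (Ioi 0), δ ≤ b := fun hb =>
        mem_nhdsWithin_of_mem_nhds (Iic_mem_nhds hb)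
      exact eventually_mem_nhdsWithin.and <| (h one_pos).and <| (h hδ1).and <| (h hδ2).and <|
        (h hδ3).and <| (h hδ4).and <| (h hδ5).and <| (h hδ6).and <| (h hδ7).and (h hδ8)
    exact this.exists
  obtain ⟨l0, l1, l2, l3, l4, l5, l6, l7, l8⟩ := hl
  have hci : 0 < c⁻¹ := inv_pos.2 hc
  have p1 := mul_nonneg hC1 hci.le
  have p3 := mul_nonneg hC3 hci.le
  have hV : ∀ m ξ V, ‖m‖ ≤ ρ → ‖ξ‖ ≤ δ → ‖V‖ ^ 2 ≤ c⁻¹ * M.S (m + (2⁻¹ : ℝ) • ξ) V V := by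
    intro m ξ V hm hξ
    rw [le_inv_mul_iff₀ hc]
    exact hcoer _ _ (norm_shift_le hm (hξ.trans l0) (by norm_num))
  have hpos : ∀ z V, 0 ≤ M.S z V V := fun z V => by
    by_cases h : V = 0
    · simp [h]
    · exact (M.pos z V h).le
  refine ⟨K, δ, ?_, hδ, ?_, ?_, ?_, ?_, ?_, ?_, ?_, ?_, ?_, ?_, ?_⟩
  · positivity
  · intro m ξ V hm hξ
    refine (H1 m ξ V hm (hξ.trans l1)).trans ?_
    calc C1 * ‖ξ‖ ^ 3 * ‖V‖ ^ 2 ≤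
        C1 * ‖ξ‖ ^ 3 * (c⁻¹ * M.S (m + (2⁻¹ : ℝ) • ξ) V V) := by gcongr; exact hV m ξ V hm hξ
      _ = (C1 * c⁻¹) * ‖ξ‖ ^ 3 * M.S (m + (2⁻¹ : ℝ) • ξ) V V := by ring
      _ ≤ _ := by gcongr; exacts [hpos _ _, by linarith]
  · intro m ξ V hm hξ h1
    refine (H2 m ξ V hm (hξ.trans l2) ?_).trans ?_
    · have := hV m ξ V hm hξ
      have : ‖V‖ ^ 2 ≤ c⁻¹ := this.trans (mul_le_of_le_one_right hci.le h1)
      nlinarith [norm_nonneg V]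
    · gcongr; linarith
  · intro m ξ V hm hξ
    refine (H3 m ξ V hm (hξ.trans l3)).trans ?_
    calc C3 * ‖V‖ ^ 2 ≤ C3 * (c⁻¹ * M.S (m + (2⁻¹ : ℝ) • ξ) V V) := by
          gcongr; exact hV m ξ V hm hξ
      _ = (C3 * c⁻¹) * M.S (m + (2⁻¹ : ℝ) • ξ) V V := by ring
      _ ≤ _ := by gcongr; exacts [hpos _ _, by linarith]
  · intro m ξ hm
    have := hcoer m ξ (by linarith)
    rw [← le_inv_mul_iff₀ hc] at this
    refine this.trans ?_
    gcongr; exacts [hpos _ _, by linarith]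
  · intro m ξ hm
    refine (hle m ξ (by linarith)).trans ?_
    gcongr; linarith
  · intro m ξ hm hξ
    refine (H4 m ξ hm (hξ.trans l4)).trans ?_
    gcongr; linarith
  · intro m ξ hm hξ
    refine (H5 m ξ hm (hξ.trans l5)).trans ?_
    gcongr; linarith
  · intro m ξ hm hξ
    refine (H6 m ξ hm (hξ.trans l6)).trans ?_
    gcongr; linarith
  · intro m ξ ν hm hξ hν
    refine (H7 m ξ ν hm (hξ.trans l7) hν).1.trans ?_
    gcongr; linarith
  · intro m ξ ν hm hξ hν
    refine (H7 m ξ ν hm (hξ.trans l7) hν).2.trans ?_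
    gcongr; linarith
  · intro m ξ ν w hm hξ hν hw
    refine (H8 m ξ ν w hm (hξ.trans l8) hν hw).trans ?_
    gcongr; linarith

end MetricPair

section Frame

variable {X : Type*} [NormedAddCommGroup X] [NormedSpace ℝ X] {ι : Type*} [Fintype ι]
  [DecidableEq ι]

/-- `f` is an orthonormal basis for the bilinear form `g`. -/
structure IsFrame (g : X →L[ℝ] X →L[ℝ] ℝ) (f : ι → X) : Prop where
  orth : ∀ i j, g (f i) (f j) = if i = j then 1 else 0
  expand : ∀ v, v = ∑ i, g (f i) v • f i

namespace IsFrame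

variable {g g' : X →L[ℝ] X →L[ℝ] ℝ} {f f' : ι → X}

theorem bilin_sum (H : X →L[ℝ] X →L[ℝ] ℝ) (c d : ι → ℝ) :
    H (∑ i, c i • f i) (∑ i, d i • f i) = ∑ i, ∑ j, c i * d j * H (f i) (f j) := by
  simp only [map_sum, map_smul, sum_apply, smul_apply, smul_eq_mul,
    Finset.mul_sum]
  rw [Finset.sum_comm]
  exact Finset.sum_congr rfl fun i _ => Finset.sum_congr rfl fun j _ => by ring

theorem apply_sum (hf : IsFrame g f) (c d : ι → ℝ) :
    g (∑ i, c i • f i) (∑ i, d i • f i) = ∑ i, c i * d i := by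
  rw [bilin_sum]
  simp [hf.orth]

theorem apply_eq_sum (hf : IsFrame g f) (V : X) : g V V = ∑ i, g (f i) V * g (f i) V := by
  conv_lhs => rw [hf.expand V]
  rw [hf.apply_sum]

open Matrix in
theorem exists_complement (hf : IsFrame g f) (hf' : IsFrame g' f') (L : X →ₗ[ℝ] X) {s : ℝ}
    (hs : 0 ≤ s) (hL : ∀ V, s * g' (L V) (L V) ≤ g V V) :
    ∃ (N : ℕ) (q : Fin N → X), ∀ H : X →L[ℝ] X →L[ℝ] ℝ,
      ∑ i, H (f' i) (f' i) = s * ∑ i, H (L (f i)) (L (f i)) + ∑ j, H (q j) (q j) := by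
  let A : Matrix ι ι ℝ := Matrix.of fun k i => g' (f' k) (L (f i))
  have hLf : ∀ i, L (f i) = ∑ k, A k i • f' k := fun i => hf'.expand (L (f i))
  have hnorm : ∀ v : ι → ℝ, s * (A *ᵥ v ⬝ᵥ A *ᵥ v) ≤ v ⬝ᵥ v := by
    intro v
    have h1 := hL (∑ i, v i • f i)
    have h2 : L (∑ i, v i • f i) = ∑ k, (A *ᵥ v) k • f' k := by
      simp only [map_sum, map_smul, hLf, Finset.smul_sum, mulVec, dotProduct, Finset.sum_smul,
        smul_smul]
      rw [Finset.sum_comm]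
      exact Finset.sum_congr rfl fun i _ => Finset.sum_congr rfl fun j _ => by rw [mul_comm]
    rw [h2, hf'.apply_sum, hf.apply_sum] at h1
    exact h1
  let Q : Matrix ι ι ℝ := 1 - s • (A * Aᵀ)
  have hQ : Q.PosSemidef := by
    refine Matrix.PosSemidef.of_dotProduct_mulVec_nonneg ?_ fun z => ?_
    · simp [Q, Matrix.IsHermitian]
    · have e : star z ⬝ᵥ (Q *ᵥ z) = z ⬝ᵥ z - s * ((Aᵀ *ᵥ z) ⬝ᵥ (Aᵀ *ᵥ z)) := by
        simp only [Q, sub_mulVec, one_mulVec, dotProduct_sub, smul_mulVec, dotProduct_smul,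
          star_trivial, smul_eq_mul]
        rw [← mulVec_mulVec, dotProduct_mulVec, ← mulVec_transpose]
      rw [e]
      set v := Aᵀ *ᵥ z with hv
      have h1 : z ⬝ᵥ (A *ᵥ v) = v ⬝ᵥ v := by
        rw [dotProduct_mulVec, ← mulVec_transpose]
      have h2 : 0 ≤ (z - s • (A *ᵥ v)) ⬝ᵥ (z - s • (A *ᵥ v)) := by
        simpa using dotProduct_star_self_nonneg (z - s • (A *ᵥ v))
      simp only [sub_dotProduct, dotProduct_sub, smul_dotProduct, dotProduct_smul, smul_eq_mul,
        dotProduct_comm (A *ᵥ v) z, h1] at h2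
      nlinarith [mul_le_mul_of_nonneg_left (hnorm v) hs]
  obtain ⟨N, v, hv⟩ := Matrix.posSemidef_iff_eq_sum_vecMulVec.1 hQ
  refine ⟨N, fun j => ∑ k, v j k • f' k, fun H => ?_⟩
  have h1 : ∀ j, H (∑ k, v j k • f' k) (∑ k, v j k • f' k)
      = ∑ k, ∑ l, v j k * v j l * H (f' k) (f' l) := fun j => bilin_sum H _ _
  have h2 : ∀ i, H (L (f i)) (L (f i)) = ∑ k, ∑ l, A k i * A l i * H (f' k) (f' l) := fun i => by
    rw [hLf i, bilin_sum]
  have h3 : ∀ k l, ∑ j, v j k * v j l = (if k = l then 1 else 0) - s * ∑ i, A k i * A l i := by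
    intro k l
    have := congrFun (congrFun hv k) l
    simp only [Q, Matrix.sub_apply, Matrix.smul_apply, Matrix.mul_apply, Matrix.one_apply,
      Matrix.transpose_apply, smul_eq_mul, Matrix.sum_apply, vecMulVec_apply, star_trivial] at this
    exact this.symm
  simp only [h1, h2]
  have e1 : ∑ j, ∑ k, ∑ l, v j k * v j l * H (f' k) (f' l)
      = ∑ k, ∑ l, (∑ j, v j k * v j l) * H (f' k) (f' l) := by
    rw [Finset.sum_comm]
    refine Finset.sum_congr rfl fun k _ => ?_
    rw [Finset.sum_comm]
    simp only [Finset.sum_mul]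
  have e2 : ∑ j, ∑ k, ∑ l, A k j * A l j * H (f' k) (f' l)
      = ∑ k, ∑ l, (∑ j, A k j * A l j) * H (f' k) (f' l) := by
    rw [Finset.sum_comm]
    refine Finset.sum_congr rfl fun k _ => ?_
    rw [Finset.sum_comm]
    simp only [Finset.sum_mul]
  rw [e1, e2]
  simp only [h3, sub_mul, Finset.sum_sub_distrib, ite_mul, one_mul, zero_mul, Finset.sum_ite_eq,
    Finset.mem_univ, if_true, mul_assoc]
  simp only [← Finset.mul_sum]
  ring

end IsFrame

end Frame

namespace MetricPair

variable {X : Type*} [NormedAddCommGroup X] [NormedSpace ℝ X] [ProperSpace X] {M : MetricPair X}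
  {ρ K δ : ℝ} {m ξ ν w : X}

/-- `transp` as a linear map. -/
def transpLin (M : MetricPair X) (m ξ : X) : X →ₗ[ℝ] X where
  toFun := M.transp m ξ
  map_add' a b := by simp only [transp, map_add, smul_add]; abel
  map_smul' c a := by simp only [transp_smul, RingHom.id_apply]

theorem neg_shift (m ξ : X) : m + (2⁻¹ : ℝ) • (-ξ) = m + (-2⁻¹ : ℝ) • ξ := by
  rw [smul_neg, neg_smul]

theorem IsUniform.B_zero (hU : M.IsUniform ρ K δ) (hm : ‖m‖ ≤ ρ) (hξ : ‖ξ‖ ≤ δ)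
    (hν : M.IsNu m ξ ν) {p₁ p₂ κ : ℝ} (h1 : 0 ≤ p₁) (h1' : p₁ * ‖ξ‖ ≤ κ) (h2 : p₂ ≤ 0)
    (h2' : -p₂ * ‖ξ‖ ^ 3 ≤ κ)
    (h12 : 2 * p₁ * M.S m ξ ξ + 4 * p₂ * M.S m ξ ξ ^ 2 ≤ κ * ‖ξ‖ ^ 3) :
    p₁ * M.E2 m ξ ν 0 + p₂ * M.E1 m ξ ν 0 ^ 2 ≤ (κ + K * κ + 8 * K ^ 2 * κ) * ‖ξ‖ ^ 3 := by
  have hK := hU.K_pos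
  set d := ‖ξ‖ with hd
  have hd0 : 0 ≤ d := norm_nonneg ξ
  set E := M.S m ξ ξ with hE
  have hE0 : 0 ≤ E := by
    have := hU.sq_le m ξ hm
    by_contra! hlt
    nlinarith [sq_nonneg ‖ξ‖]
  have a1 := le_of_abs_le (hU.E2_nu_zero m ξ ν hm hξ hν)
  have a2 := abs_le.1 (hU.nu_norm m ξ ν hm hξ hν)
  have a3 := hU.le_sq m ξ hm
  rw [← hE, ← hd] at a1 a2 a3
  have a4 : M.E1 m ξ ν 0 = 2 * M.S (m + (2⁻¹ : ℝ) • ξ) ν ν := by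
    rw [E1_zero, hν ν]; ring
  rw [a4]
  set N := M.S (m + (2⁻¹ : ℝ) • ξ) ν ν
  have b1 : E ^ 2 - 2 * E * (K * d ^ 4) ≤ N ^ 2 := by nlinarith [sq_nonneg (N - E)]
  have b2 : p₁ * M.E2 m ξ ν 0 ≤ p₁ * (2 * E + K * d ^ 4) :=
    mul_le_mul_of_nonneg_left (by linarith) h1
  have b3 : p₂ * (2 * N) ^ 2 ≤ p₂ * (4 * (E ^ 2 - 2 * E * (K * d ^ 4))) :=
    mul_le_mul_of_nonpos_left (by nlinarith) h2
  have b4 : (-p₂) * E * d ^ 4 ≤ K * κ * d ^ 3 := by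
    have : (-p₂) * E * d ^ 4 ≤ (-p₂) * (K * d ^ 2) * d ^ 4 := by gcongr; linarith
    calc _ ≤ _ := this
      _ = (-p₂ * d ^ 3) * (K * d ^ 3) := by ring
      _ ≤ κ * (K * d ^ 3) := by gcongr
      _ = _ := by ring
  have b5 : p₁ * (K * d ^ 4) ≤ K * κ * d ^ 3 := by
    calc p₁ * (K * d ^ 4) = (p₁ * d) * (K * d ^ 3) := by ring
      _ ≤ κ * (K * d ^ 3) := by gcongr
      _ = _ := by ring
  nlinarith

theorem IsUniform.B_zero' (hU : M.IsUniform ρ K δ) (hm : ‖m‖ ≤ ρ) (hξ : ‖ξ‖ ≤ δ)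
    (hw : M.IsNu m (-ξ) (-w)) {p₁ p₂ κ : ℝ} (h1 : 0 ≤ p₁) (h1' : p₁ * ‖ξ‖ ≤ κ) (h2 : p₂ ≤ 0)
    (h2' : -p₂ * ‖ξ‖ ^ 3 ≤ κ)
    (h12 : 2 * p₁ * M.S m ξ ξ + 4 * p₂ * M.S m ξ ξ ^ 2 ≤ κ * ‖ξ‖ ^ 3) :
    p₁ * M.E2 m ξ 0 w + p₂ * M.E1 m ξ 0 w ^ 2 ≤ (κ + K * κ + 8 * K ^ 2 * κ) * ‖ξ‖ ^ 3 := by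
  have h := hU.B_zero (ξ := -ξ) (κ := κ) hm (by rwa [norm_neg]) hw h1 (by rwa [norm_neg]) h2
    (by rwa [norm_neg]) (by simpa only [norm_neg, map_neg, neg_apply, neg_neg] using h12)
  have e1 : M.E2 m (-ξ) (-w) 0 = M.E2 m ξ 0 w := by
    rw [← M.E2_neg_neg m ξ 0 w, neg_zero, E2_swap]
  have e2 : M.E1 m (-ξ) (-w) 0 = - M.E1 m ξ 0 w := by
    rw [E1_swap]
    simp only [E1, zero_add, zero_sub, map_neg, smul_neg, neg_apply, neg_neg]
    ring
  rwa [e1, e2, neg_sq, norm_neg] at h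

set_option maxHeartbeats 1000000 in
theorem IsUniform.trace_le (hU : M.IsUniform ρ K δ) (hm : ‖m‖ ≤ ρ) (hξ : ‖ξ‖ ≤ δ)
    (hK1 : K * ‖ξ‖ ^ 3 ≤ 1)
    (hν : M.IsNu m ξ ν) (hw : M.IsNu m (-ξ) (-w)) {p₁ p₂ κ e C₀ : ℝ}
    (h1 : 0 ≤ p₁) (h1' : p₁ * ‖ξ‖ ≤ κ) (h1'' : 2 * p₁ * M.S m ξ ξ ≤ e + κ * ‖ξ‖ ^ 2) (h2 : p₂ ≤ 0)
    (h2' : -p₂ * ‖ξ‖ ^ 3 ≤ κ)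
    (h12 : 2 * p₁ * M.S m ξ ξ + 4 * p₂ * M.S m ξ ξ ^ 2 ≤ κ * ‖ξ‖ ^ 3)
    {ι : Type*} [Fintype ι] [DecidableEq ι] {f g : ι → X}
    (hf : IsFrame (M.S (m + (2⁻¹ : ℝ) • ξ)) f) (hg : IsFrame (M.S (m + (-2⁻¹ : ℝ) • ξ)) g)
    {Hy Hx : X →L[ℝ] X →L[ℝ] ℝ}
    (hH : ∀ V W, Hy V V - Hx W W ≤ p₁ * M.E2 m ξ V W + p₂ * M.E1 m ξ V W ^ 2)
    (hC₀ : 0 ≤ C₀)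
    (hR : ∑ i, M.S (m + (2⁻¹ : ℝ) • ξ) ξ (M.curv (m + (2⁻¹ : ℝ) • ξ) (f i) ξ (f i)) ≤
      C₀ * M.S (m + (2⁻¹ : ℝ) • ξ) ξ ξ)
    {ωy ωx : ℝ} (hωy : 0 ≤ ωy) (hωx : 0 ≤ ωx) :
    (∑ i, Hy (f i) (f i) + ωy * Hy ν ν) - (∑ i, Hx (g i) (g i) + ωx * Hx w w) ≤
      C₀ * e + (C₀ * κ + (2 * C₀ * K + Fintype.card ι * K + 3 * Fintype.card ι * K ^ 2) * κ) * ‖ξ‖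
          ^ 2
        + (κ + K * κ + 8 * K ^ 2 * κ) * (|ωy - ωx| * ‖ξ‖ ^ 3) + K * κ * (ωy * ‖ξ‖ ^ 4) := by
  have hK := hU.K_pos
  set d := ‖ξ‖ with hd
  have hd0 : 0 ≤ d := norm_nonneg ξ
  set y := m + (2⁻¹ : ℝ) • ξ with hy
  set x := m + (-2⁻¹ : ℝ) • ξ with hx
  set n : ℝ := (Fintype.card ι : ℝ) with hn
  have hn0 : 0 ≤ n := by positivity
  set s : ℝ := 1 - K * d ^ 3 with hs
  have hs0 : 0 ≤ s := by linarith
  have hs1 : s ≤ 1 := by have : 0 ≤ K * d ^ 3 := by positivity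
                         linarith
  have hκ : 0 ≤ κ := (by positivity : (0:ℝ) ≤ p₁ * d).trans h1'
  have Spos : ∀ z a, 0 ≤ M.S z a a := fun z a => by
    by_cases h : a = 0
    · simp [h]
    · exact (M.pos z a h).le
  have hfu : ∀ i, M.S y (f i) (f i) = 1 := fun i => by rw [hf.orth]; simp
  have hgu : ∀ i, M.S x (g i) (g i) = 1 := fun i => by rw [hg.orth]; simp
  obtain ⟨N, q, hq⟩ := hf.exists_complement hg (M.transpLin m ξ) hs0 fun V => by
    have h := (abs_le.1 (hU.transp_norm m ξ V hm hξ)).2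
    rw [← hy, ← hx, ← hd] at h
    have hV := Spos y V
    calc s * M.S x (M.transp m ξ V) (M.transp m ξ V) ≤ s * ((1 + K * d ^ 3) * M.S y V V) := by
          gcongr; linarith
      _ = M.S y V V - (K * d ^ 3) ^ 2 * M.S y V V := by rw [hs]; ring
      _ ≤ M.S y V V := by linarith [mul_nonneg (sq_nonneg (K * d ^ 3)) hV]
  change ∀ H : X →L[ℝ] X →L[ℝ] ℝ, ∑ i, H (g i) (g i)
    = s * ∑ i, H (M.transp m ξ (f i)) (M.transp m ξ (f i)) + ∑ j, H (q j) (q j) at hq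
  have hle : ∀ V W, Hy V V - Hx W W ≤ p₁ * M.E2 m ξ V W := fun V W =>
    (hH V W).trans (by nlinarith [sq_nonneg (M.E1 m ξ V W)])
  -- transported frame vectors
  have t1 : ∑ i, (Hy (f i) (f i) - Hx (M.transp m ξ (f i)) (M.transp m ξ (f i))) ≤
      p₁ * (2 * (C₀ * M.S y ξ ξ) + n * (K * d ^ 3)) := by
    calc _ ≤ ∑ i, p₁ * (2 * M.S y ξ (M.curv y (f i) ξ (f i)) + K * d ^ 3) := by
          refine Finset.sum_le_sum fun i _ => (hle _ _).trans ?_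
          exact mul_le_mul_of_nonneg_left (hU.E2_transp m ξ (f i) hm hξ (hfu i).le) h1
      _ = p₁ * (2 * (∑ i, M.S y ξ (M.curv y (f i) ξ (f i))) + n * (K * d ^ 3)) := by
          rw [← Finset.mul_sum, Finset.sum_add_distrib, ← Finset.mul_sum]; simp [hn]
      _ ≤ _ := by gcongr
  have t1' : s * ∑ i, (Hy (f i) (f i) - Hx (M.transp m ξ (f i)) (M.transp m ξ (f i))) ≤
      C₀ * e + (C₀ * κ + (2 * C₀ * K + n * K) * κ) * d ^ 2 := by
    have hA : 0 ≤ p₁ * (2 * (C₀ * M.S y ξ ξ) + n * (K * d ^ 3)) := by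
      have := Spos y ξ; positivity
    have hE := (abs_le.1 (hU.S_endpoint m ξ hm hξ)).2
    rw [← hy, ← hd] at hE
    have c1 : p₁ * (2 * (C₀ * M.S y ξ ξ) + n * (K * d ^ 3)) ≤
        p₁ * (2 * (C₀ * (M.S m ξ ξ + K * d ^ 3)) + n * (K * d ^ 3)) := by
      gcongr; linarith
    have c2 : p₁ * d * d ^ 2 ≤ κ * d ^ 2 := by gcongr
    have c3 : C₀ * (2 * p₁ * M.S m ξ ξ) ≤ C₀ * (e + κ * d ^ 2) := by gcongr
    have c4 : (2 * C₀ * K + n * K) * (p₁ * d * d ^ 2) ≤ (2 * C₀ * K + n * K) * (κ * d ^ 2) := by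
      gcongr
    have := mul_le_mul_of_nonneg_left t1 hs0
    nlinarith
  -- the remaining parts of the two frames
  have t2 : ∑ i, (Hy (f i) (f i) - Hx 0 0) ≤ p₁ * (n * K) := by
    calc _ ≤ ∑ _i : ι, p₁ * K := by
          refine Finset.sum_le_sum fun i _ => (hle _ _).trans ?_
          have := hU.E2_zero m ξ (f i) hm hξ
          rw [← hy, hfu, mul_one] at this
          exact mul_le_mul_of_nonneg_left this h1
      _ = _ := by simp [hn]; ring
  have hqs : ∑ j, M.S x (q j) (q j) ≤ n * (2 * (K * d ^ 3)) := by
    have h := hq (M.S x)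
    have h1 : ∑ i, M.S x (g i) (g i) = n := by simp [hgu, hn]
    have h2 : n * (1 - K * d ^ 3) ≤ ∑ i, M.S x (M.transp m ξ (f i)) (M.transp m ξ (f i)) := by
      calc n * (1 - K * d ^ 3) = ∑ _i : ι, (1 - K * d ^ 3) := by
            rw [Finset.sum_const, nsmul_eq_mul, Finset.card_univ]
        _ ≤ _ := by
          refine Finset.sum_le_sum fun i _ => ?_
          have h := (abs_le.1 (hU.transp_norm m ξ (f i) hm hξ)).1
          rw [← hy, ← hx, ← hd, hfu] at h
          linarith
    have h3 := mul_le_mul_of_nonneg_left h2 hs0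
    have h4 : 0 ≤ n * (K * d ^ 3) ^ 2 := by positivity
    rw [hs] at h3 h
    nlinarith
  have t3 : ∑ j, (Hy 0 0 - Hx (q j) (q j)) ≤ p₁ * (K * (n * (2 * (K * d ^ 3)))) := by
    calc _ ≤ ∑ j, p₁ * (K * M.S x (q j) (q j)) := by
          refine Finset.sum_le_sum fun j _ => (hle _ _).trans ?_
          have := hU.E2_zero m (-ξ) (q j) hm (by rwa [norm_neg])
          rw [neg_shift, E2_swap] at this
          exact mul_le_mul_of_nonneg_left this h1
      _ = p₁ * (K * ∑ j, M.S x (q j) (q j)) := by simp only [Finset.mul_sum]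
      _ ≤ _ := by gcongr
  have t23 : (1 - s) * ∑ i, (Hy (f i) (f i) - Hx 0 0) + ∑ j, (Hy 0 0 - Hx (q j) (q j)) ≤
      3 * n * K ^ 2 * κ * d ^ 2 := by
    have c1 := mul_le_mul_of_nonneg_left t2 (by linarith : 0 ≤ 1 - s)
    have c2 : 3 * n * K ^ 2 * (p₁ * d) * d ^ 2 ≤ 3 * n * K ^ 2 * κ * d ^ 2 := by gcongr
    rw [hs] at c1 ⊢
    nlinarith
  -- the normal directions
  have hmin0 : 0 ≤ min ωy ωx := le_min hωy hωx
  have t4 : min ωy ωx * (Hy ν ν - Hx w w) ≤ K * κ * (ωy * d ^ 4) := by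
    have c1 : Hy ν ν - Hx w w ≤ K * κ * d ^ 4 := by
      calc _ ≤ p₁ * M.E2 m ξ ν w := hle _ _
        _ ≤ p₁ * (K * d ^ 5) := by gcongr; exact le_of_abs_le (hU.E2_nu m ξ ν w hm hξ hν hw)
        _ = K * (p₁ * d) * d ^ 4 := by ring
        _ ≤ _ := by gcongr
    calc _ ≤ min ωy ωx * (K * κ * d ^ 4) := by gcongr
      _ ≤ ωy * (K * κ * d ^ 4) := by gcongr; exact min_le_left _ _
      _ = _ := by ring
  have hB : 0 ≤ (κ + K * κ + 8 * K ^ 2 * κ) * d ^ 3 := by positivity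
  have t5 : Hy ν ν - Hx 0 0 ≤ (κ + K * κ + 8 * K ^ 2 * κ) * d ^ 3 :=
    (hH ν 0).trans (hU.B_zero hm hξ hν h1 h1' h2 h2' h12)
  have t6 : Hy 0 0 - Hx w w ≤ (κ + K * κ + 8 * K ^ 2 * κ) * d ^ 3 := by
    exact (hH 0 w).trans (hU.B_zero' hm hξ hw h1 h1' h2 h2' h12)
  have t56 : (ωy - min ωy ωx) * (Hy ν ν - Hx 0 0) + (ωx - min ωy ωx) * (Hy 0 0 - Hx w w) ≤
      (κ + K * κ + 8 * K ^ 2 * κ) * (|ωy - ωx| * d ^ 3) := by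
    have c1 := mul_le_mul_of_nonneg_left t5 (sub_nonneg.2 (min_le_left ωy ωx))
    have c2 := mul_le_mul_of_nonneg_left t6 (sub_nonneg.2 (min_le_right ωy ωx))
    have c3 : (ωy - min ωy ωx) + (ωx - min ωy ωx) = |ωy - ωx| := by
      rcases le_total ωy ωx with h | h
      · rw [min_eq_left h, abs_of_nonpos (by linarith)]; ring
      · rw [min_eq_right h, abs_of_nonneg (by linarith)]; ring
    rw [← c3]
    linarith
  have hHx := hq Hx
  simp only [Finset.sum_sub_distrib, map_zero, sub_zero, zero_sub,
    Finset.sum_neg_distrib] at t1' t23 t56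
  rw [hHx]
  linarith

end MetricPair

section Coordinates

variable {n : ℕ} {σ : EuclideanSpace ℝ (Fin n) → Matrix (Fin n) (Fin n) ℝ}

theorem EuclideanSpace.eq_sum_single (v : EuclideanSpace ℝ (Fin n)) :
    v = ∑ i, v i • EuclideanSpace.single i (1 : ℝ) := by
  ext j
  simp [Finset.sum_apply, Pi.single_apply]

theorem fderiv_apply_eq_sum_pd (f : EuclideanSpace ℝ (Fin n) → ℝ) (x v : EuclideanSpace ℝ (Fin n)) :
    fderiv ℝ f x v = ∑ i, v i * pd i f x := by
  conv_lhs => rw [EuclideanSpace.eq_sum_single v]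
  simp [pd]

theorem contDiff_det {A : EuclideanSpace ℝ (Fin n) → Matrix (Fin n) (Fin n) ℝ}
    (hA : ∀ i j, ContDiff ℝ (⊤ : ℕ∞) fun x => A x i j) :
    ContDiff ℝ (⊤ : ℕ∞) fun x => (A x).det := by
  simp only [Matrix.det_apply, zsmul_eq_mul, Units.smul_def]
  exact ContDiff.sum fun s _ => contDiff_const.mul (contDiff_prod fun i _ => hA _ _)

theorem contDiff_inv_apply (hσ : ∀ i j, ContDiff ℝ (⊤ : ℕ∞) fun x => σ x i j)
    (hpos : ∀ x, (σ x).PosDef) (i j : Fin n) : ContDiff ℝ (⊤ : ℕ∞) fun x => (σ x)⁻¹ i j := by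
  simp only [Matrix.inv_def, Matrix.smul_apply, Ring.inverse_eq_inv', smul_eq_mul,
    Matrix.adjugate_apply]
  refine ((contDiff_det hσ).inv fun x => (hpos x).det_pos.ne').mul (contDiff_det fun k l => ?_)
  simp only [Matrix.updateRow_apply]
  split_ifs
  · exact contDiff_const
  · exact hσ k l

theorem contDiff_pd {f : EuclideanSpace ℝ (Fin n) → ℝ} (hf : ContDiff ℝ (⊤ : ℕ∞) f) (i : Fin n) :
    ContDiff ℝ (⊤ : ℕ∞) fun x => pd i f x :=
  hf.fderiv_smooth.clm_apply contDiff_const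

theorem contDiff_christoffel (hσ : ∀ i j, ContDiff ℝ (⊤ : ℕ∞) fun x => σ x i j)
    (hpos : ∀ x, (σ x).PosDef) (k i j : Fin n) : ContDiff ℝ (⊤ : ℕ∞) (christoffel σ k i j) :=
  contDiff_const.mul (ContDiff.sum fun _ _ => (contDiff_inv_apply hσ hpos _ _).mul
    (((contDiff_pd (hσ _ _) _).add (contDiff_pd (hσ _ _) _)).sub (contDiff_pd (hσ _ _) _)))

/-- The bilinear form with matrix `A`. -/
def matrixForm (A : Matrix (Fin n) (Fin n) ℝ) :
    EuclideanSpace ℝ (Fin n) →L[ℝ] EuclideanSpace ℝ (Fin n) →L[ℝ] ℝ :=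
  ∑ i, ∑ j, A i j • (EuclideanSpace.proj i : EuclideanSpace ℝ (Fin n) →L[ℝ] ℝ).smulRight
    (EuclideanSpace.proj j : EuclideanSpace ℝ (Fin n) →L[ℝ] ℝ)

theorem matrixForm_apply (A : Matrix (Fin n) (Fin n) ℝ) (a b : EuclideanSpace ℝ (Fin n)) :
    matrixForm A a b = ∑ i, ∑ j, A i j * a i * b j := by
  simp only [matrixForm, sum_apply, smul_apply, ContinuousLinearMap.smulRight_apply,
    PiLp.proj_apply, smul_eq_mul, mul_assoc]

/-- The connection form with coefficients `christoffel σ`. -/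
def christoffelForm (σ : EuclideanSpace ℝ (Fin n) → Matrix (Fin n) (Fin n) ℝ)
    (x : EuclideanSpace ℝ (Fin n)) :
    EuclideanSpace ℝ (Fin n) →L[ℝ] EuclideanSpace ℝ (Fin n) →L[ℝ] EuclideanSpace ℝ (Fin n) :=
  ∑ k, ∑ i, ∑ j, christoffel σ k i j x •
    (EuclideanSpace.proj i : EuclideanSpace ℝ (Fin n) →L[ℝ] ℝ).smulRight
      ((EuclideanSpace.proj j : EuclideanSpace ℝ (Fin n) →L[ℝ] ℝ).smulRight
        (EuclideanSpace.single k (1 : ℝ)))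

theorem christoffelForm_apply (x a b : EuclideanSpace ℝ (Fin n)) (k : Fin n) :
    christoffelForm σ x a b k = ∑ i, ∑ j, christoffel σ k i j x * a i * b j := by
  simp only [christoffelForm, sum_apply, smul_apply, ContinuousLinearMap.smulRight_apply,
    PiLp.proj_apply, smul_eq_mul, WithLp.ofLp_sum, Finset.sum_apply, PiLp.smul_apply,
    PiLp.single_apply]
  rw [Finset.sum_eq_single k]
  · simp [mul_assoc]
  · intro l _ hl
    simp [hl.symm]
  · simp

theorem fderiv_matrixForm (hσ : ∀ i j, ContDiff ℝ (⊤ : ℕ∞) fun x => σ x i j)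
    (x c a b : EuclideanSpace ℝ (Fin n)) :
    fderiv ℝ (fun x => matrixForm (σ x)) x c a b
      = ∑ i, ∑ j, ∑ k, c k * pd k (fun y => σ y i j) x * a i * b j := by
  have hS : ContDiff ℝ (⊤ : ℕ∞) fun x => matrixForm (σ x) :=
    ContDiff.sum fun i _ => ContDiff.sum fun j _ => (hσ i j).smul contDiff_const
  have h1 := ((hS.hasFDerivAt_smooth x).clm_apply (hasFDerivAt_const a x)).clm_apply
    (hasFDerivAt_const b x)
  simp only [matrixForm_apply] at h1
  have h2 : HasFDerivAt (fun x => ∑ i, ∑ j, σ x i j * a i * b j)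
      (∑ i, ∑ j, b j • a i • fderiv ℝ (fun x => σ x i j) x) x :=
    HasFDerivAt.fun_sum fun i _ => HasFDerivAt.fun_sum fun j _ =>
      (((hσ i j).hasFDerivAt_smooth x).mul_const (a i)).mul_const (b j)
  have := DFunLike.congr_fun (h1.unique h2) c
  simp at this
  simp only [fderiv_apply_eq_sum_pd, Finset.mul_sum] at this
  rw [this]
  exact Finset.sum_congr rfl fun i _ => Finset.sum_congr rfl fun j _ =>
    Finset.sum_congr rfl fun k _ => by ring

theorem symm_apply (hpos : ∀ x, (σ x).PosDef) (x : EuclideanSpace ℝ (Fin n)) (i j : Fin n) :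
    σ x i j = σ x j i := by
  simpa using ((hpos x).isHermitian.apply i j).symm

theorem sum_mul_christoffel (hpos : ∀ x, (σ x).PosDef) (x : EuclideanSpace ℝ (Fin n))
    (l i j : Fin n) : ∑ k, σ x l k * christoffel σ k i j x =
      1 / 2 * (pd j (fun y => σ y l i) x + pd i (fun y => σ y l j) x
        - pd l (fun y => σ y i j) x) := by
  simp only [christoffel, Finset.mul_sum]
  rw [Finset.sum_comm]
  have h : ∀ m, ∑ k, σ x l k * (σ x)⁻¹ k m = if l = m then 1 else 0 := fun m => by
    rw [← Matrix.mul_apply, Matrix.mul_nonsing_inv _ (hpos x).det_pos.ne'.isUnit, Matrix.one_apply]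
  calc _ = ∑ m, (∑ k, σ x l k * (σ x)⁻¹ k m) * (1 / 2 * (pd j (fun y => σ y m i) x
        + pd i (fun y => σ y m j) x - pd m (fun y => σ y i j) x)) := by
        refine Finset.sum_congr rfl fun m _ => ?_
        rw [Finset.sum_mul]
        exact Finset.sum_congr rfl fun k _ => by ring
    _ = _ := by simp [h]

theorem matrixForm_christoffelForm (hpos : ∀ x, (σ x).PosDef)
    (x a b c : EuclideanSpace ℝ (Fin n)) :
    matrixForm (σ x) c (christoffelForm σ x a b) = ∑ l, ∑ i, ∑ j,
      c l * a i * b j * (1 / 2 * (pd j (fun y => σ y l i) x + pd i (fun y => σ y l j) x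
        - pd l (fun y => σ y i j) x)) := by
  simp only [matrixForm_apply, christoffelForm_apply, ← sum_mul_christoffel hpos]
  refine Finset.sum_congr rfl fun l _ => ?_
  simp only [Finset.mul_sum]
  rw [Finset.sum_comm]
  refine Finset.sum_congr rfl fun i _ => ?_
  rw [Finset.sum_comm]
  refine Finset.sum_congr rfl fun j _ => ?_
  exact Finset.sum_congr rfl fun k _ => by ring

theorem matrixForm_symm {A : Matrix (Fin n) (Fin n) ℝ} (hA : A.PosDef)
    (a b : EuclideanSpace ℝ (Fin n)) : matrixForm A a b = matrixForm A b a := by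
  rw [matrixForm_apply, matrixForm_apply, Finset.sum_comm]
  refine Finset.sum_congr rfl fun i _ => Finset.sum_congr rfl fun j _ => ?_
  have : A i j = A j i := by simpa using (hA.isHermitian.apply i j).symm
  rw [this]; ring

theorem christoffel_symm (hpos : ∀ x, (σ x).PosDef) (k i j : Fin n) (x : EuclideanSpace ℝ (Fin n)) :
    christoffel σ k i j x = christoffel σ k j i x := by
  simp only [christoffel, symm_apply hpos _ i j]
  congr 1
  exact Finset.sum_congr rfl fun l _ => by ring

theorem sum_comm_cycle (F : Fin n → Fin n → Fin n → ℝ) :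
    ∑ i, ∑ j, ∑ k, F i j k = ∑ k, ∑ i, ∑ j, F i j k := by
  rw [Finset.sum_comm' (t' := Finset.univ) (s' := fun _ => Finset.univ) (by simp)]
  calc ∑ j, ∑ i, ∑ k, F i j k = ∑ j, ∑ k, ∑ i, F i j k :=
        Finset.sum_congr rfl fun j _ => Finset.sum_comm
    _ = ∑ k, ∑ j, ∑ i, F i j k := Finset.sum_comm
    _ = _ := Finset.sum_congr rfl fun k _ => Finset.sum_comm

/-- The `MetricPair` of a smooth Riemannian metric given in coordinates. -/
def metricPair (σ : EuclideanSpace ℝ (Fin n) → Matrix (Fin n) (Fin n) ℝ)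
    (hσ : ∀ i j, ContDiff ℝ (⊤ : ℕ∞) fun x => σ x i j) (hpos : ∀ x, (σ x).PosDef) :
    MetricPair (EuclideanSpace ℝ (Fin n)) where
  S x := matrixForm (σ x)
  Γ x := christoffelForm σ x
  contDiff_S := ContDiff.sum fun i _ => ContDiff.sum fun j _ => (hσ i j).smul contDiff_const
  contDiff_Γ := ContDiff.sum fun k _ => ContDiff.sum fun i _ => ContDiff.sum fun j _ =>
    (contDiff_christoffel hσ hpos k i j).smul contDiff_const
  S_symm x := matrixForm_symm (hpos x)
  Γ_symm x a b := by
    ext k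
    rw [christoffelForm_apply, christoffelForm_apply, Finset.sum_comm]
    exact Finset.sum_congr rfl fun i _ => Finset.sum_congr rfl fun j _ => by
      rw [christoffel_symm hpos k j i]; ring
  compat x c a b := by
    rw [matrixForm_symm (hpos x) _ b, matrixForm_christoffelForm hpos,
      matrixForm_christoffelForm hpos, fderiv_matrixForm hσ]
    have e1 := sum_comm_cycle fun i j l =>
      b l * c i * a j * (1 / 2 * (pd j (fun y => σ y l i) x + pd i (fun y => σ y l j) x
        - pd l (fun y => σ y i j) x))
    have e2 : ∀ F : Fin n → Fin n → Fin n → ℝ,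
        ∑ l, ∑ i, ∑ j, F l i j = ∑ i, ∑ l, ∑ j, F l i j := fun F => Finset.sum_comm
    rw [sum_comm_cycle fun i j k => c k * pd k (fun y => σ y i j) x * a i * b j, ← e1,
      e2 (fun l i j => a l * c i * b j * _), ← Finset.sum_add_distrib]
    refine Finset.sum_congr rfl fun i _ => ?_
    rw [← Finset.sum_add_distrib]
    refine Finset.sum_congr rfl fun j _ => ?_
    rw [← Finset.sum_add_distrib]
    refine Finset.sum_congr rfl fun l _ => ?_
    simp only [symm_apply hpos _ l i, symm_apply hpos _ l j]
    rw [show (fun y => σ y j i) = fun y => σ y i j from funext fun y => symm_apply hpos y j i]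
    ring
  pos x a ha := by
    have h := (hpos x).dotProduct_mulVec_pos (x := a.ofLp) (by simpa using ha)
    rw [matrixForm_apply]
    simp only [dotProduct, Matrix.mulVec, Finset.mul_sum, Pi.star_apply, star_trivial] at h
    refine h.trans_eq (Finset.sum_congr rfl fun i _ => Finset.sum_congr rfl fun j _ => by ring)

theorem exists_isFrame {A : Matrix (Fin n) (Fin n) ℝ} (hA : A.PosDef) :
    ∃ f : Fin n → EuclideanSpace ℝ (Fin n), IsFrame (matrixForm A) f := by
  let U := hA.isHermitian.eigenvectorBasis
  let μ := hA.isHermitian.eigenvalues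
  have hμ : ∀ i, 0 < μ i := hA.eigenvalues_pos
  have hU : ∀ i v, matrixForm A (U i) v = μ i * inner ℝ (U i) v := by
    intro i v
    rw [matrixForm_symm hA]
    have h := hA.isHermitian.mulVec_eigenvectorBasis i
    have : ∀ k, ∑ j, A k j * U i j = μ i * U i k := fun k => congrFun h k
    rw [matrixForm_apply]
    calc _ = ∑ k, v k * ∑ j, A k j * U i j := by
          simp only [Finset.mul_sum]
          exact Finset.sum_congr rfl fun k _ => Finset.sum_congr rfl fun j _ => by ring
      _ = _ := by
          simp only [this, PiLp.inner_apply, Finset.mul_sum]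
          refine Finset.sum_congr rfl fun k _ => ?_
          simp; ring
  refine ⟨fun i => (√(μ i))⁻¹ • U i, ⟨fun i j => ?_, fun v => ?_⟩⟩
  · simp only [map_smul, smul_apply, smul_eq_mul, hU]
    rw [orthonormal_iff_ite.1 U.orthonormal i j]
    split_ifs with h
    · subst h
      have := Real.mul_self_sqrt (hμ i).le
      have h0 := (Real.sqrt_pos.2 (hμ i)).ne'
      field_simp
      rw [sq, this]
    · simp
  · simp only [map_smul, smul_apply, smul_eq_mul, hU, smul_smul]
    conv_lhs => rw [← U.sum_repr' v]
    refine Finset.sum_congr rfl fun i _ => ?_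
    congr 1
    have := Real.mul_self_sqrt (hμ i).le
    have h0 := (Real.sqrt_pos.2 (hμ i)).ne'
    field_simp
    rw [sq, this]

end Coordinates

section Traces

variable {n : ℕ} {σ : EuclideanSpace ℝ (Fin n) → Matrix (Fin n) (Fin n) ℝ}
  {A : Matrix (Fin n) (Fin n) ℝ} {f : Fin n → EuclideanSpace ℝ (Fin n)}

theorem apply_eq_sum_single (p : EuclideanSpace ℝ (Fin n) →L[ℝ] ℝ) (v : EuclideanSpace ℝ (Fin n)) :
    p v = ∑ i, v i * p (EuclideanSpace.single i 1) := by
  conv_lhs => rw [EuclideanSpace.eq_sum_single v]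
  simp

theorem apply_apply_eq_sum_single
    (Q : EuclideanSpace ℝ (Fin n) →L[ℝ] EuclideanSpace ℝ (Fin n) →L[ℝ] ℝ)
    (v w : EuclideanSpace ℝ (Fin n)) :
    Q v w = ∑ i, ∑ j, v i * w j * Q (EuclideanSpace.single i 1) (EuclideanSpace.single j 1) := by
  conv_lhs => rw [EuclideanSpace.eq_sum_single v, EuclideanSpace.eq_sum_single w]
  exact IsFrame.bilin_sum Q _ _

/-- The vector dual to the covector `p` with respect to `A`. -/
def sharp (A : Matrix (Fin n) (Fin n) ℝ) (p : EuclideanSpace ℝ (Fin n) →L[ℝ] ℝ) :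
    EuclideanSpace ℝ (Fin n) :=
  ∑ i, (∑ j, A⁻¹ i j * p (EuclideanSpace.single j 1)) • EuclideanSpace.single i (1 : ℝ)

theorem sharp_apply (p : EuclideanSpace ℝ (Fin n) →L[ℝ] ℝ) (i : Fin n) :
    sharp A p i = ∑ j, A⁻¹ i j * p (EuclideanSpace.single j 1) := by
  simp [sharp, Finset.sum_apply, Pi.single_apply]

theorem matrixForm_sharp (hA : A.PosDef) (p : EuclideanSpace ℝ (Fin n) →L[ℝ] ℝ)
    (a : EuclideanSpace ℝ (Fin n)) : matrixForm A (sharp A p) a = p a := by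
  rw [matrixForm_symm hA, matrixForm_apply, apply_eq_sum_single p a]
  refine Finset.sum_congr rfl fun i _ => ?_
  have h : ∀ m, ∑ k, A i k * A⁻¹ k m = if i = m then 1 else 0 := fun m => by
    rw [← Matrix.mul_apply, Matrix.mul_nonsing_inv _ hA.det_pos.ne'.isUnit, Matrix.one_apply]
  simp only [sharp_apply, Finset.mul_sum]
  rw [Finset.sum_comm]
  calc _ = ∑ m, (∑ k, A i k * A⁻¹ k m) * (a i * p (EuclideanSpace.single m 1)) := by
        refine Finset.sum_congr rfl fun m _ => ?_
        rw [Finset.sum_mul]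
        exact Finset.sum_congr rfl fun k _ => by ring
    _ = _ := by simp [h]

theorem eq_of_matrixForm_eq (hA : A.PosDef) {v w : EuclideanSpace ℝ (Fin n)}
    (h : ∀ a, matrixForm A v a = matrixForm A w a) : v = w := by
  obtain ⟨f, hf⟩ := exists_isFrame hA
  rw [hf.expand v, hf.expand w]
  refine Finset.sum_congr rfl fun i _ => ?_
  rw [matrixForm_symm hA, h, matrixForm_symm hA]

theorem gradSq_eq (u : EuclideanSpace ℝ (Fin n) → ℝ) (x : EuclideanSpace ℝ (Fin n)) :
    gradSq σ u x = fderiv ℝ u x (sharp (σ x) (fderiv ℝ u x)) := by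
  rw [apply_eq_sum_single]
  simp only [sharp_apply, gradSq, Finset.sum_mul]
  exact Finset.sum_congr rfl fun i _ => Finset.sum_congr rfl fun j _ => by simp only [pd]; ring

theorem IsFrame.sum_mul (hA : A.PosDef) (hf : IsFrame (matrixForm A) f) (i j : Fin n) :
    ∑ k, f k i * f k j = A⁻¹ i j := by
  let e : EuclideanSpace ℝ (Fin n) →L[ℝ] ℝ := EuclideanSpace.proj j
  have h := congrArg (fun v : EuclideanSpace ℝ (Fin n) => v i) (hf.expand (sharp A e))
  simp only [matrixForm_symm hA _ (sharp A e), matrixForm_sharp hA, sharp_apply,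
    WithLp.ofLp_sum, Finset.sum_apply, PiLp.smul_apply, smul_eq_mul] at h
  have h2 : ∑ m, A⁻¹ i m * e (EuclideanSpace.single m 1) = A⁻¹ i j := by
    simp [e]
  rw [← h2, h]
  exact Finset.sum_congr rfl fun k _ => by simp only [e, PiLp.proj_apply]; ring

theorem IsFrame.sum_apply (hA : A.PosDef) (hf : IsFrame (matrixForm A) f)
    (Q : EuclideanSpace ℝ (Fin n) →L[ℝ] EuclideanSpace ℝ (Fin n) →L[ℝ] ℝ) :
    ∑ k, Q (f k) (f k) = ∑ i, ∑ j, A⁻¹ i j *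
      Q (EuclideanSpace.single i 1) (EuclideanSpace.single j 1) := by
  simp only [apply_apply_eq_sum_single Q (f _)]
  rw [← sum_comm_cycle]
  refine Finset.sum_congr rfl fun i _ => Finset.sum_congr rfl fun j _ => ?_
  rw [← hf.sum_mul hA, Finset.sum_mul]

/-- The covariant Hessian as a bilinear form. -/
def hessForm (σ : EuclideanSpace ℝ (Fin n) → Matrix (Fin n) (Fin n) ℝ)
    (u : EuclideanSpace ℝ (Fin n) → ℝ) (x : EuclideanSpace ℝ (Fin n)) :
    EuclideanSpace ℝ (Fin n) →L[ℝ] EuclideanSpace ℝ (Fin n) →L[ℝ] ℝ :=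
  fderiv ℝ (fderiv ℝ u) x -
    (ContinuousLinearMap.compL ℝ _ _ _ (fderiv ℝ u x)).comp (christoffelForm σ x)

theorem hessForm_apply (u : EuclideanSpace ℝ (Fin n) → ℝ) (x a b : EuclideanSpace ℝ (Fin n)) :
    hessForm σ u x a b = fderiv ℝ (fderiv ℝ u) x a b - fderiv ℝ u x (christoffelForm σ x a b) := rfl

theorem covHess_eq {u : EuclideanSpace ℝ (Fin n) → ℝ} {x : EuclideanSpace ℝ (Fin n)}
    (hu : DifferentiableAt ℝ (fderiv ℝ u) x) (i j : Fin n) :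
    covHess σ u i j x =
      hessForm σ u x (EuclideanSpace.single i 1) (EuclideanSpace.single j 1) := by
  rw [hessForm_apply, covHess]
  congr 1
  · have := (hu.hasFDerivAt.clm_apply (hasFDerivAt_const (EuclideanSpace.single j (1:ℝ)) x)).fderiv
    simp only [pd]
    rw [this]
    simp
  · rw [apply_eq_sum_single]
    refine Finset.sum_congr rfl fun k _ => ?_
    rw [christoffelForm_apply]
    simp [pd]

theorem mcfOp_eq {u : EuclideanSpace ℝ (Fin n) → ℝ} {x : EuclideanSpace ℝ (Fin n)}
    (hA : (σ x).PosDef) (hf : IsFrame (matrixForm (σ x)) f)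
    (hu : DifferentiableAt ℝ (fderiv ℝ u) x) :
    mcfOp σ u x = ∑ k, hessForm σ u x (f k) (f k) +
      hessForm σ u x (sharp (σ x) (fderiv ℝ u x)) (sharp (σ x) (fderiv ℝ u x))
        / (1 - gradSq σ u x) := by
  rw [hf.sum_apply hA, apply_apply_eq_sum_single (hessForm σ u x) (sharp _ _), mcfOp,
    Finset.sum_div, ← Finset.sum_add_distrib]
  refine Finset.sum_congr rfl fun i _ => ?_
  rw [Finset.sum_div, ← Finset.sum_add_distrib]
  refine Finset.sum_congr rfl fun j _ => ?_
  rw [covHess_eq hu, ginv, add_mul, sharp_apply, sharp_apply, Finset.sum_mul_sum]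
  congr 1
  rw [div_mul_eq_mul_div]
  congr 2
  exact Finset.sum_congr rfl fun k _ => Finset.sum_congr rfl fun l _ => by simp only [pd]; ring

theorem IsFrame.sum_apply_map (hf : IsFrame (matrixForm A) f)
    (L : EuclideanSpace ℝ (Fin n) →ₗ[ℝ] EuclideanSpace ℝ (Fin n)) :
    ∑ k, matrixForm A (f k) (L (f k)) = ∑ i, L (EuclideanSpace.single i 1) i := by
  have h : ∀ i, L (EuclideanSpace.single i 1) i =
      ∑ k, matrixForm A (f k) (EuclideanSpace.single i 1) * L (f k) i := fun i => by
    conv_lhs => rw [hf.expand (EuclideanSpace.single i 1)]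
    simp [Finset.sum_apply]
  simp only [h]
  rw [Finset.sum_comm]
  refine Finset.sum_congr rfl fun k _ => ?_
  rw [apply_eq_sum_single (matrixForm A (f k)) (L (f k))]
  exact Finset.sum_congr rfl fun i _ => mul_comm _ _

theorem fderiv_christoffelForm (hσ : ∀ i j, ContDiff ℝ (⊤ : ℕ∞) fun x => σ x i j)
    (hpos : ∀ x, (σ x).PosDef) (x c a b : EuclideanSpace ℝ (Fin n)) (k : Fin n) :
    fderiv ℝ (christoffelForm σ) x c a b k
      = ∑ i, ∑ j, (∑ l, c l * pd l (fun y => christoffel σ k i j y) x) * a i * b j := by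
  have hS : ContDiff ℝ (⊤ : ℕ∞) (christoffelForm σ) := (metricPair σ hσ hpos).contDiff_Γ
  have h1 := (EuclideanSpace.proj k : EuclideanSpace ℝ (Fin n) →L[ℝ] ℝ).hasFDerivAt.comp x
    (((hS.hasFDerivAt_smooth x).clm_apply (hasFDerivAt_const a x)).clm_apply
      (hasFDerivAt_const b x))
  have h2 : HasFDerivAt (fun x => ∑ i, ∑ j, christoffel σ k i j x * a i * b j)
      (∑ i, ∑ j, b j • a i • fderiv ℝ (fun x => christoffel σ k i j x) x) x :=
    HasFDerivAt.fun_sum fun i _ => HasFDerivAt.fun_sum fun j _ =>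
      (((contDiff_christoffel hσ hpos k i j).hasFDerivAt_smooth x).mul_const (a i)).mul_const (b j)
  have h3 : (fun x => ∑ i, ∑ j, christoffel σ k i j x * a i * b j) =
      (EuclideanSpace.proj k : EuclideanSpace ℝ (Fin n) →L[ℝ] ℝ) ∘
        fun y => christoffelForm σ y a b :=
    funext fun y => (christoffelForm_apply y a b k).symm
  rw [h3] at h2
  have := DFunLike.congr_fun (h1.unique h2) c
  simp [fderiv_apply_eq_sum_pd] at this
  rw [this]
  exact Finset.sum_congr rfl fun i _ => Finset.sum_congr rfl fun j _ => by ring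

theorem sum_curv_eq_ricci (hσ : ∀ i j, ContDiff ℝ (⊤ : ℕ∞) fun x => σ x i j)
    (hpos : ∀ x, (σ x).PosDef) (x ξ : EuclideanSpace ℝ (Fin n))
    (hf : IsFrame (matrixForm (σ x)) f) :
    ∑ k, matrixForm (σ x) ξ ((metricPair σ hσ hpos).curv x (f k) ξ (f k)) =
      -∑ j, ∑ l, ricci σ j l x * ξ j * ξ l := by
  set M := metricPair σ hσ hpos with hM
  have hS : ∀ a b, M.S x a b = matrixForm (σ x) a b := fun _ _ => rfl
  have hΓ : ∀ a b, M.Γ x a b = christoffelForm σ x a b := fun _ _ => rfl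
  have hΓ' : ∀ a b c, fderiv ℝ M.Γ x a b c = fderiv ℝ (christoffelForm σ) x a b c :=
    fun _ _ _ => rfl
  let L : EuclideanSpace ℝ (Fin n) →ₗ[ℝ] EuclideanSpace ℝ (Fin n) :=
    { toFun := fun V => M.curv x V ξ ξ
      map_add' := fun a b => by
        simp only [MetricPair.curv, map_add, add_apply]; abel
      map_smul' := fun c a => by
        simp only [MetricPair.curv, map_smul, smul_apply, RingHom.id_apply, smul_sub, smul_add] }
  have h1 : ∀ k, matrixForm (σ x) ξ (M.curv x (f k) ξ (f k)) =
      -matrixForm (σ x) (f k) (L (f k)) := fun k => by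
    have := M.curv_skew x (f k) ξ ξ (f k)
    rw [hS, hS, matrixForm_symm (hpos x)] at this
    exact eq_neg_of_add_eq_zero_right this
  simp only [h1, Finset.sum_neg_distrib, hf.sum_apply_map]
  congr 1
  have h2 : ∀ i, L (EuclideanSpace.single i 1) i = ∑ j, ∑ l,
      (pd i (fun y => christoffel σ i j l y) x - pd j (fun y => christoffel σ i i l y) x
        + ∑ p, christoffel σ i i p x * christoffel σ p j l x
        - ∑ p, christoffel σ i j p x * christoffel σ p i l x) * ξ j * ξ l := by
    intro i
    change M.curv x (EuclideanSpace.single i 1) ξ ξ i = _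
    simp only [MetricPair.curv, hΓ, hΓ', PiLp.sub_apply, PiLp.add_apply,
      fderiv_christoffelForm hσ hpos, christoffelForm_apply]
    simp only [PiLp.single_apply, ite_mul, mul_ite, one_mul, zero_mul, mul_one, mul_zero,
      Finset.sum_ite_eq', Finset.mem_univ, if_true, Finset.sum_ite_irrel,
      Finset.sum_const_zero]
    simp only [sub_mul, add_mul, Finset.sum_sub_distrib, Finset.sum_add_distrib]
    congr 1
    · congr 1
      · congr 1
        rw [Finset.sum_comm]
        simp only [Finset.sum_mul]
        exact Finset.sum_congr rfl fun j _ => Finset.sum_congr rfl fun l _ => by ring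
      · simp only [Finset.mul_sum, Finset.sum_mul]
        rw [← sum_comm_cycle]
        exact Finset.sum_congr rfl fun j _ => Finset.sum_congr rfl fun l _ =>
          Finset.sum_congr rfl fun p _ => by ring
    · simp only [Finset.mul_sum, Finset.sum_mul]
      refine Finset.sum_congr rfl fun j _ => ?_
      rw [Finset.sum_comm]
      exact Finset.sum_congr rfl fun l _ => Finset.sum_congr rfl fun p _ => by ring
  simp only [h2]
  rw [← sum_comm_cycle]
  refine Finset.sum_congr rfl fun j _ => Finset.sum_congr rfl fun l _ => ?_
  rw [← Finset.sum_mul, ← Finset.sum_mul, ricci]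
  simp only [Finset.sum_sub_distrib, Finset.sum_add_distrib]

end Traces

section MaximumPrinciple

theorem IsLocalMax.hasDerivAt_hasDerivAt_nonpos {φ φ' : ℝ → ℝ} {D s₀ : ℝ}
    (h : ∀ᶠ s in nhds s₀, HasDerivAt φ (φ' s) s) (h2 : HasDerivAt φ' D s₀)
    (hmax : IsLocalMax φ s₀) : φ' s₀ = 0 ∧ D ≤ 0 := by
  have h0 : φ' s₀ = 0 := hmax.hasDerivAt_eq_zero h.self_of_nhds
  refine ⟨h0, ?_⟩
  by_contra! hD
  have hd : deriv φ =ᶠ[nhds s₀] φ' := h.mono fun s hs => hs.deriv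
  have hmin : IsLocalMin φ s₀ := isLocalMin_of_deriv_deriv_pos
    (by rw [hd.deriv_eq, h2.deriv]; exact hD) (by rw [hd.self_of_nhds, h0])
    h.self_of_nhds.continuousAt
  have hc : φ =ᶠ[nhds s₀] fun _ => φ s₀ := by
    filter_upwards [hmin, hmax] with s h1 h2
    exact le_antisymm h2 h1
  have h3 : φ' =ᶠ[nhds s₀] fun _ => 0 := by
    filter_upwards [hd, hc.eventuallyEq_nhds] with s h1 h2
    rw [← h1, h2.deriv_eq]
    simp
  have h4 := h3.deriv_eq
  rw [h2.deriv] at h4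
  simp at h4
  linarith

variable {X : Type*} [NormedAddCommGroup X] [NormedSpace ℝ X]

theorem ContDiffAt.eventually_hasDerivAt_line {u : X → ℝ} {x : X} (hu : ContDiffAt ℝ 2 u x) (V : X)
    :
    ∀ᶠ s in nhds (0 : ℝ), HasDerivAt (fun s => u (x + s • V)) (fderiv ℝ u (x + s • V) V) s := by
  have h1 : ∀ᶠ z in nhds x, DifferentiableAt ℝ u z :=
    (hu.eventually (by simp)).mono fun z hz => hz.differentiableAt (by norm_num)
  have h2 : Tendsto (fun s : ℝ => x + s • V) (nhds 0) (nhds x) := by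
    have : Continuous fun s : ℝ => x + s • V := by fun_prop
    simpa using this.tendsto 0
  filter_upwards [h2.eventually h1] with s hs
  exact hasDerivAt_comp_line hs.hasFDerivAt

theorem ContDiffAt.differentiableAt_fderiv {u : X → ℝ} {x : X} (hu : ContDiffAt ℝ 2 u x) :
    DifferentiableAt ℝ (fderiv ℝ u) x :=
  (hu.fderiv_right (m := 1) (by norm_num)).differentiableAt (by norm_num)

theorem ContDiffAt.hasDerivAt_fderiv_line {u : X → ℝ} {x : X} (hu : ContDiffAt ℝ 2 u x) (V : X) :
    HasDerivAt (fun s : ℝ => fderiv ℝ u (x + s • V) V) (fderiv ℝ (fderiv ℝ u) x V V) 0 := by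
  have h : HasFDerivAt (fderiv ℝ u) (fderiv ℝ (fderiv ℝ u) x) (x + (0:ℝ) • V) := by
    simpa using hu.differentiableAt_fderiv.hasFDerivAt
  exact (hasDerivAt_comp_line h).clm_apply (hasDerivAt_const (0:ℝ) V) |>.congr_deriv (by simp)

theorem IsLocalMax.fderiv_fderiv_nonpos {u : X → ℝ} {x : X} (hm : IsLocalMax u x)
    (hu : ContDiffAt ℝ 2 u x) (V : X) : fderiv ℝ (fderiv ℝ u) x V V ≤ 0 := by
  refine (IsLocalMax.hasDerivAt_hasDerivAt_nonpos (hu.eventually_hasDerivAt_line V)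
    (hu.hasDerivAt_fderiv_line V) ?_).2
  have hc : Tendsto (fun s : ℝ => x + s • V) (nhds 0) (nhds x) := by
    have : Continuous fun s : ℝ => x + s • V := by fun_prop
    simpa using this.tendsto 0
  have := hc.eventually hm
  simpa [IsLocalMax, IsMaxFilter] using this

/-- A function which is nonpositive initially and whose small positive spatial maxima do not
increase stays nonpositive. -/
theorem nonpos_of_forall_max_nonincreasing {P : Type*} [TopologicalSpace P] {K : Set P}
    (hK : IsCompact K)
    {N : ℝ → P → ℝ} {t₁ κ : ℝ} (hκ : 0 < κ)
    (hN : ContinuousOn (fun q : ℝ × P => N q.1 q.2) (Icc 0 t₁ ×ˢ K))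
    (h0 : ∀ p ∈ K, N 0 p ≤ 0)
    (hmax : ∀ t ∈ Ioc 0 t₁, ∀ p ∈ K, (∀ q ∈ K, N t q ≤ N t p) → 0 < N t p → N t p ≤ κ →
      ∃ D ≤ 0, HasDerivAt (fun s => N s p) D t) :
    ∀ t ∈ Icc 0 t₁, ∀ p ∈ K, N t p ≤ 0 := by
  intro t ht p hp
  have ht₁ : 0 ≤ t₁ := ht.1.trans ht.2
  by_contra! hpos
  obtain ⟨η, hη0, hη1, hη2⟩ : ∃ η > 0, η * (1 + t₁) ≤ κ ∧ η * (1 + t₁) < N t p := by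
    refine ⟨min κ (N t p) / 2 / (1 + t₁), by positivity, ?_, ?_⟩
    · rw [div_mul_cancel₀ _ (by positivity)]
      linarith [min_le_left κ (N t p)]
    · rw [div_mul_cancel₀ _ (by positivity)]
      linarith [min_le_right κ (N t p)]
  set Z : ℝ × P → ℝ := fun q => N q.1 q.2 - η * (1 + q.1) with hZ
  have hZc : ContinuousOn Z (Icc 0 t₁ ×ˢ K) := hN.sub (by fun_prop)
  have hcomp : IsCompact ((Icc 0 t₁ ×ˢ K) ∩ Z ⁻¹' Ici 0) := by
    have hS : IsCompact (Icc 0 t₁ ×ˢ K) := isCompact_Icc.prod hK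
    obtain ⟨F, hF, hFe⟩ := continuousOn_iff_isClosed.1 hZc (Ici 0) isClosed_Ici
    rw [inter_comm, hFe, inter_comm]
    exact hS.inter_right hF
  have hne : ((Icc 0 t₁ ×ˢ K) ∩ Z ⁻¹' Ici 0).Nonempty := ⟨(t, p), ⟨ht, hp⟩, by
    have : η * (1 + t) ≤ η * (1 + t₁) := by gcongr; exact ht.2
    simp only [mem_preimage, mem_Ici, hZ]; linarith⟩
  obtain ⟨⟨s, q⟩, ⟨⟨hs, hq⟩, hZq⟩, hmin⟩ := hcomp.exists_isMinOn hne continuous_fst.continuousOn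
  simp only [mem_preimage, mem_Ici] at hZq hs hq
  have hlt : ∀ r ∈ Icc 0 t₁, ∀ p' ∈ K, r < s → Z (r, p') < 0 := by
    intro r hr p' hp' hrs
    by_contra! hc
    have := hmin (a := (r, p')) ⟨⟨hr, hp'⟩, hc⟩
    simp at this
    linarith
  have hs0 : 0 < s := by
    rcases hs.1.lt_or_eq with h | h
    · exact h
    · have := h0 q hq
      rw [← h] at hZq
      simp only [hZ] at hZq
      linarith
  have hev : ∀ᶠ r in nhdsWithin s (Iio s), r ∈ Icc 0 t₁ ∧ r < s := by
    filter_upwards [Ioo_mem_nhdsLT hs0] with r hr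
    exact ⟨⟨hr.1.le, hr.2.le.trans hs.2⟩, hr.2⟩
  have hle : ∀ p' ∈ K, Z (s, p') ≤ 0 := by
    intro p' hp'
    have hcont : ContinuousWithinAt (fun r => Z (r, p')) (Icc 0 t₁) s :=
      (hZc (s, p') ⟨hs, hp'⟩).comp (f := fun r => (r, p')) (by fun_prop) fun r hr => ⟨hr, hp'⟩
    have h1 : Tendsto (fun r => Z (r, p')) (nhdsWithin s (Iio s)) (nhds (Z (s, p'))) :=
      hcont.tendsto.mono_left (le_inf inf_le_left (le_principal_iff.2 (hev.mono fun r hr => hr.1)))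
    exact le_of_tendsto h1 (hev.mono fun r hr => (hlt r hr.1 p' hp' hr.2).le)
  have hZ0 : Z (s, q) = 0 := le_antisymm (hle q hq) hZq
  have hNq : N s q = η * (1 + s) := by simp only [hZ] at hZ0; linarith
  obtain ⟨D, hD, hder⟩ := hmax s ⟨hs0, hs.2⟩ q hq
    (fun p' hp' => by have := hle p' hp'; simp only [hZ] at this; linarith)
    (by rw [hNq]; positivity)
    (by rw [hNq]; refine le_trans ?_ hη1; gcongr; exact hs.2)
  have hZd : HasDerivAt (fun r => Z (r, q)) (D - η) s := by
    simp only [hZ]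
    refine (hder.sub (((hasDerivAt_id s).const_add 1).const_mul η)).congr_deriv ?_
    simp
  have hslope := (hasDerivAt_iff_tendsto_slope.1 hZd).mono_left
    (nhdsWithin_mono s (show Iio s ⊆ {s}ᶜ from fun r hr => ne_of_lt hr))
  have h3 : 0 ≤ D - η := by
    refine ge_of_tendsto hslope (hev.mono fun r hr => ?_)
    have h4 := hlt r hr.1 q hq hr.2
    rw [slope_def_field, hZ0]
    exact div_nonneg_of_nonpos (by linarith) (by linarith [hr.2])
  linarith

end MaximumPrinciple

section Barrier

variable {n : ℕ}

/-- `u` solves the graphical mean curvature flow on the ball of radius `ρ` up to time `t₁`, with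
zero
boundary values. -/
structure IsGraphicalFlow (σ : EuclideanSpace ℝ (Fin n) → Matrix (Fin n) (Fin n) ℝ) (ρ t₁ : ℝ)
    (u : ℝ → EuclideanSpace ℝ (Fin n) → ℝ) : Prop where
  continuousOn : ContinuousOn (fun p : ℝ × EuclideanSpace ℝ (Fin n) => u p.1 p.2)
    (Icc 0 t₁ ×ˢ closedBall 0 ρ)
  contDiffOn : ∀ t ∈ Ioc 0 t₁, ContDiffOn ℝ 2 (u t) (ball 0 ρ)
  hasDerivAt : ∀ t ∈ Ioc 0 t₁, ∀ x ∈ ball (0 : EuclideanSpace ℝ (Fin n)) ρ,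
    HasDerivAt (fun s => u s x) (mcfOp σ (u t) x) t
  boundary : ∀ t ∈ Icc 0 t₁, ∀ x, ‖x‖ = ρ → u t x = 0

variable {σ : EuclideanSpace ℝ (Fin n) → Matrix (Fin n) (Fin n) ℝ} {ρ t₁ : ℝ}
  {u : ℝ → EuclideanSpace ℝ (Fin n) → ℝ}

theorem pd_neg (i : Fin n) (f : EuclideanSpace ℝ (Fin n) → ℝ) (x : EuclideanSpace ℝ (Fin n)) :
    pd i (fun y => -f y) x = -pd i f x := by
  simp only [pd]
  rw [fderiv_fun_neg]
  simp

theorem gradSq_neg (f : EuclideanSpace ℝ (Fin n) → ℝ) (x : EuclideanSpace ℝ (Fin n)) :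
    gradSq σ (fun y => -f y) x = gradSq σ f x := by
  simp only [gradSq, pd_neg]
  simp

theorem mcfOp_neg (f : EuclideanSpace ℝ (Fin n) → ℝ) (x : EuclideanSpace ℝ (Fin n)) :
    mcfOp σ (fun y => -f y) x = -mcfOp σ f x := by
  simp only [mcfOp, ginv, covHess, gradSq_neg, pd_neg]
  rw [← Finset.sum_neg_distrib]
  refine Finset.sum_congr rfl fun i _ => ?_
  rw [← Finset.sum_neg_distrib]
  refine Finset.sum_congr rfl fun j _ => ?_
  simp only [mul_neg, neg_mul, neg_neg, Finset.sum_neg_distrib]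
  ring

theorem IsGraphicalFlow.neg (hu : IsGraphicalFlow σ ρ t₁ u) :
    IsGraphicalFlow σ ρ t₁ fun t x => -u t x where
  continuousOn := hu.continuousOn.neg
  contDiffOn t ht := (hu.contDiffOn t ht).neg
  hasDerivAt t ht x hx := by
    rw [mcfOp_neg]
    exact (hu.hasDerivAt t ht x hx).neg
  boundary t ht x hx := by simp [hu.boundary t ht x hx]

theorem IsGraphicalFlow.contDiffAt (hu : IsGraphicalFlow σ ρ t₁ u) {t : ℝ} (ht : t ∈ Ioc 0 t₁)
    {x : EuclideanSpace ℝ (Fin n)} (hx : x ∈ ball (0 : EuclideanSpace ℝ (Fin n)) ρ) :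
    ContDiffAt ℝ 2 (u t) x :=
  (hu.contDiffOn t ht).contDiffAt (isOpen_ball.mem_nhds hx)

theorem christoffelForm_eq_zero {x : EuclideanSpace ℝ (Fin n)}
    {A : Matrix (Fin n) (Fin n) ℝ} (h : ∀ᶠ z in nhds x, σ z = A) (V : EuclideanSpace ℝ (Fin n)) :
    christoffelForm σ x V V = 0 := by
  have hpd : ∀ k i j, pd k (fun z => σ z i j) x = 0 := fun k i j => by
    have : (fun z => σ z i j) =ᶠ[nhds x] fun _ => A i j := h.mono fun z hz => by simp [hz]
    simp [pd, this.fderiv_eq]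
  ext k
  rw [christoffelForm_apply]
  simp [christoffel, hpd]

theorem gradSq_eq_sum {x : EuclideanSpace ℝ (Fin n)} (h : σ x = 1)
    (f : EuclideanSpace ℝ (Fin n) → ℝ) :
    gradSq σ f x = ∑ i, pd i f x ^ 2 := by
  simp [gradSq, h, Matrix.one_apply, sq]

theorem mcfOp_nonpos {x : EuclideanSpace ℝ (Fin n)} {f : EuclideanSpace ℝ (Fin n) → ℝ}
    (hA : (σ x).PosDef) (hf : DifferentiableAt ℝ (fderiv ℝ f) x)
    (hH : ∀ V, hessForm σ f x V V ≤ 0) (hg : gradSq σ f x < 1) : mcfOp σ f x ≤ 0 := by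
  obtain ⟨b, hb⟩ := exists_isFrame hA
  rw [mcfOp_eq hA hb hf]
  have h1 := Finset.sum_nonpos fun k (_ : k ∈ Finset.univ) => hH (b k)
  have h2 := div_nonpos_of_nonpos_of_nonneg (hH (sharp (σ x) (fderiv ℝ f x))) (sub_nonneg.2 hg.le)
  linarith

theorem fderiv_of_isLocalMax_add_norm_sq {f : EuclideanSpace ℝ (Fin n) → ℝ}
    {x : EuclideanSpace ℝ (Fin n)} {k : ℝ} (hf : ContDiffAt ℝ 2 f x)
    (hm : IsLocalMax (fun z => f z + k * ‖z‖ ^ 2) x) (V : EuclideanSpace ℝ (Fin n)) :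
    fderiv ℝ f x V = -(2 * k * inner ℝ x V) ∧ fderiv ℝ (fderiv ℝ f) x V V ≤ -(2 * k * ‖V‖ ^ 2) := by
  have hline : ∀ s : ℝ, HasDerivAt (fun s : ℝ => x + s • V) V s := fun s => by
    simpa using ((hasDerivAt_id s).smul_const V).const_add x
  have h1 : ∀ᶠ s in nhds (0 : ℝ), HasDerivAt (fun s => f (x + s • V) + k * ‖x + s • V‖ ^ 2)
      (fderiv ℝ f (x + s • V) V + k * (2 * inner ℝ (x + s • V) V)) s := by
    filter_upwards [hf.eventually_hasDerivAt_line V] with s hs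
    exact hs.add ((hline s).norm_sq.const_mul k)
  have h2 : HasDerivAt (fun s : ℝ => fderiv ℝ f (x + s • V) V + k * (2 * inner ℝ (x + s • V) V))
      (fderiv ℝ (fderiv ℝ f) x V V + k * (2 * inner ℝ V V)) 0 := by
    refine (hf.hasDerivAt_fderiv_line V).add (((HasDerivAt.const_mul 2 ?_)).const_mul k)
    refine ((hline 0).inner ℝ (hasDerivAt_const (0:ℝ) V)).congr_deriv ?_
    simp
  have hmax : IsLocalMax (fun s : ℝ => f (x + s • V) + k * ‖x + s • V‖ ^ 2) 0 := by
    have hc : Tendsto (fun s : ℝ => x + s • V) (nhds 0) (nhds x) := by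
      have : Continuous fun s : ℝ => x + s • V := by fun_prop
      simpa using this.tendsto 0
    have := hc.eventually hm
    simpa [IsLocalMax, IsMaxFilter] using this
  obtain ⟨h3, h4⟩ := hmax.hasDerivAt_hasDerivAt_nonpos h1 h2
  simp only [zero_smul, add_zero] at h3
  rw [real_inner_self_eq_norm_sq] at h4
  constructor <;> linarith

theorem isLocalMax_of_forall_closedBall_le (ρ : ℝ) {f : EuclideanSpace ℝ (Fin n) → ℝ}
    {x : EuclideanSpace ℝ (Fin n)} (hx : ‖x‖ < ρ) (h : ∀ z ∈ closedBall 0 ρ, f z ≤ f x) :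
    IsLocalMax f x :=
  mem_of_superset (isOpen_ball.mem_nhds (show x ∈ ball 0 ρ by simpa using hx))
    fun z hz => h z (ball_subset_closedBall hz)

theorem IsGraphicalFlow.le_of_initial_le (hu : IsGraphicalFlow σ ρ t₁ u) (hpos : ∀ x, (σ x).PosDef)
    {h : ℝ} (hh : 0 ≤ h) (h0 : ∀ x, ‖x‖ ≤ ρ → u 0 x ≤ h) :
    ∀ t ∈ Icc 0 t₁, ∀ x, ‖x‖ ≤ ρ → u t x ≤ h := by
  have key := nonpos_of_forall_max_nonincreasing (isCompact_closedBall
      (0 : EuclideanSpace ℝ (Fin n)) ρ)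
    (N := fun t x => u t x - h) (t₁ := t₁) (κ := 1) one_pos (hu.continuousOn.sub continuousOn_const)
    (fun x hx => by have := h0 x (by simpa using hx); simpa using this) ?_
  · intro t ht x hx
    have := key t ht x (by simpa using hx)
    linarith
  · intro t ht x hx hmax hN _
    have hxρ : ‖x‖ < ρ := by
      refine lt_of_le_of_ne (by simpa using hx) fun hxe => ?_
      have := hu.boundary t (Ioc_subset_Icc_self ht) x hxe
      linarith
    have hxb : x ∈ ball (0 : EuclideanSpace ℝ (Fin n)) ρ := by simpa using hxρ
    refine ⟨mcfOp σ (u t) x, ?_, (hu.hasDerivAt t ht x hxb).sub_const h⟩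
    have hC := hu.contDiffAt ht hxb
    have hm : IsLocalMax (u t) x :=
      isLocalMax_of_forall_closedBall_le ρ hxρ fun z hz => by linarith [hmax z hz]
    have hd := hm.fderiv_eq_zero
    refine mcfOp_nonpos (hpos x) hC.differentiableAt_fderiv (fun V => ?_) ?_
    · rw [hessForm_apply, hd]
      simpa using hm.fderiv_fderiv_nonpos hC V
    · simp [gradSq_eq, hd]

theorem IsGraphicalFlow.le_barrier (hu : IsGraphicalFlow σ ρ t₁ u) (hpos : ∀ x, (σ x).PosDef)
    {h R k : ℝ} (hh : 0 ≤ h) (hflat : ∀ x, R ≤ ‖x‖ → σ x = 1) (h0 : ∀ x, ‖x‖ ≤ ρ → u 0 x ≤ h)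
    (h0' : ∀ x, R ≤ ‖x‖ → ‖x‖ ≤ ρ → u 0 x = 0) (hk : 0 ≤ k)
    (hk1 : h ≤ k * (ρ ^ 2 - R ^ 2)) (hk2 : 2 * k * ρ < 1) :
    ∀ t ∈ Icc 0 t₁, ∀ x, ‖x‖ ≤ ρ → u t x ≤ k * (ρ ^ 2 - ‖x‖ ^ 2) := by
  have hle := hu.le_of_initial_le hpos hh h0
  have hβ : ∀ x : EuclideanSpace ℝ (Fin n), ‖x‖ ≤ R → h ≤ k * (ρ ^ 2 - ‖x‖ ^ 2) := fun x hx =>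
    hk1.trans (by gcongr)
  have hβ0 : ∀ x : EuclideanSpace ℝ (Fin n), ‖x‖ ≤ ρ → 0 ≤ k * (ρ ^ 2 - ‖x‖ ^ 2) := fun x hx =>
    mul_nonneg hk (sub_nonneg.2 (by gcongr))
  have key := nonpos_of_forall_max_nonincreasing (isCompact_closedBall
      (0 : EuclideanSpace ℝ (Fin n)) ρ)
    (N := fun t x => u t x - k * (ρ ^ 2 - ‖x‖ ^ 2)) (t₁ := t₁) (κ := 1) one_pos
    (hu.continuousOn.sub (by fun_prop)) (fun x hx => ?_) ?_
  · intro t ht x hx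
    have := key t ht x (by simpa using hx)
    linarith
  · have hx' : ‖x‖ ≤ ρ := by simpa using hx
    rcases le_total R ‖x‖ with hxR | hxR
    · rw [h0' x hxR hx']; linarith [hβ0 x hx']
    · linarith [h0 x hx', hβ x hxR]
  · intro t ht x hx hmax hN _
    have hx' : ‖x‖ ≤ ρ := by simpa using hx
    have hxρ : ‖x‖ < ρ := by
      refine lt_of_le_of_ne hx' fun hxe => ?_
      have := hu.boundary t (Ioc_subset_Icc_self ht) x hxe
      linarith [hβ0 x hx']
    have hxR : R < ‖x‖ := by
      by_contra! hc
      linarith [hβ x hc, hle t (Ioc_subset_Icc_self ht) x hx']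
    have hxb : x ∈ ball (0 : EuclideanSpace ℝ (Fin n)) ρ := by simpa using hxρ
    refine ⟨mcfOp σ (u t) x, ?_, (hu.hasDerivAt t ht x hxb).sub_const _⟩
    have hC := hu.contDiffAt ht hxb
    have hm : IsLocalMax (fun z => u t z + k * ‖z‖ ^ 2) x :=
      isLocalMax_of_forall_closedBall_le ρ hxρ fun z hz => by linarith [hmax z hz]
    have hd := fderiv_of_isLocalMax_add_norm_sq hC hm
    refine mcfOp_nonpos (hpos x) hC.differentiableAt_fderiv (fun V => ?_) ?_
    · rw [hessForm_apply, christoffelForm_eq_zero (A := 1)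
        (mem_of_superset ((isOpen_lt continuous_const continuous_norm).mem_nhds hxR)
          fun z hz => hflat z (le_of_lt hz))]
      have h1 := (hd V).2
      have h2 : 0 ≤ 2 * k * ‖V‖ ^ 2 := by positivity
      simp only [map_zero, sub_zero]
      linarith
    · rw [gradSq_eq_sum (hflat x hxR.le)]
      have h1 : ∀ i, pd i (u t) x = -(2 * k * x i) := fun i => by
        rw [pd, (hd _).1, EuclideanSpace.inner_single_right]
        simp
      have h2 : ∑ i, pd i (u t) x ^ 2 = (2 * k * ‖x‖) ^ 2 := by
        rw [mul_pow, EuclideanSpace.real_norm_sq_eq, Finset.mul_sum]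
        exact Finset.sum_congr rfl fun i _ => by rw [h1]; ring
      rw [h2]
      have h3 : 2 * k * ‖x‖ < 1 := lt_of_le_of_lt (by gcongr) hk2
      have h4 : 0 ≤ 2 * k * ‖x‖ := by positivity
      nlinarith

end Barrier

section Modulus

/-- The comparison modulus as a function of the squared distance. -/
def modulus (ζ E : ℝ) : ℝ := √E * (1 + ζ * E)

/-- The first derivative of `modulus`. -/
def modulusDeriv (ζ E : ℝ) : ℝ := (1 + 3 * ζ * E) / (2 * √E)

/-- The second derivative of `modulus`. -/
def modulusDeriv₂ (ζ E : ℝ) : ℝ := (3 * ζ * E - 1) / (4 * (E * √E))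

theorem continuous_modulus (ζ : ℝ) : Continuous (modulus ζ) := by unfold modulus; fun_prop

theorem sqrt_le_modulus {ζ E : ℝ} (hζ : 0 ≤ ζ) (hE : 0 ≤ E) : √E ≤ modulus ζ E :=
  le_mul_of_one_le_right (sqrt_nonneg E) (by nlinarith [mul_nonneg hζ hE])

theorem hasDerivAt_modulus (ζ : ℝ) {E : ℝ} (hE : 0 < E) :
    HasDerivAt (modulus ζ) (modulusDeriv ζ E) E := by
  have he : 0 < √E := sqrt_pos.2 hE
  have h := (Real.hasDerivAt_sqrt hE.ne').mul (((hasDerivAt_id E).const_mul ζ).const_add 1)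
  refine h.congr_deriv ?_
  simp only [modulusDeriv, id]
  have h2 : √E * √E = E := mul_self_sqrt hE.le
  field_simp
  rw [sq, h2]
  ring

theorem hasDerivAt_modulusDeriv (ζ : ℝ) {E : ℝ} (hE : 0 < E) :
    HasDerivAt (modulusDeriv ζ) (modulusDeriv₂ ζ E) E := by
  have he : 0 < √E := sqrt_pos.2 hE
  have h := (((hasDerivAt_id E).const_mul (3 * ζ)).const_add 1).div
    ((Real.hasDerivAt_sqrt hE.ne').const_mul 2) (by positivity)
  refine h.congr_deriv ?_
  simp only [modulusDeriv₂, id]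
  have h2 : √E ^ 2 = E := sq_sqrt hE.le
  have h3 : E * √E = √E ^ 3 := by rw [pow_succ, h2]
  rw [h3]
  field_simp
  rw [h2]
  ring

theorem modulus_bounds {K ζ d E : ℝ} (hK : 0 < K) (hζ : 0 ≤ ζ) (hd : 0 < d) (hd1 : d ≤ 1)
    (h1 : d ^ 2 ≤ K * E) (h2 : E ≤ K * d ^ 2) (h3 : 3 * ζ * E ≤ 1) :
    0 < modulusDeriv ζ E ∧ modulusDeriv ζ E * d ≤ (9 * ζ + 1) * (K + 1) ^ 3 ∧
    2 * modulusDeriv ζ E * E ≤ √E + (9 * ζ + 1) * (K + 1) ^ 3 * d ^ 2 ∧ modulusDeriv₂ ζ E ≤ 0 ∧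
    -modulusDeriv₂ ζ E * d ^ 3 ≤ (9 * ζ + 1) * (K + 1) ^ 3 ∧
    2 * modulusDeriv ζ E * E + 4 * modulusDeriv₂ ζ E * E ^ 2 ≤ (9 * ζ + 1) * (K + 1) ^ 3 * d ^ 3 ∧
    |4 * modulusDeriv ζ E ^ 2 * E - 1| ≤ (9 * ζ + 1) * (K + 1) ^ 3 * d ^ 2 ∧ d ≤ (K + 1) * √E := by
  have hE : 0 < E := by
    have : 0 < K * E := lt_of_lt_of_le (by positivity) h1
    exact pos_of_mul_pos_right this hK.le
  obtain ⟨e, he, rfl⟩ : ∃ e, 0 < e ∧ E = e ^ 2 := ⟨√E, sqrt_pos.2 hE, (sq_sqrt hE.le).symm⟩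
  have hs : √(e ^ 2) = e := sqrt_sq he.le
  obtain ⟨B, hB⟩ : ∃ B, B = K + 1 := ⟨_, rfl⟩
  have hB1 : 1 < B := by linarith
  have hKB : K ≤ B ^ 2 := by nlinarith
  have hdB : d ≤ B * e := by
    refine le_of_sq_le_sq ?_ (by positivity)
    rw [mul_pow]
    exact h1.trans (by gcongr)
  have heB : e ≤ B * d := by
    refine le_of_sq_le_sq ?_ (by positivity)
    rw [mul_pow]
    exact h2.trans (by gcongr)
  rw [← hB]
  simp only [modulusDeriv, modulusDeriv₂, hs]
  have e3 : e ^ 3 ≤ B ^ 3 * d ^ 3 := by rw [← mul_pow]; gcongr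
  have d3 : d ^ 3 ≤ B ^ 3 * e ^ 3 := by rw [← mul_pow]; gcongr
  have hB3 : B ≤ B ^ 3 := le_self_pow₀ hB1.le (by norm_num)
  have hB23 : B ^ 2 ≤ B ^ 3 := pow_le_pow_right₀ hB1.le (by norm_num)
  have hζB : 0 ≤ ζ * B ^ 3 := by positivity
  have hd32 : d ^ 3 ≤ d ^ 2 := pow_le_pow_of_le_one hd.le hd1 (by norm_num)
  have hx : (1 + 3 * ζ * e ^ 2) / (2 * e) * d ≤ B := by
    rw [div_mul_eq_mul_div, div_le_iff₀ (by positivity)]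
    calc (1 + 3 * ζ * e ^ 2) * d ≤ 2 * d := by gcongr; linarith
      _ ≤ B * (2 * e) := by linarith
  have hE2 : e ^ 2 ≤ B ^ 3 * d ^ 2 := by
    calc e ^ 2 ≤ (B * d) ^ 2 := by gcongr
      _ = B ^ 2 * d ^ 2 := by ring
      _ ≤ _ := by gcongr
  refine ⟨by positivity, ?_, ?_, ?_, ?_, ?_, ?_, hdB⟩
  · nlinarith
  · have : 2 * ((1 + 3 * ζ * e ^ 2) / (2 * e)) * e ^ 2 = e + 3 * ζ * e ^ 3 := by field_simp
    rw [this]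
    have h5 : ζ * e ^ 3 ≤ ζ * (B ^ 3 * d ^ 2) := by
      gcongr; exact e3.trans (by gcongr)
    have h6 : 0 ≤ B ^ 3 * d ^ 2 := by positivity
    nlinarith [mul_nonneg hζ h6]
  · exact div_nonpos_of_nonpos_of_nonneg (by linarith) (by positivity)
  · have : -((3 * ζ * e ^ 2 - 1) / (4 * (e ^ 2 * e))) * d ^ 3 = (1 - 3 * ζ * e ^ 2) * d ^ 3 /
      (4 * e ^ 3) := by
      field_simp; ring
    rw [this, div_le_iff₀ (by positivity)]
    have h5 : 0 ≤ 3 * ζ * e ^ 2 * d ^ 3 := by positivity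
    have h6 : 0 ≤ ζ * B ^ 3 * e ^ 3 := by positivity
    have h7 : 0 ≤ B ^ 3 * e ^ 3 := by positivity
    nlinarith
  · have : 2 * ((1 + 3 * ζ * e ^ 2) / (2 * e)) * e ^ 2
        + 4 * ((3 * ζ * e ^ 2 - 1) / (4 * (e ^ 2 * e))) * (e ^ 2) ^ 2 = 6 * ζ * e ^ 3 := by
      field_simp; ring
    rw [this]
    have h5 : ζ * e ^ 3 ≤ ζ * (B ^ 3 * d ^ 3) := by gcongr
    have h6 : 0 ≤ B ^ 3 * d ^ 3 := by positivity
    nlinarith [mul_nonneg hζ h6]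
  · have : 4 * ((1 + 3 * ζ * e ^ 2) / (2 * e)) ^ 2 * e ^ 2 - 1
        = 3 * ζ * e ^ 2 * (2 + 3 * ζ * e ^ 2) := by
      field_simp; ring
    rw [this, abs_of_nonneg (by positivity)]
    have h5 : ζ * e ^ 2 ≤ ζ * (B ^ 3 * d ^ 2) := by gcongr
    have h6 : 0 ≤ B ^ 3 * d ^ 2 := by positivity
    calc 3 * ζ * e ^ 2 * (2 + 3 * ζ * e ^ 2) ≤ 3 * ζ * e ^ 2 * 3 := by gcongr; linarith
      _ ≤ _ := by nlinarith

/-- Passing to the midpoint gains a cubic term in the modulus. -/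
theorem modulus_midpoint {K d E E₁ E₂ : ℝ} (hK : 0 < K) (hd : 0 < d) (hE₁ : 0 ≤ E₁) (hE₂ : 0 ≤ E₂)
    (h1 : d ^ 2 ≤ K * E) (hd1 : 5 * K ^ 2 * d ≤ 1)
    (h2 : |4 * E₁ - E| ≤ K * d ^ 3) (h3 : |4 * E₂ - E| ≤ K * d ^ 3)
    (h4 : |4 * E₁ + 4 * E₂ - 2 * E| ≤ K * d ^ 4) :
    modulus (K ^ 3) E₁ + modulus (K ^ 3) E₂ + 10⁻¹ * K ^ 3 * √E ^ 3 ≤ modulus (K ^ 3) E := by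
  have hE : 0 < E := by
    have : 0 < K * E := lt_of_lt_of_le (by positivity) h1
    exact pos_of_mul_pos_right this hK.le
  obtain ⟨e, he, rfl⟩ : ∃ e, 0 < e ∧ E = e ^ 2 := ⟨√E, sqrt_pos.2 hE, (sq_sqrt hE.le).symm⟩
  obtain ⟨a, ha, rfl⟩ : ∃ a, 0 ≤ a ∧ E₁ = a ^ 2 := ⟨√E₁, sqrt_nonneg _, (sq_sqrt hE₁).symm⟩
  obtain ⟨b, hb, rfl⟩ : ∃ b, 0 ≤ b ∧ E₂ = b ^ 2 := ⟨√E₂, sqrt_nonneg _, (sq_sqrt hE₂).symm⟩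
  simp only [modulus, sqrt_sq he.le, sqrt_sq ha, sqrt_sq hb]
  have hd3 : K * d ^ 3 ≤ 5⁻¹ * e ^ 2 := by
    calc K * d ^ 3 = K * d * d ^ 2 := by ring
      _ ≤ K * d * (K * e ^ 2) := by gcongr
      _ = 5⁻¹ * (5 * K ^ 2 * d) * e ^ 2 := by ring
      _ ≤ 5⁻¹ * 1 * e ^ 2 := by gcongr
      _ = _ := by ring
  have hd4 : K * d ^ 4 ≤ K ^ 3 * e ^ 4 := by
    calc K * d ^ 4 = K * (d ^ 2) ^ 2 := by ring
      _ ≤ K * (K * e ^ 2) ^ 2 := by gcongr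
      _ = _ := by ring
  have ha2 : a ^ 2 ≤ 3 / 10 * e ^ 2 := by linarith [(abs_le.1 h2).2]
  have hb2 : b ^ 2 ≤ 3 / 10 * e ^ 2 := by linarith [(abs_le.1 h3).2]
  have hab1 : a + b ≤ e + K ^ 3 * e ^ 3 / 4 := by
    refine le_of_sq_le_sq ?_ (by positivity)
    have h5 : 0 ≤ (K ^ 3 * e ^ 3 / 4) ^ 2 := by positivity
    nlinarith [(abs_le.1 h4).2, sq_nonneg (a - b)]
  have hab2 : a + b ≤ 11 / 10 * e := by
    refine le_of_sq_le_sq ?_ (by positivity)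
    nlinarith [sq_nonneg (a - b)]
  have h6 : a * a ^ 2 + b * b ^ 2 ≤ 33 / 100 * e ^ 3 := by
    calc a * a ^ 2 + b * b ^ 2 ≤ a * (3 / 10 * e ^ 2) + b * (3 / 10 * e ^ 2) := by gcongr
      _ = (a + b) * (3 / 10 * e ^ 2) := by ring
      _ ≤ (11 / 10 * e) * (3 / 10 * e ^ 2) := by gcongr
      _ = _ := by ring
  have h7 : K ^ 3 * (a * a ^ 2 + b * b ^ 2) ≤ K ^ 3 * (33 / 100 * e ^ 3) := by gcongr
  have h8 : 0 ≤ K ^ 3 * e ^ 3 := by positivity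
  nlinarith

theorem exists_profile {h ε l : ℝ} (hε : 0 < ε) (hl : 0 ≤ l) :
    ∃ (H G : ℝ → ℝ) (G₀ : ℝ), 1 < G₀ ∧ (∀ r, HasDerivAt H (G r) r) ∧ (∀ r, G₀ ≤ G r) ∧
      (∀ r, G r ≤ 2) ∧ (∀ r, G r ≤ 1 + ε) ∧
      ∀ r, r ^ 2 < h → HasDerivAt G (l * r * (G r ^ 2 - 1)) r := by
  set δ := min ε 1 with hδ
  have hδ0 : 0 < δ := lt_min hε one_pos
  have hδ1 : δ ≤ 1 := min_le_right _ _
  have hδε : δ ≤ ε := min_le_left _ _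
  set q : ℝ → ℝ := fun r => δ / 3 * exp (l * (min (r ^ 2) h - h)) with hq
  set q₀ : ℝ := δ / 3 * exp (l * (min 0 h - h)) with hq₀
  have hq0 : ∀ r, q₀ ≤ q r := fun r => by
    simp only [hq, hq₀]; gcongr; positivity
  have hqm : ∀ r, q r ≤ δ / 3 := fun r => by
    refine mul_le_of_le_one_right (by positivity) (exp_le_one_iff.2 ?_)
    exact mul_nonpos_of_nonneg_of_nonpos hl (sub_nonpos.2 (min_le_right _ _))
  have hq₀0 : 0 < q₀ := by positivity
  have hq1 : ∀ r, 0 < 1 - q r := fun r => by linarith [hqm r]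
  have hq₀1 : 0 < 1 - q₀ := by linarith [hq0 0, hq1 0]
  set G : ℝ → ℝ := fun r => (1 + q r) / (1 - q r) with hG
  have hqc : Continuous q := by simp only [hq]; fun_prop
  have hGc : Continuous G := (continuous_const.add hqc).div (continuous_const.sub hqc) fun r =>
      (hq1 r).ne'
  have hGδ : ∀ r, G r ≤ 1 + δ := fun r => by
    rw [hG, div_le_iff₀ (hq1 r)]
    nlinarith [hqm r, hq0 r]
  refine ⟨fun r => ∫ s in (0:ℝ)..r, G s, G, (1 + q₀) / (1 - q₀), ?_, ?_, ?_, ?_, ?_, ?_⟩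
  · rw [lt_div_iff₀ hq₀1]; linarith
  · intro r
    exact intervalIntegral.integral_hasDerivAt_right (hGc.intervalIntegrable _ _)
      (hGc.stronglyMeasurableAtFilter _ _) hGc.continuousAt
  · intro r
    simp only [hG]
    have := hq0 r
    have := hq1 r
    gcongr
  · intro r; linarith [hGδ r]
  · intro r; linarith [hGδ r]
  · intro r hr
    have hq' : HasDerivAt q (q r * (l * (2 * r))) r := by
      have h1 : HasDerivAt (fun r => δ / 3 * exp (l * (r ^ 2 - h)))
          (δ / 3 * (exp (l * (r ^ 2 - h)) * (l * (2 * r)))) r := by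
        have := ((((hasDerivAt_pow 2 r).sub_const h).const_mul l).exp).const_mul (δ / 3)
        simpa using this
      have h2 : q =ᶠ[nhds r] fun r => δ / 3 * exp (l * (r ^ 2 - h)) := by
        have : ∀ᶠ s in nhds r, s ^ 2 < h :=
          (isOpen_lt (continuous_pow 2) continuous_const).mem_nhds hr
        filter_upwards [this] with s hs
        simp only [hq, min_eq_left hs.le]
      rw [h2.self_of_nhds, mul_assoc]
      exact h1.congr_of_eventuallyEq h2
    refine ((hq'.const_add 1).div (hq'.const_sub 1) (hq1 r).ne').congr_deriv ?_
    simp only [hG]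
    have := (hq1 r).ne'
    field_simp
    ring

end Modulus

namespace MetricPair

variable {X : Type*} [NormedAddCommGroup X] [NormedSpace ℝ X] (M : MetricPair X)

theorem hasDerivAt_energy (m ξ V W : X) (s : ℝ) :
    HasDerivAt (fun s : ℝ => M.S (m + s • ((2⁻¹ : ℝ) • (V + W))) (ξ + s • (V - W))
        (ξ + s • (V - W)))
      (M.E1 (m + s • ((2⁻¹ : ℝ) • (V + W))) (ξ + s • (V - W)) V W) s := by
  have hS := hasDerivAt_comp_line
    (M.contDiff_S.hasFDerivAt_smooth (m + s • ((2⁻¹ : ℝ) • (V + W))))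
  have hk : HasDerivAt (fun s : ℝ => ξ + s • (V - W)) (V - W) s := by
    simpa using ((hasDerivAt_id s).smul_const (V - W)).const_add ξ
  refine ((hS.clm_apply hk).clm_apply hk).congr_deriv ?_
  simp only [E1, add_apply]
  rw [M.S_symm _ (V - W) (ξ + s • (V - W))]
  ring

theorem hasDerivAt_E1 (m ξ V W : X) :
    HasDerivAt (fun s : ℝ => M.E1 (m + s • ((2⁻¹ : ℝ) • (V + W))) (ξ + s • (V - W)) V W)
      (fderiv ℝ (fderiv ℝ M.S) m ((2⁻¹ : ℝ) • (V + W)) ((2⁻¹ : ℝ) • (V + W)) ξ ξ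
        + 4 * fderiv ℝ M.S m ((2⁻¹ : ℝ) • (V + W)) ξ (V - W) + 2 * M.S m (V - W) (V - W)) 0 := by
  have hS : HasDerivAt (fun s : ℝ => M.S (m + s • ((2⁻¹ : ℝ) • (V + W))))
      (fderiv ℝ M.S m ((2⁻¹ : ℝ) • (V + W))) 0 :=
    hasDerivAt_comp_line (by simpa using M.contDiff_S.hasFDerivAt_smooth m)
  have hS' : HasDerivAt (fun s : ℝ => fderiv ℝ M.S (m + s • ((2⁻¹ : ℝ) • (V + W))))
      (fderiv ℝ (fderiv ℝ M.S) m ((2⁻¹ : ℝ) • (V + W))) 0 :=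
    hasDerivAt_comp_line (by simpa using M.contDiff_S.fderiv_smooth.hasFDerivAt_smooth m)
  have hk : HasDerivAt (fun s : ℝ => ξ + s • (V - W)) (V - W) 0 := by
    simpa using ((hasDerivAt_id (0:ℝ)).smul_const (V - W)).const_add ξ
  have h1 := ((hS'.clm_apply (hasDerivAt_const (0:ℝ) ((2⁻¹ : ℝ) • (V + W)))).clm_apply
      hk).clm_apply hk
  have h2 := ((hS.clm_apply hk).clm_apply (hasDerivAt_const (0:ℝ) (V - W))).const_mul 2
  refine (h1.add h2).congr_deriv ?_
  simp only [zero_smul, add_zero, map_zero, add_apply]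
  rw [M.fderiv_S_symm m _ (V - W) ξ]
  ring

theorem first_second_variation {f : X → ℝ} {H G ψ ψ' : ℝ → ℝ} {m ξ : X} {gy gx p₂ : ℝ}
    (hfy : ContDiffAt ℝ 2 f (m + (2⁻¹ : ℝ) • ξ)) (hfx : ContDiffAt ℝ 2 f (m + (-2⁻¹ : ℝ) • ξ))
    (hH : ∀ r, HasDerivAt H (G r) r) (hGy : HasDerivAt G gy (f (m + (2⁻¹ : ℝ) • ξ)))
    (hGx : HasDerivAt G gx (f (m + (-2⁻¹ : ℝ) • ξ)))
    (hψ : ∀ᶠ e in nhds (M.S m ξ ξ), HasDerivAt ψ (ψ' e) e) (hψ' : HasDerivAt ψ' p₂ (M.S m ξ ξ))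
    (hmax : ∀ V W, IsLocalMax (fun s : ℝ => H (f (m + (2⁻¹ : ℝ) • ξ + s • V))
      - H (f (m + (-2⁻¹ : ℝ) • ξ + s • W))
      - ψ (M.S (m + s • ((2⁻¹ : ℝ) • (V + W))) (ξ + s • (V - W)) (ξ + s • (V - W)))) 0) (V W : X) :
    G (f (m + (2⁻¹ : ℝ) • ξ)) * fderiv ℝ f (m + (2⁻¹ : ℝ) • ξ) V
        - G (f (m + (-2⁻¹ : ℝ) • ξ)) * fderiv ℝ f (m + (-2⁻¹ : ℝ) • ξ) W
        = ψ' (M.S m ξ ξ) * M.E1 m ξ V W ∧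
    (gy * fderiv ℝ f (m + (2⁻¹ : ℝ) • ξ) V ^ 2
        + G (f (m + (2⁻¹ : ℝ) • ξ)) * fderiv ℝ (fderiv ℝ f) (m + (2⁻¹ : ℝ) • ξ) V V)
      - (gx * fderiv ℝ f (m + (-2⁻¹ : ℝ) • ξ) W ^ 2
        + G (f (m + (-2⁻¹ : ℝ) • ξ)) * fderiv ℝ (fderiv ℝ f) (m + (-2⁻¹ : ℝ) • ξ) W W)
      ≤ p₂ * M.E1 m ξ V W ^ 2 + ψ' (M.S m ξ ξ) *
        (fderiv ℝ (fderiv ℝ M.S) m ((2⁻¹ : ℝ) • (V + W)) ((2⁻¹ : ℝ) • (V + W)) ξ ξ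
        + 4 * fderiv ℝ M.S m ((2⁻¹ : ℝ) • (V + W)) ξ (V - W) + 2 * M.S m (V - W) (V - W)) := by
  have hcomp : ∀ {z : X} (U : X) {g : ℝ}, ContDiffAt ℝ 2 f z → HasDerivAt G g (f z) →
      (∀ᶠ s in nhds (0:ℝ), HasDerivAt (fun s : ℝ => H (f (z + s • U)))
        (G (f (z + s • U)) * fderiv ℝ f (z + s • U) U) s) ∧
      HasDerivAt (fun s : ℝ => G (f (z + s • U)) * fderiv ℝ f (z + s • U) U)
        (g * fderiv ℝ f z U ^ 2 + G (f z) * fderiv ℝ (fderiv ℝ f) z U U) 0 := by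
    intro z U g hf hg
    have hl := hf.eventually_hasDerivAt_line U
    refine ⟨hl.mono fun s hs => (hH _).comp s hs, ?_⟩
    have h0 := hl.self_of_nhds
    have h1 : HasDerivAt (fun s : ℝ => G (f (z + s • U))) (g * fderiv ℝ f z U) 0 := by
      have hg' : HasDerivAt G g (f (z + (0:ℝ) • U)) := by simpa using hg
      exact (hg'.comp (0:ℝ) h0).congr_deriv (by simp)
    refine (h1.mul (hf.hasDerivAt_fderiv_line U)).congr_deriv ?_
    simp only [zero_smul, add_zero]
    ring
  obtain ⟨hy1, hy2⟩ := hcomp V hfy hGy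
  obtain ⟨hx1, hx2⟩ := hcomp W hfx hGx
  have hEc : Tendsto (fun s : ℝ => M.S (m + s • ((2⁻¹ : ℝ) • (V + W))) (ξ + s • (V - W))
      (ξ + s • (V - W))) (nhds 0) (nhds (M.S m ξ ξ)) := by
    simpa using (M.hasDerivAt_energy m ξ V W 0).continuousAt.tendsto
  have hψ1 : ∀ᶠ s in nhds (0:ℝ), HasDerivAt
      (fun s : ℝ => ψ (M.S (m + s • ((2⁻¹ : ℝ) • (V + W))) (ξ + s • (V - W)) (ξ + s • (V - W))))
      (ψ' (M.S (m + s • ((2⁻¹ : ℝ) • (V + W))) (ξ + s • (V - W)) (ξ + s • (V - W))) *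
        M.E1 (m + s • ((2⁻¹ : ℝ) • (V + W))) (ξ + s • (V - W)) V W) s := by
    filter_upwards [hEc.eventually hψ] with s hs
    exact hs.comp s (M.hasDerivAt_energy m ξ V W s)
  have hψ2 : HasDerivAt (fun s : ℝ =>
      ψ' (M.S (m + s • ((2⁻¹ : ℝ) • (V + W))) (ξ + s • (V - W)) (ξ + s • (V - W))) *
        M.E1 (m + s • ((2⁻¹ : ℝ) • (V + W))) (ξ + s • (V - W)) V W)
      (p₂ * M.E1 m ξ V W ^ 2 + ψ' (M.S m ξ ξ) *
        (fderiv ℝ (fderiv ℝ M.S) m ((2⁻¹ : ℝ) • (V + W)) ((2⁻¹ : ℝ) • (V + W)) ξ ξ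
        + 4 * fderiv ℝ M.S m ((2⁻¹ : ℝ) • (V + W)) ξ (V - W) + 2 * M.S m (V - W) (V - W))) 0 := by
    have h1 : HasDerivAt (fun s : ℝ =>
        ψ' (M.S (m + s • ((2⁻¹ : ℝ) • (V + W))) (ξ + s • (V - W)) (ξ + s • (V - W))))
        (p₂ * M.E1 m ξ V W) 0 := by
      have hg' : HasDerivAt ψ' p₂ (M.S (m + (0:ℝ) • ((2⁻¹ : ℝ) • (V + W))) (ξ + (0:ℝ) • (V - W))
        (ξ + (0:ℝ) • (V - W))) := by simpa using hψ'
      exact (hg'.comp (0:ℝ) (M.hasDerivAt_energy m ξ V W 0)).congr_deriv (by simp)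
    refine (h1.mul (M.hasDerivAt_E1 m ξ V W)).congr_deriv ?_
    simp only [zero_smul, add_zero]
    ring
  obtain ⟨r1, r2⟩ := (hmax V W).hasDerivAt_hasDerivAt_nonpos
    (φ' := fun s => G (f (m + (2⁻¹ : ℝ) • ξ + s • V)) * fderiv ℝ f (m + (2⁻¹ : ℝ) • ξ + s • V) V
      - G (f (m + (-2⁻¹ : ℝ) • ξ + s • W)) * fderiv ℝ f (m + (-2⁻¹ : ℝ) • ξ + s • W) W
      - ψ' (M.S (m + s • ((2⁻¹ : ℝ) • (V + W))) (ξ + s • (V - W)) (ξ + s • (V - W))) *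
        M.E1 (m + s • ((2⁻¹ : ℝ) • (V + W))) (ξ + s • (V - W)) V W)
    (by filter_upwards [hy1, hx1, hψ1] with s h1 h2 h3 using (h1.sub h2).sub h3)
    ((hy2.sub hx2).sub hψ2)
  simp only [zero_smul, add_zero] at r1
  constructor <;> linarith

end MetricPair

section Conclusion

variable {n : ℕ} {σ : EuclideanSpace ℝ (Fin n) → Matrix (Fin n) (Fin n) ℝ}

/-- The covariant Hessian of `H ∘ u`, where `H' = G` and `H'' = g` at the value of `u`. -/
def compHess (σ : EuclideanSpace ℝ (Fin n) → Matrix (Fin n) (Fin n) ℝ) (g G : ℝ)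
    (u : EuclideanSpace ℝ (Fin n) → ℝ) (x : EuclideanSpace ℝ (Fin n)) :
    EuclideanSpace ℝ (Fin n) →L[ℝ] EuclideanSpace ℝ (Fin n) →L[ℝ] ℝ :=
  g • (fderiv ℝ u x).smulRight (fderiv ℝ u x) + G • hessForm σ u x

theorem compHess_apply (g G : ℝ) (u : EuclideanSpace ℝ (Fin n) → ℝ)
    (x V : EuclideanSpace ℝ (Fin n)) :
    compHess σ g G u x V V = g * fderiv ℝ u x V ^ 2 + G * (fderiv ℝ (fderiv ℝ u) x V V -
      fderiv ℝ u x (christoffelForm σ x V V)) := by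
  simp [compHess, hessForm_apply, sq]

theorem mul_mcfOp_eq {u : EuclideanSpace ℝ (Fin n) → ℝ} {x ν : EuclideanSpace ℝ (Fin n)}
    {f : Fin n → EuclideanSpace ℝ (Fin n)} {g G p P : ℝ}
    (hA : (σ x).PosDef) (hf : IsFrame (matrixForm (σ x)) f)
    (hu : DifferentiableAt ℝ (fderiv ℝ u) x) (hG : 0 < G)
    (hν : ∀ a, G * fderiv ℝ u x a = 2 * p * matrixForm (σ x) ν a)
    (hP : P = 4 * p ^ 2 * matrixForm (σ x) ν ν) (hlt : P < G ^ 2) :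
    G * mcfOp σ u x = (∑ k, compHess σ g G u x (f k) (f k)
      + 4 * p ^ 2 / (G ^ 2 - P) * compHess σ g G u x ν ν) - g * P / (G ^ 2 - P) := by
  have hs : sharp (σ x) (fderiv ℝ u x) = (2 * p / G) • ν := by
    refine eq_of_matrixForm_eq hA fun a => ?_
    rw [matrixForm_sharp hA, map_smul, smul_apply, smul_eq_mul]
    field_simp
    linarith [hν a]
  have hDν : fderiv ℝ u x ν = 2 * p * matrixForm (σ x) ν ν / G := by
    field_simp
    linarith [hν ν]
  have hgr : gradSq σ u x = P / G ^ 2 := by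
    rw [gradSq_eq, hs, map_smul, smul_eq_mul, hDν, hP]
    field_simp
    ring
  have hsum : ∑ k, fderiv ℝ u x (f k) ^ 2 = P / G ^ 2 := by
    rw [← hgr, gradSq_eq, ← matrixForm_sharp hA (fderiv ℝ u x) (sharp _ _), hf.apply_eq_sum]
    refine Finset.sum_congr rfl fun k _ => ?_
    rw [matrixForm_symm hA, matrixForm_sharp hA, sq]
  have hQ : 0 < G ^ 2 - P := by linarith
  rw [mcfOp_eq hA hf hu, hs, hgr]
  have hc : ∀ V, compHess σ g G u x V V = g * fderiv ℝ u x V ^ 2 + G * hessForm σ u x V V :=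
    fun V => by rw [compHess_apply, hessForm_apply]
  simp only [hc, Finset.sum_add_distrib, ← Finset.mul_sum, hsum, hDν, map_smul, smul_apply,
      smul_eq_mul]
  have h2 : (2 * p * matrixForm (σ x) ν ν / G) ^ 2 * (4 * p ^ 2) = P ^ 2 / G ^ 2 := by
    rw [hP]; field_simp; ring
  have h3 : 1 - P / G ^ 2 = (G ^ 2 - P) / G ^ 2 := by field_simp
  have h4 : 4 * p ^ 2 / (G ^ 2 - P) * (g * (2 * p * matrixForm (σ x) ν ν / G) ^ 2)
      = g / (G ^ 2 - P) * (P ^ 2 / G ^ 2) := by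
    rw [← h2]; ring
  rw [h3, mul_add (4 * p ^ 2 / (G ^ 2 - P)), h4]
  field_simp
  ring

theorem exists_final_bound {C₀ G₀ h κ B c₁ c₂ c₃ L : ℝ} (hC₀ : 0 < C₀) (hG₀ : 1 < G₀) (hh : 0 ≤ h)
    (hκ : 0 ≤ κ) (hB : 0 ≤ B) (hc₁ : 0 ≤ c₁) (hc₂ : 0 ≤ c₂) (hc₃ : 0 ≤ c₃) (hL : 0 ≤ L) :
    ∃ d₀ > 0, ∀ {d e a b Gy Gx Py Px p : ℝ}, 0 < d → d ≤ d₀ → d ≤ B * e → e ≤ 2 * (a - b) →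
      |a| ≤ h → |b| ≤ h → G₀ ≤ Gy → Gy ≤ 2 → G₀ ≤ Gx → Gx ≤ 2 → |Gy - Gx| ≤ L * |a - b| →
      |Py - 1| ≤ κ * d ^ 2 → |Px - 1| ≤ κ * d ^ 2 → 0 ≤ p → p * d ≤ κ →
      Py < Gy ^ 2 ∧ Px < Gx ^ 2 ∧
      C₀ * e + c₁ * d ^ 2
        + c₂ * (|4 * p ^ 2 / (Gy ^ 2 - Py) - 4 * p ^ 2 / (Gx ^ 2 - Px)| * d ^ 3)
        + c₃ * (4 * p ^ 2 / (Gy ^ 2 - Py) * d ^ 4)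
        - (4 * C₀ * a * (Gy ^ 2 - 1) * Py / (Gy ^ 2 - Py)
          - 4 * C₀ * b * (Gx ^ 2 - 1) * Px / (Gx ^ 2 - Px)) ≤ 0 := by
  obtain ⟨g, hg⟩ : ∃ g, g = (G₀ ^ 2 - 1) / 2 := ⟨_, rfl⟩
  have hg0 : 0 < g := by rw [hg]; nlinarith
  obtain ⟨A₁, hA₁⟩ : ∃ A₁, A₁ = c₁ + c₂ * (4 * κ ^ 2 * (2 * κ) / g ^ 2) + c₃ * (4 * κ ^ 2 / g)
    + 2 * (4 * C₀ * h * 4 * κ / g) := ⟨_, rfl⟩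
  obtain ⟨A₂, hA₂⟩ : ∃ A₂, A₂ = c₂ * (4 * κ ^ 2 * (4 * L) / g ^ 2) := ⟨_, rfl⟩
  have hA₁0 : 0 ≤ A₁ := by rw [hA₁]; positivity
  have hA₂0 : 0 ≤ A₂ := by rw [hA₂]; positivity
  refine ⟨min 1 (min (g / (κ + 1)) (min (C₀ / (A₂ + 1)) (C₀ / 2 / (A₁ * B + 1)))), by positivity,
      ?_⟩
  intro d e a b Gy Gx Py Px p hd hd₀ hdB hab ha hb hGy hGy2 hGx hGx2 hGL hPy hPx hp hpd
  simp only [le_min_iff] at hd₀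
  obtain ⟨hd1, hdg, hdA₂, hdA₁⟩ := hd₀
  rw [le_div_iff₀ (by positivity)] at hdg hdA₂ hdA₁
  have he : 0 ≤ e := by
    by_contra! hc
    nlinarith
  have hab0 : 0 ≤ a - b := by linarith
  have hκg : κ * d ^ 2 ≤ g := by
    calc κ * d ^ 2 = κ * d * d := by ring
      _ ≤ κ * d * 1 := by gcongr
      _ ≤ g := by linarith
  have hden : ∀ {G P : ℝ}, G₀ ≤ G → |P - 1| ≤ κ * d ^ 2 → g ≤ G ^ 2 - P := by
    intro G P hG hP
    have h1 : G₀ ^ 2 ≤ G ^ 2 := by gcongr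
    have h2 := (abs_le.1 hP).2
    linarith
  have hy := hden hGy hPy
  have hx := hden hGx hPx
  have hy0 : 0 < Gy ^ 2 - Py := by linarith
  have hx0 : 0 < Gx ^ 2 - Px := by linarith
  have hQ : ∀ {r G P : ℝ}, |r| ≤ h → G₀ ≤ G → G ≤ 2 → |P - 1| ≤ κ * d ^ 2 →
      |4 * C₀ * r * (G ^ 2 - 1) * P / (G ^ 2 - P) - 4 * C₀ * r| ≤ 4 * C₀ * h * 4 * κ / g * d ^ 2 :=
          by
    intro r G P hr hG hG2 hP
    have hD := hden hG hP
    have hD0 : 0 < G ^ 2 - P := by linarith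
    have e1 : 4 * C₀ * r * (G ^ 2 - 1) * P / (G ^ 2 - P) - 4 * C₀ * r
        = 4 * C₀ * r * G ^ 2 * (P - 1) / (G ^ 2 - P) := by
      field_simp; ring
    rw [e1, abs_div, abs_mul, abs_mul, abs_mul, abs_of_pos hD0, abs_of_pos
        (by positivity : 0 < 4 * C₀),
      abs_of_nonneg (sq_nonneg G)]
    have hG0 : 0 ≤ G := by linarith
    have hG4 : G ^ 2 ≤ 4 := by
      calc G ^ 2 ≤ 2 ^ 2 := by gcongr
        _ = 4 := by norm_num
    calc 4 * C₀ * |r| * G ^ 2 * |P - 1| / (G ^ 2 - P)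
        ≤ 4 * C₀ * h * 4 * (κ * d ^ 2) / g := by gcongr
      _ = _ := by ring
  have hp2 : p ^ 2 * d ^ 2 ≤ κ ^ 2 := by
    rw [← mul_pow]; gcongr
  have hω : 4 * p ^ 2 / (Gy ^ 2 - Py) * d ^ 4 ≤ 4 * κ ^ 2 / g * d ^ 2 := by
    calc 4 * p ^ 2 / (Gy ^ 2 - Py) * d ^ 4 ≤ 4 * p ^ 2 / g * d ^ 4 := by gcongr
      _ = 4 * (p ^ 2 * d ^ 2) / g * d ^ 2 := by ring
      _ ≤ _ := by gcongr
  have hGG : |Gy ^ 2 - Gx ^ 2| ≤ 4 * L * (a - b) := by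
    have e1 : Gy ^ 2 - Gx ^ 2 = (Gy + Gx) * (Gy - Gx) := by ring
    rw [abs_of_nonneg hab0] at hGL
    rw [e1, abs_mul, abs_of_nonneg (by linarith : 0 ≤ Gy + Gx)]
    calc (Gy + Gx) * |Gy - Gx| ≤ 4 * (L * (a - b)) := by
          gcongr; linarith
      _ = _ := by ring
  have hωd : |4 * p ^ 2 / (Gy ^ 2 - Py) - 4 * p ^ 2 / (Gx ^ 2 - Px)| * d ^ 3
      ≤ 4 * κ ^ 2 * (4 * L) / g ^ 2 * (d * (a - b)) + 4 * κ ^ 2 * (2 * κ) / g ^ 2 * d ^ 2 := by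
    have e1 : 4 * p ^ 2 / (Gy ^ 2 - Py) - 4 * p ^ 2 / (Gx ^ 2 - Px)
        = 4 * p ^ 2 * ((Py - 1) - (Px - 1) - (Gy ^ 2 - Gx ^ 2)) /
            ((Gy ^ 2 - Py) * (Gx ^ 2 - Px)) := by
      field_simp; ring
    have h1 : |(Py - 1) - (Px - 1) - (Gy ^ 2 - Gx ^ 2)| ≤ 4 * L * (a - b) + 2 * κ * d ^ 2 := by
      have := abs_sub ((Py - 1) - (Px - 1)) (Gy ^ 2 - Gx ^ 2)
      have := abs_sub (Py - 1) (Px - 1)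
      linarith
    have h3 : 0 ≤ 4 * L * (a - b) + 2 * κ * d ^ 2 := by positivity
    rw [e1, abs_div, abs_mul, abs_of_nonneg (by positivity : 0 ≤ 4 * p ^ 2), abs_of_pos
        (mul_pos hy0 hx0)]
    have hd32 : d * d ^ 2 ≤ d ^ 2 := mul_le_of_le_one_left (sq_nonneg d) hd1
    calc 4 * p ^ 2 * |(Py - 1) - (Px - 1) - (Gy ^ 2 - Gx ^ 2)| / ((Gy ^ 2 - Py) * (Gx ^ 2 - Px)) *
        d ^ 3
        ≤ 4 * p ^ 2 * (4 * L * (a - b) + 2 * κ * d ^ 2) / (g * g) * d ^ 3 := by gcongr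
      _ = 4 * (p ^ 2 * d ^ 2) / g ^ 2 * (4 * L * (d * (a - b)) + 2 * κ * (d * d ^ 2)) := by ring
      _ ≤ 4 * κ ^ 2 / g ^ 2 * (4 * L * (d * (a - b)) + 2 * κ * d ^ 2) := by gcongr
      _ = _ := by ring
  refine ⟨by linarith, by linarith, ?_⟩
  have q1 := (abs_le.1 (hQ ha hGy hGy2 hPy)).1
  have q2 := (abs_le.1 (hQ hb hGx hGx2 hPx)).2
  have q3 := mul_le_mul_of_nonneg_left hωd hc₂
  have q4 := mul_le_mul_of_nonneg_left hω hc₃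
  have tot : C₀ * e + A₁ * d ^ 2 + A₂ * d * (a - b) - 4 * C₀ * (a - b) ≤ 0 := by
    have t1 : A₂ * d * (a - b) ≤ C₀ * (a - b) := by gcongr; linarith
    have t2 : A₁ * d ^ 2 ≤ C₀ / 2 * e := by
      calc A₁ * d ^ 2 = A₁ * d * d := by ring
        _ ≤ A₁ * d * (B * e) := by gcongr
        _ = (A₁ * B * d) * e := by ring
        _ ≤ C₀ / 2 * e := by gcongr; linarith
    have t3 : C₀ * e ≤ C₀ * (2 * (a - b)) := by gcongr
    linarith
  rw [hA₁, hA₂] at tot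
  linarith

end Conclusion

/-- A height profile `H` with slope `G > 1` that absorbs the Ricci curvature term of size `C₀`
on heights at most `h`. -/
structure IsProfile (H G : ℝ → ℝ) (C₀ h G₀ : ℝ) : Prop where
  one_lt : 1 < G₀
  hasDerivAt : ∀ r, HasDerivAt H (G r) r
  le : ∀ r, G₀ ≤ G r
  le_two : ∀ r, G r ≤ 2
  hasDerivAt_slope : ∀ r, r ^ 2 < (h + 1) ^ 2 → HasDerivAt G (4 * C₀ * r * (G r ^ 2 - 1)) r

namespace IsProfile

variable {H G : ℝ → ℝ} {C₀ h G₀ : ℝ}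

theorem pos (hP : IsProfile H G C₀ h G₀) (r : ℝ) : 0 < G r := by
  linarith [hP.one_lt, hP.le r]

theorem strictMono (hP : IsProfile H G C₀ h G₀) : StrictMono H :=
  strictMono_of_deriv_pos fun r => by rw [(hP.hasDerivAt r).deriv]; exact hP.pos r

theorem abs_sub_le (hP : IsProfile H G C₀ h G₀) (a b : ℝ) : |H a - H b| ≤ 2 * |a - b| := by
  have := convex_univ.norm_image_sub_le_of_norm_hasDerivWithin_le (f := H) (f' := G) (C := 2)
    (x := b) (y := a) (fun r _ => (hP.hasDerivAt r).hasDerivWithinAt)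
    (fun r _ => by rw [Real.norm_eq_abs, abs_of_pos (hP.pos r)]; exact hP.le_two r)
    (mem_univ _) (mem_univ _)
  simpa [Real.norm_eq_abs] using this

theorem sub_le (hP : IsProfile H G C₀ h G₀) {a b : ℝ} (hab : H b < H a) :
    H a - H b ≤ 2 * (a - b) := by
  have h1 := hP.abs_sub_le a b
  have h2 : b < a := hP.strictMono.lt_iff_lt.1 hab
  rw [abs_of_pos (by linarith), abs_of_pos (by linarith)] at h1
  exact h1

theorem abs_slope_sub_le (hP : IsProfile H G C₀ h G₀) (hh : 0 ≤ h) (hC₀ : 0 ≤ C₀) {a b : ℝ}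
    (ha : |a| ≤ h) (hb : |b| ≤ h) : |G a - G b| ≤ 12 * C₀ * h * |a - b| := by
  have := (convex_Icc (-h) h).norm_image_sub_le_of_norm_hasDerivWithin_le (f := G)
    (f' := fun r => 4 * C₀ * r * (G r ^ 2 - 1)) (C := 12 * C₀ * h) (x := b) (y := a)
    (fun r hr => (hP.hasDerivAt_slope r (by
      have := abs_le.2 hr
      rw [← sq_abs r]; gcongr; linarith)).hasDerivWithinAt)
    (fun r hr => by
      have h1 : |G r ^ 2 - 1| ≤ 3 := by
        have h1 := hP.le_two r
        have h2 := hP.le r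
        have h3 := hP.one_lt
        rw [abs_le]; constructor <;> nlinarith
      rw [Real.norm_eq_abs, abs_mul, abs_mul, abs_of_nonneg (by positivity : 0 ≤ 4 * C₀)]
      calc 4 * C₀ * |r| * |G r ^ 2 - 1| ≤ 4 * C₀ * h * 3 := by gcongr; exact abs_le.2 hr
        _ = _ := by ring)
    (abs_le.1 hb) (abs_le.1 ha)
  simpa [Real.norm_eq_abs] using this

end IsProfile

section Interior

variable {n : ℕ} {σ : EuclideanSpace ℝ (Fin n) → Matrix (Fin n) (Fin n) ℝ}

theorem abs_normal_sq_sub_one_le {p E s d κ K : ℝ} (hd0 : 0 ≤ d) (hp : 0 ≤ p)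
    (hK : 0 ≤ K)
    (hpd : p * d ≤ κ) (h1 : |4 * p ^ 2 * E - 1| ≤ κ * d ^ 2) (h2 : |s - E| ≤ K * d ^ 4) :
    |4 * p ^ 2 * s - 1| ≤ (κ + 4 * κ ^ 2 * K) * d ^ 2 := by
  have e : 4 * p ^ 2 * s - 1 = (4 * p ^ 2 * E - 1) + 4 * p ^ 2 * (s - E) := by ring
  have h3 : |4 * p ^ 2 * (s - E)| ≤ 4 * κ ^ 2 * K * d ^ 2 := by
    rw [abs_mul, abs_of_nonneg (by positivity)]
    calc 4 * p ^ 2 * |s - E| ≤ 4 * p ^ 2 * (K * d ^ 4) := by gcongr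
      _ = 4 * (p * d) ^ 2 * K * d ^ 2 := by ring
      _ ≤ 4 * κ ^ 2 * K * d ^ 2 := by gcongr
  rw [e]
  refine (abs_add_le _ _).trans ?_
  linarith

set_option maxHeartbeats 1000000 in
/-- At an interior maximum of the two-point function, the mean curvature operators at the two points
compare in the direction that decreases the maximum. -/
theorem exists_interior_bound (hσ : ∀ i j, ContDiff ℝ (⊤ : ℕ∞) fun x => σ x i j)
    (hpos : ∀ x, (σ x).PosDef) {ρ K δ C₀ h G₀ : ℝ} {H G : ℝ → ℝ}
    (hU : (metricPair σ hσ hpos).IsUniform ρ K δ) (hP : IsProfile H G C₀ h G₀) (hC₀ : 0 < C₀)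
    (hh : 0 ≤ h)
    (hRic : ∀ (x : EuclideanSpace ℝ (Fin n)) (w : Fin n → ℝ),
      |∑ j, ∑ l, ricci σ j l x * w j * w l| ≤ C₀ * ∑ j, ∑ l, σ x j l * w j * w l) :
    ∃ d₀ > 0, ∀ (f : EuclideanSpace ℝ (Fin n) → ℝ) (m ξ : EuclideanSpace ℝ (Fin n)),
      ‖m‖ ≤ ρ → 0 < ‖ξ‖ → ‖ξ‖ ≤ d₀ →
      ContDiffAt ℝ 2 f (m + (2⁻¹ : ℝ) • ξ) → ContDiffAt ℝ 2 f (m + (-2⁻¹ : ℝ) • ξ) →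
      |f (m + (2⁻¹ : ℝ) • ξ)| ≤ h → |f (m + (-2⁻¹ : ℝ) • ξ)| ≤ h →
      modulus (K ^ 3) (matrixForm (σ m) ξ ξ) <
        H (f (m + (2⁻¹ : ℝ) • ξ)) - H (f (m + (-2⁻¹ : ℝ) • ξ)) →
      (∀ V W, IsLocalMax (fun s : ℝ => H (f (m + (2⁻¹ : ℝ) • ξ + s • V))
        - H (f (m + (-2⁻¹ : ℝ) • ξ + s • W))
        - modulus (K ^ 3) (matrixForm (σ (m + s • ((2⁻¹ : ℝ) • (V + W)))) (ξ + s • (V - W))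
          (ξ + s • (V - W)))) 0) →
      G (f (m + (2⁻¹ : ℝ) • ξ)) * mcfOp σ f (m + (2⁻¹ : ℝ) • ξ)
        - G (f (m + (-2⁻¹ : ℝ) • ξ)) * mcfOp σ f (m + (-2⁻¹ : ℝ) • ξ) ≤ 0 := by
  have hK := hU.K_pos
  obtain ⟨κ, hκdef⟩ : ∃ κ, κ = (9 * K ^ 3 + 1) * (K + 1) ^ 3 := ⟨_, rfl⟩
  have hκ : 0 ≤ κ := by rw [hκdef]; positivity
  obtain ⟨d₁, hd₁, hfin⟩ := exists_final_bound (C₀ := C₀) (G₀ := G₀) (h := h)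
    (κ := κ + 4 * κ ^ 2 * K) (B := K + 1)
    (c₁ := C₀ * κ + (2 * C₀ * K + Fintype.card (Fin n) * K + 3 * Fintype.card (Fin n) * K ^ 2) * κ)
    (c₂ := κ + K * κ + 8 * K ^ 2 * κ) (c₃ := K * κ) (L := 12 * C₀ * h) hC₀ hP.one_lt hh
    (by positivity) (by positivity) (by positivity) (by positivity) (by positivity) (by positivity)
  refine ⟨min (min d₁ δ) (min 1 (min (1 / K) (1 / (3 * K ^ 4)))), by
    have := hU.δ_pos
    positivity, fun f m ξ hm hξ0 hξ hfy hfx hay hax hgt hmax => ?_⟩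
  obtain ⟨⟨hξd₁, hξδ⟩, hξ1, hξK, hξK4⟩ : (‖ξ‖ ≤ d₁ ∧ ‖ξ‖ ≤ δ) ∧ ‖ξ‖ ≤ 1 ∧ ‖ξ‖ ≤ 1 / K ∧
      ‖ξ‖ ≤ 1 / (3 * K ^ 4) := by simpa [le_min_iff] using hξ
  rw [le_div_iff₀ (by positivity)] at hξK hξK4
  obtain ⟨M, hM⟩ : ∃ M, M = metricPair σ hσ hpos := ⟨_, rfl⟩
  have hMS : ∀ z, M.S z = matrixForm (σ z) := fun z => by rw [hM]; rfl
  have hMΓ : ∀ z, M.Γ z = christoffelForm σ z := fun z => by rw [hM]; rfl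
  rw [← hM] at hU
  have hd1 := hU.sq_le m ξ hm
  have hd2 := hU.le_sq m ξ hm
  have hdd : ‖ξ‖ ^ 2 ≤ ‖ξ‖ := by nlinarith
  have hd3 : ‖ξ‖ ^ 3 ≤ ‖ξ‖ := by nlinarith
  have hE : 0 < M.S m ξ ξ := M.pos m ξ (norm_pos_iff.1 hξ0)
  obtain ⟨b1, b2, b3, b4, b5, b6, b7, b8⟩ := modulus_bounds (K := K) (ζ := K ^ 3) hK (by positivity)
    hξ0 hξ1 hd1 hd2 (by
      calc 3 * K ^ 3 * M.S m ξ ξ ≤ 3 * K ^ 3 * (K * ‖ξ‖) := by gcongr; exact hd2.trans (by gcongr)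
        _ = ‖ξ‖ * (3 * K ^ 4) := by ring
        _ ≤ 1 := hξK4)
  rw [← hκdef] at b2 b3 b5 b6 b7
  obtain ⟨a, hadef⟩ : ∃ a, a = f (m + (2⁻¹ : ℝ) • ξ) := ⟨_, rfl⟩
  obtain ⟨b, hbdef⟩ : ∃ b, b = f (m + (-2⁻¹ : ℝ) • ξ) := ⟨_, rfl⟩
  obtain ⟨p, hp⟩ : ∃ p, p = modulusDeriv (K ^ 3) (M.S m ξ ξ) := ⟨_, rfl⟩
  have hvar := M.first_second_variation (f := f) (H := H) (G := G) (ψ := modulus (K ^ 3))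
    (ψ' := modulusDeriv (K ^ 3)) (m := m) (ξ := ξ)
    (gy := 4 * C₀ * a * (G a ^ 2 - 1)) (gx := 4 * C₀ * b * (G b ^ 2 - 1))
    (p₂ := modulusDeriv₂ (K ^ 3) (M.S m ξ ξ)) hfy hfx hP.hasDerivAt
    (by rw [← hadef]; exact hP.hasDerivAt_slope a (by rw [hadef, ← sq_abs]; gcongr; linarith))
    (by rw [← hbdef]; exact hP.hasDerivAt_slope b (by rw [hbdef, ← sq_abs]; gcongr; linarith))
    ((lt_mem_nhds hE).mono fun e he => hasDerivAt_modulus _ he)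
    (hasDerivAt_modulusDeriv _ hE) (by simpa only [hMS] using hmax)
  rw [← hadef, ← hbdef, ← hp] at hvar
  rw [← hp] at b1 b2 b3 b6 b7
  rw [← hadef, ← hbdef, ← hMS] at hgt
  rw [← hadef] at hay
  rw [← hbdef] at hax
  have hGa := hP.pos a
  have hGb := hP.pos b
  have dy : ∀ V, G a * fderiv ℝ f (m + (2⁻¹ : ℝ) • ξ) V = p * M.dE m ξ V := fun V => by
    have := (hvar V 0).1
    rwa [map_zero, mul_zero, sub_zero, M.E1_zero] at this
  have dx : ∀ W, -(G b * fderiv ℝ f (m + (-2⁻¹ : ℝ) • ξ) W) = p * M.dE m (-ξ) W := fun W => by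
    have := (hvar 0 W).1
    rwa [map_zero, mul_zero, zero_sub, ← M.E1_swap, M.E1_zero] at this
  obtain ⟨ν, hνdef⟩ : ∃ ν, ν = (G a / (2 * p)) • sharp (σ (m + (2⁻¹ : ℝ) • ξ))
    (fderiv ℝ f (m + (2⁻¹ : ℝ) • ξ)) := ⟨_, rfl⟩
  obtain ⟨w, hwdef⟩ : ∃ w, w = (G b / (2 * p)) • sharp (σ (m + (-2⁻¹ : ℝ) • ξ))
    (fderiv ℝ f (m + (-2⁻¹ : ℝ) • ξ)) := ⟨_, rfl⟩
  have hνD : ∀ V, G a * fderiv ℝ f (m + (2⁻¹ : ℝ) • ξ) V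
      = 2 * p * matrixForm (σ (m + (2⁻¹ : ℝ) • ξ)) ν V := fun V => by
    rw [hνdef, map_smul, smul_apply, matrixForm_sharp (hpos _), smul_eq_mul]
    field_simp
  have hwD : ∀ V, G b * fderiv ℝ f (m + (-2⁻¹ : ℝ) • ξ) V
      = 2 * p * matrixForm (σ (m + (-2⁻¹ : ℝ) • ξ)) w V := fun V => by
    rw [hwdef, map_smul, smul_apply, matrixForm_sharp (hpos _), smul_eq_mul]
    field_simp
  have hν : M.IsNu m ξ ν := fun V => by
    have h1 := dy V
    rw [hνD, mul_comm 2 p, mul_assoc] at h1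
    rw [hMS]
    linarith [mul_left_cancel₀ b1.ne' h1]
  have hw : M.IsNu m (-ξ) (-w) := fun V => by
    have h1 := dx V
    rw [hwD, mul_comm 2 p, mul_assoc, ← mul_neg] at h1
    rw [hMS, MetricPair.neg_shift, map_neg, neg_apply]
    linarith [mul_left_cancel₀ b1.ne' h1]
  obtain ⟨Py, hPy⟩ : ∃ P, P = 4 * p ^ 2 * matrixForm (σ (m + (2⁻¹ : ℝ) • ξ)) ν ν := ⟨_, rfl⟩
  obtain ⟨Px, hPx⟩ : ∃ P, P = 4 * p ^ 2 * matrixForm (σ (m + (-2⁻¹ : ℝ) • ξ)) w w := ⟨_, rfl⟩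
  have hPy1 : |Py - 1| ≤ (κ + 4 * κ ^ 2 * K) * ‖ξ‖ ^ 2 := by
    rw [hPy, ← hMS]
    exact abs_normal_sq_sub_one_le hξ0.le b1.le hK.le b2 b7 (hU.nu_norm m ξ ν hm hξδ hν)
  have hPx1 : |Px - 1| ≤ (κ + 4 * κ ^ 2 * K) * ‖ξ‖ ^ 2 := by
    have h1 := hU.nu_norm m (-ξ) (-w) hm (by rwa [norm_neg]) hw
    simp only [MetricPair.neg_shift, map_neg, neg_apply, neg_neg, norm_neg] at h1
    rw [hPx, ← hMS]
    exact abs_normal_sq_sub_one_le hξ0.le b1.le hK.le b2 b7 h1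
  have he : √(M.S m ξ ξ) < H a - H b :=
    (sqrt_le_modulus (by positivity) hE.le).trans_lt hgt
  have hab : H b < H a := by linarith [Real.sqrt_nonneg (M.S m ξ ξ)]
  obtain ⟨q1, q2, q3⟩ := hfin (d := ‖ξ‖) (e := √(M.S m ξ ξ)) (a := a) (b := b) (Gy := G a)
    (Gx := G b) (Py := Py) (Px := Px) (p := p) hξ0 hξd₁ b8 (he.le.trans (hP.sub_le hab)) hay hax
    (hP.le a) (hP.le_two a) (hP.le b) (hP.le_two b) (hP.abs_slope_sub_le hh hC₀.le hay hax) hPy1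
        hPx1
    b1.le (b2.trans (le_add_of_nonneg_right (by positivity)))
  obtain ⟨fy, hfry⟩ := exists_isFrame (hpos (m + (2⁻¹ : ℝ) • ξ))
  obtain ⟨fx, hfrx⟩ := exists_isFrame (hpos (m + (-2⁻¹ : ℝ) • ξ))
  have hH : ∀ V W, compHess σ (4 * C₀ * a * (G a ^ 2 - 1)) (G a) f (m + (2⁻¹ : ℝ) • ξ) V V
      - compHess σ (4 * C₀ * b * (G b ^ 2 - 1)) (G b) f (m + (-2⁻¹ : ℝ) • ξ) W W
      ≤ p * M.E2 m ξ V W + modulusDeriv₂ (K ^ 3) (M.S m ξ ξ) * M.E1 m ξ V W ^ 2 := fun V W => by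
    have h1 := (hvar V W).2
    have h2 := dy (christoffelForm σ (m + (2⁻¹ : ℝ) • ξ) V V)
    have h3 := dx (christoffelForm σ (m + (-2⁻¹ : ℝ) • ξ) W W)
    rw [compHess_apply, compHess_apply, MetricPair.E2, hMΓ, hMΓ]
    linarith
  have hRy : ∑ i, M.S (m + (2⁻¹ : ℝ) • ξ) ξ (M.curv (m + (2⁻¹ : ℝ) • ξ) (fy i) ξ (fy i)) ≤
      C₀ * M.S (m + (2⁻¹ : ℝ) • ξ) ξ ξ := by
    have h1 := sum_curv_eq_ricci hσ hpos (m + (2⁻¹ : ℝ) • ξ) ξ hfry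
    rw [← hM] at h1
    rw [hMS, h1, matrixForm_apply]
    exact (neg_le_abs _).trans (hRic _ _)
  have htr := hU.trace_le hm hξδ (by
      calc K * ‖ξ‖ ^ 3 ≤ K * ‖ξ‖ := by gcongr
        _ ≤ 1 := by linarith) hν hw b1.le b2 b3 b4 b5 b6 (by rwa [hMS]) (by rwa [hMS]) hH hC₀.le hRy
    (ωy := 4 * p ^ 2 / (G a ^ 2 - Py)) (ωx := 4 * p ^ 2 / (G b ^ 2 - Px))
    (by have := sub_pos.2 q1; positivity) (by have := sub_pos.2 q2; positivity)
  have hDy : DifferentiableAt ℝ (fderiv ℝ f) (m + (2⁻¹ : ℝ) • ξ) := hfy.differentiableAt_fderiv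
  have hDx : DifferentiableAt ℝ (fderiv ℝ f) (m + (-2⁻¹ : ℝ) • ξ) := hfx.differentiableAt_fderiv
  have my := mul_mcfOp_eq (g := 4 * C₀ * a * (G a ^ 2 - 1)) (hpos _) hfry hDy hGa hνD hPy q1
  have mx := mul_mcfOp_eq (g := 4 * C₀ * b * (G b ^ 2 - 1)) (hpos _) hfrx hDx hGb hwD hPx q2
  rw [← hadef, ← hbdef, my, mx]
  linarith

end Interior

section TwoPoint

variable {n : ℕ} {σ : EuclideanSpace ℝ (Fin n) → Matrix (Fin n) (Fin n) ℝ}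

theorem matrixForm_self_nonneg {A : Matrix (Fin n) (Fin n) ℝ} (hA : A.PosDef)
    (a : EuclideanSpace ℝ (Fin n)) : 0 ≤ matrixForm A a a := by
  obtain ⟨f, hf⟩ := exists_isFrame hA
  rw [hf.apply_eq_sum]
  exact Finset.sum_nonneg fun i _ => mul_self_nonneg _

theorem sq_apply_le {A : Matrix (Fin n) (Fin n) ℝ} (hA : A.PosDef)
    (p : EuclideanSpace ℝ (Fin n) →L[ℝ] ℝ) (a : EuclideanSpace ℝ (Fin n)) :
    p a ^ 2 ≤ p (sharp A p) * matrixForm A a a := by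
  obtain ⟨f, hf⟩ := exists_isFrame hA
  have h1 : p a = ∑ i, p (f i) * matrixForm A (f i) a := by
    conv_lhs => rw [hf.expand a]
    simp [mul_comm]
  have h2 : p (sharp A p) = ∑ i, p (f i) ^ 2 := by
    rw [← matrixForm_sharp hA p (sharp A p), hf.apply_eq_sum]
    refine Finset.sum_congr rfl fun i _ => ?_
    rw [matrixForm_symm hA, matrixForm_sharp hA, sq]
  rw [h1, h2, hf.apply_eq_sum]
  simp only [← sq]
  exact Finset.sum_mul_sq_le_sq_mul_sq _ _ _

theorem matrixForm_one (a : EuclideanSpace ℝ (Fin n)) :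
    matrixForm (1 : Matrix (Fin n) (Fin n) ℝ) a a = ‖a‖ ^ 2 := by
  rw [EuclideanSpace.real_norm_sq_eq]
  simp [matrixForm_apply, Matrix.one_apply, sq]

/-- The two-point function comparing the values of `H ∘ f` at the endpoints `m ± ξ / 2` with the
modulus `ψ` of the squared midpoint length, at the pair `(m, ξ)`. -/
def twoPoint (σ : EuclideanSpace ℝ (Fin n) → Matrix (Fin n) (Fin n) ℝ) (H ψ : ℝ → ℝ)
    (f : EuclideanSpace ℝ (Fin n) → ℝ) (p : EuclideanSpace ℝ (Fin n) × EuclideanSpace ℝ (Fin n)) :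
        ℝ :=
  H (f (p.1 + (2⁻¹ : ℝ) • p.2)) - H (f (p.1 + (-2⁻¹ : ℝ) • p.2)) - ψ (matrixForm (σ p.1) p.2 p.2)

/-- The pairs `(m, ξ)` with `‖ξ‖ ≤ d` whose endpoints `m ± ξ / 2` lie in the ball of radius `ρ`. -/
def shortPairs (n : ℕ) (ρ d : ℝ) : Set (EuclideanSpace ℝ (Fin n) × EuclideanSpace ℝ (Fin n)) :=
  {p | ‖p.1 + (2⁻¹ : ℝ) • p.2‖ ≤ ρ ∧ ‖p.1 + (-2⁻¹ : ℝ) • p.2‖ ≤ ρ ∧ ‖p.2‖ ≤ d}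

theorem norm_midpoint_le {ρ : ℝ} {m ξ : EuclideanSpace ℝ (Fin n)} (h1 : ‖m + (2⁻¹ : ℝ) • ξ‖ ≤ ρ)
    (h2 : ‖m + (-2⁻¹ : ℝ) • ξ‖ ≤ ρ) : ‖m‖ ≤ ρ := by
  have e : m = (2⁻¹ : ℝ) • ((m + (2⁻¹ : ℝ) • ξ) + (m + (-2⁻¹ : ℝ) • ξ)) := by module
  calc ‖m‖ = 2⁻¹ * ‖(m + (2⁻¹ : ℝ) • ξ) + (m + (-2⁻¹ : ℝ) • ξ)‖ := by
        conv_lhs => rw [e, norm_smul]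
        norm_num
    _ ≤ 2⁻¹ * (‖m + (2⁻¹ : ℝ) • ξ‖ + ‖m + (-2⁻¹ : ℝ) • ξ‖) := by gcongr; exact norm_add_le _ _
    _ ≤ ρ := by linarith

theorem isCompact_shortPairs (ρ d : ℝ) : IsCompact (shortPairs n ρ d) := by
  refine IsCompact.of_isClosed_subset
    ((isCompact_closedBall (0 : EuclideanSpace ℝ (Fin n)) ρ).prod
      (isCompact_closedBall (0 : EuclideanSpace ℝ (Fin n)) d)) ?_ ?_
  · have h1 : Continuous fun p : EuclideanSpace ℝ (Fin n) × EuclideanSpace ℝ (Fin n) =>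
        ‖p.1 + (2⁻¹ : ℝ) • p.2‖ := by fun_prop
    have h2 : Continuous fun p : EuclideanSpace ℝ (Fin n) × EuclideanSpace ℝ (Fin n) =>
        ‖p.1 + (-2⁻¹ : ℝ) • p.2‖ := by fun_prop
    have h3 : Continuous fun p : EuclideanSpace ℝ (Fin n) × EuclideanSpace ℝ (Fin n) => ‖p.2‖ := by
      fun_prop
    exact (isClosed_le h1 continuous_const).inter
      ((isClosed_le h2 continuous_const).inter (isClosed_le h3 continuous_const))
  · rintro ⟨m, ξ⟩ ⟨h1, h2, h3⟩
    exact ⟨by simpa using norm_midpoint_le h1 h2, by simpa using h3⟩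

theorem continuousOn_twoPoint {ρ d t₁ : ℝ} {H ψ : ℝ → ℝ} {u : ℝ → EuclideanSpace ℝ (Fin n) → ℝ}
    (hσ : ∀ i j, ContDiff ℝ (⊤ : ℕ∞) fun x => σ x i j) (hH : Continuous H) (hψ : Continuous ψ)
    (hu : ContinuousOn (fun p : ℝ × EuclideanSpace ℝ (Fin n) => u p.1 p.2)
      (Icc 0 t₁ ×ˢ closedBall 0 ρ)) :
    ContinuousOn (fun q : ℝ × EuclideanSpace ℝ (Fin n) × EuclideanSpace ℝ (Fin n) =>
      twoPoint σ H ψ (u q.1) q.2) (Icc 0 t₁ ×ˢ shortPairs n ρ d) := by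
  have hS : Continuous fun q : ℝ × EuclideanSpace ℝ (Fin n) × EuclideanSpace ℝ (Fin n) =>
      matrixForm (σ q.2.1) q.2.2 q.2.2 := by
    simp only [matrixForm_apply]
    refine continuous_finsetSum _ fun i _ => continuous_finsetSum _ fun j _ => ?_
    have := (hσ i j).continuous
    fun_prop
  have hc : ∀ c : ℝ, (∀ p ∈ shortPairs n ρ d, ‖p.1 + c • p.2‖ ≤ ρ) →
      ContinuousOn (fun q : ℝ × EuclideanSpace ℝ (Fin n) × EuclideanSpace ℝ (Fin n) =>
        H (u q.1 (q.2.1 + c • q.2.2))) (Icc 0 t₁ ×ˢ shortPairs n ρ d) := fun c hc => by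
    have h1 : Continuous fun q : ℝ × EuclideanSpace ℝ (Fin n) × EuclideanSpace ℝ (Fin n) =>
      (q.1, q.2.1 + c • q.2.2) := by fun_prop
    refine hH.comp_continuousOn (hu.comp h1.continuousOn ?_)
    rintro ⟨t, p⟩ ⟨ht, hp⟩
    exact ⟨ht, by simpa using hc p hp⟩
  exact ((hc _ fun p hp => hp.1).sub (hc _ fun p hp => hp.2.1)).sub (hψ.comp hS).continuousOn

variable {ρ K δ C₀ h G₀ : ℝ} {H G : ℝ → ℝ}

namespace MetricPair

variable {X : Type*} [NormedAddCommGroup X] [NormedSpace ℝ X] {M : MetricPair X}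

theorem IsUniform.S_segment (hU : M.IsUniform ρ K δ) {m ξ : X} (hm : ‖m‖ ≤ ρ) (hξ : ‖ξ‖ ≤ δ) {s : ℝ}
    (hs : |s| ≤ 2⁻¹) : M.S (m + s • ξ) ξ ξ ≤ M.S m ξ ξ + K * ‖ξ‖ ^ 3 := by
  have hK := hU.K_pos
  by_cases h0 : s = 0
  · rw [h0, zero_smul, add_zero]
    exact le_add_of_nonneg_right (by positivity)
  have hn : ‖(2 * s) • ξ‖ = 2 * |s| * ‖ξ‖ := by
    rw [norm_smul, Real.norm_eq_abs, abs_mul, abs_two]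
  have h1 := hU.S_endpoint m ((2 * s) • ξ) hm (by
    rw [hn]; exact (mul_le_of_le_one_left (norm_nonneg _) (by linarith)).trans hξ)
  rw [smul_smul, inv_mul_cancel_left₀ two_ne_zero, hn] at h1
  simp only [map_smul, smul_apply, smul_eq_mul] at h1
  have h2 := (abs_le.1 h1).2
  have hs0 : 0 < |s| := abs_pos.2 h0
  have h3 : |s| ^ 2 * (M.S (m + s • ξ) ξ ξ - M.S m ξ ξ) ≤ |s| ^ 2 * (K * ‖ξ‖ ^ 3) := by
    have h4 : |s| ^ 3 * (K * ‖ξ‖ ^ 3) ≤ |s| ^ 2 * 2⁻¹ * (K * ‖ξ‖ ^ 3) := by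
      rw [pow_succ]; gcongr
    have h5 : K * (2 * |s| * ‖ξ‖) ^ 3 = 8 * (|s| ^ 3 * (K * ‖ξ‖ ^ 3)) := by ring
    rw [h5] at h2
    have h6 : 2 * s * (2 * s * (M.S (m + s • ξ) ξ ξ)) - 2 * s * (2 * s * M.S m ξ ξ)
      = 4 * (|s| ^ 2 * (M.S (m + s • ξ) ξ ξ - M.S m ξ ξ)) := by rw [sq_abs]; ring
    rw [h6] at h2
    linarith
  linarith [le_of_mul_le_mul_left h3 (by positivity)]

end MetricPair

theorem twoPoint_initial_le (hσ : ∀ i j, ContDiff ℝ (⊤ : ℕ∞) fun x => σ x i j)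
    (hpos : ∀ x, (σ x).PosDef) (hU : (metricPair σ hσ hpos).IsUniform ρ K δ)
    (hP : IsProfile H G C₀ h G₀) {ε : ℝ} (hε : 0 < ε) (hε1 : ε ≤ 1) (hGε : ∀ r, G r ≤ 1 + ε)
    {f : EuclideanSpace ℝ (Fin n) → ℝ} (hf : Differentiable ℝ f)
    (hgrad : ∀ x, √(gradSq σ f x) ≤ 1 - ε) {m ξ : EuclideanSpace ℝ (Fin n)} (hm : ‖m‖ ≤ ρ)
    (hξ : ‖ξ‖ ≤ δ) (hξε : K ^ 2 * ‖ξ‖ ≤ ε ^ 2) :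
    twoPoint σ H (modulus (K ^ 3)) f (m, ξ) ≤ 0 := by
  have hK := hU.K_pos
  obtain ⟨E, hE⟩ : ∃ E, E = matrixForm (σ m) ξ ξ := ⟨_, rfl⟩
  have hE0 : 0 ≤ E := hE ▸ matrixForm_self_nonneg (hpos m) ξ
  have hbd : ∀ s ∈ Icc (-2⁻¹ : ℝ) 2⁻¹, ‖G (f (m + s • ξ)) * fderiv ℝ f (m + s • ξ) ξ‖ ≤ √E := by
    intro s hs
    have h1 : matrixForm (σ (m + s • ξ)) ξ ξ ≤ E * (1 + ε ^ 2) := by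
      have h2 : matrixForm (σ (m + s • ξ)) ξ ξ ≤ E + K * ‖ξ‖ ^ 3 := by
        rw [hE]; exact hU.S_segment hm hξ (abs_le.2 hs)
      have h3 : ‖ξ‖ ^ 2 ≤ K * E := by rw [hE]; exact hU.sq_le m ξ hm
      calc _ ≤ E + K * ‖ξ‖ ^ 3 := h2
        _ = E + K * ‖ξ‖ * ‖ξ‖ ^ 2 := by ring
        _ ≤ E + K * ‖ξ‖ * (K * E) := by gcongr
        _ = E + K ^ 2 * ‖ξ‖ * E := by ring
        _ ≤ E + ε ^ 2 * E := by gcongr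
        _ = _ := by ring
    have h4 := sq_apply_le (hpos (m + s • ξ)) (fderiv ℝ f (m + s • ξ)) ξ
    rw [← gradSq_eq] at h4
    have h5 : 0 ≤ gradSq σ f (m + s • ξ) := by
      rw [gradSq_eq, ← matrixForm_sharp (hpos _)]
      exact matrixForm_self_nonneg (hpos _) _
    have h6 : gradSq σ f (m + s • ξ) ≤ (1 - ε) ^ 2 := by
      rw [← Real.sq_sqrt h5]; gcongr; exact hgrad _
    have h7 := hP.pos (f (m + s • ξ))
    refine Real.le_sqrt_of_sq_le ?_
    rw [Real.norm_eq_abs, sq_abs, mul_pow]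
    have h8 : matrixForm (σ (m + s • ξ)) ξ ξ ≥ 0 := matrixForm_self_nonneg (hpos _) _
    calc _ ≤ (1 + ε) ^ 2 * ((1 - ε) ^ 2 * (E * (1 + ε ^ 2))) := by
          gcongr
          · exact hGε _
          · exact h4.trans (by gcongr)
      _ = E * ((1 - ε ^ 2) * (1 - ε ^ 4)) := by ring
      _ ≤ E * (1 * 1) := by
          have : ε ^ 4 ≤ 1 := pow_le_one₀ hε.le hε1
          gcongr
          · linarith [sq_nonneg ε]
          · linarith [pow_pos hε 4]
      _ = E := by ring
  have hmv := (convex_Icc (-2⁻¹ : ℝ) 2⁻¹).norm_image_sub_le_of_norm_hasDerivWithin_le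
    (f := fun s : ℝ => H (f (m + s • ξ))) (x := -2⁻¹) (y := 2⁻¹)
    (fun s _ => by
      have h1 : HasDerivAt (fun s : ℝ => m + s • ξ) ξ s := by
        simpa using ((hasDerivAt_id s).smul_const ξ).const_add m
      exact ((hP.hasDerivAt _).comp s
        ((hf (m + s • ξ)).hasFDerivAt.comp_hasDerivAt s h1)).hasDerivWithinAt)
    hbd (by norm_num) (by norm_num)
  have h9 : ‖(2⁻¹ : ℝ) - -2⁻¹‖ = 1 := by norm_num
  rw [h9, mul_one] at hmv
  have h10 := (le_abs_self _).trans hmv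
  have h11 := sqrt_le_modulus (ζ := K ^ 3) (by positivity) hE0
  rw [twoPoint, ← hE]
  linarith

theorem twoPoint_boundary_le (hP : IsProfile H G C₀ h G₀) {ζ : ℝ} (hζ : 0 ≤ ζ) {R : ℝ}
    (hflat : ∀ x, R ≤ ‖x‖ → σ x = 1) (hRρ : R + 1 ≤ ρ) {f : EuclideanSpace ℝ (Fin n) → ℝ}
    (hf : ∀ x, ‖x‖ ≤ ρ → |f x| ≤ 4⁻¹ * (ρ - ‖x‖)) {m ξ : EuclideanSpace ℝ (Fin n)}
    (hy : ‖m + (2⁻¹ : ℝ) • ξ‖ ≤ ρ) (hx : ‖m + (-2⁻¹ : ℝ) • ξ‖ ≤ ρ) (hξ : ‖ξ‖ ≤ 1)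
    (hb : ‖m + (2⁻¹ : ℝ) • ξ‖ = ρ ∨ ‖m + (-2⁻¹ : ℝ) • ξ‖ = ρ) :
    twoPoint σ H (modulus ζ) f (m, ξ) ≤ 0 := by
  have h1 : ‖(2⁻¹ : ℝ) • ξ‖ = 2⁻¹ * ‖ξ‖ := by rw [norm_smul]; norm_num
  have h1' : ‖(-2⁻¹ : ℝ) • ξ‖ = 2⁻¹ * ‖ξ‖ := by rw [norm_smul]; norm_num
  have h2 := norm_add_le m ((2⁻¹ : ℝ) • ξ)
  have h2' := norm_add_le m ((-2⁻¹ : ℝ) • ξ)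
  have hm : R ≤ ‖m‖ := by rcases hb with hb | hb <;> linarith
  have e1 : (m + (2⁻¹ : ℝ) • ξ) = (m + (-2⁻¹ : ℝ) • ξ) + ξ := by module
  have h3 : ‖m + (2⁻¹ : ℝ) • ξ‖ ≤ ‖m + (-2⁻¹ : ℝ) • ξ‖ + ‖ξ‖ := e1 ▸ norm_add_le _ _
  have e2 : (m + (-2⁻¹ : ℝ) • ξ) = (m + (2⁻¹ : ℝ) • ξ) - ξ := by module
  have h4 : ‖m + (-2⁻¹ : ℝ) • ξ‖ ≤ ‖m + (2⁻¹ : ℝ) • ξ‖ + ‖ξ‖ := e2 ▸ norm_sub_le _ _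
  have h5 := hP.abs_sub_le (f (m + (2⁻¹ : ℝ) • ξ)) (f (m + (-2⁻¹ : ℝ) • ξ))
  have h6 := hf _ hy
  have h7 := hf _ hx
  have h8 := abs_sub (f (m + (2⁻¹ : ℝ) • ξ)) (f (m + (-2⁻¹ : ℝ) • ξ))
  have h9 := (le_abs_self _).trans h5
  have h10 := sqrt_le_modulus hζ (matrixForm_self_nonneg Matrix.PosDef.one ξ)
  rw [matrixForm_one, Real.sqrt_sq (norm_nonneg _)] at h10
  rw [twoPoint, hflat m hm, matrixForm_one]
  have h11 := norm_nonneg ξ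
  rcases hb with hb | hb <;> linarith

theorem twoPoint_midpoint_gain (hσ : ∀ i j, ContDiff ℝ (⊤ : ℕ∞) fun x => σ x i j)
    (hpos : ∀ x, (σ x).PosDef) (hU : (metricPair σ hσ hpos).IsUniform ρ K δ)
    (f : EuclideanSpace ℝ (Fin n) → ℝ) {m ξ : EuclideanSpace ℝ (Fin n)} (hm : ‖m‖ ≤ ρ)
    (hξ0 : 0 < ‖ξ‖) (hξ : ‖ξ‖ ≤ δ) (hξK : 5 * K ^ 2 * ‖ξ‖ ≤ 1) :
    twoPoint σ H (modulus (K ^ 3)) f (m, ξ) + 10⁻¹ * K ^ 3 * √(matrixForm (σ m) ξ ξ) ^ 3 ≤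
      twoPoint σ H (modulus (K ^ 3)) f (m + (4⁻¹ : ℝ) • ξ, (2⁻¹ : ℝ) • ξ)
        + twoPoint σ H (modulus (K ^ 3)) f (m + (-4⁻¹ : ℝ) • ξ, (2⁻¹ : ℝ) • ξ) := by
  have hK := hU.K_pos
  have e : ∀ z, 4 * matrixForm (σ z) ((2⁻¹ : ℝ) • ξ) ((2⁻¹ : ℝ) • ξ) = matrixForm (σ z) ξ ξ :=
    fun z => by simp only [map_smul, smul_apply, smul_eq_mul]; ring
  have h2 : |4 * matrixForm (σ (m + (-4⁻¹ : ℝ) • ξ)) ((2⁻¹ : ℝ) • ξ) ((2⁻¹ : ℝ) • ξ)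
      - matrixForm (σ m) ξ ξ| ≤ K * ‖ξ‖ ^ 3 := by
    rw [e]
    have h3 := hU.S_quarter m (-ξ) hm (by rwa [norm_neg])
    simp only [smul_neg, ← neg_smul, map_neg, neg_apply, neg_neg, norm_neg] at h3
    exact h3
  have h1 : |4 * matrixForm (σ (m + (4⁻¹ : ℝ) • ξ)) ((2⁻¹ : ℝ) • ξ) ((2⁻¹ : ℝ) • ξ)
      - matrixForm (σ m) ξ ξ| ≤ K * ‖ξ‖ ^ 3 := by
    rw [e]
    exact hU.S_quarter m ξ hm hξ
  have hmid := modulus_midpoint hK hξ0 (matrixForm_self_nonneg (hpos (m + (4⁻¹ : ℝ) • ξ)) _)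
    (matrixForm_self_nonneg (hpos (m + (-4⁻¹ : ℝ) • ξ)) _) (hU.sq_le m ξ hm) hξK h1 h2 (by
      rw [e, e]; exact hU.S_midpoint m ξ hm hξ)
  have e1 : m + (4⁻¹ : ℝ) • ξ + (2⁻¹ : ℝ) • (2⁻¹ : ℝ) • ξ = m + (2⁻¹ : ℝ) • ξ := by module
  have e2 : m + (4⁻¹ : ℝ) • ξ + (-2⁻¹ : ℝ) • (2⁻¹ : ℝ) • ξ = m := by module
  have e3 : m + (-4⁻¹ : ℝ) • ξ + (2⁻¹ : ℝ) • (2⁻¹ : ℝ) • ξ = m := by module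
  have e4 : m + (-4⁻¹ : ℝ) • ξ + (-2⁻¹ : ℝ) • (2⁻¹ : ℝ) • ξ = m + (-2⁻¹ : ℝ) • ξ := by module
  simp only [twoPoint, e1, e2, e3, e4]
  have hmid' : modulus (K ^ 3) (matrixForm (σ (m + (4⁻¹ : ℝ) • ξ)) ((2⁻¹ : ℝ) • ξ) ((2⁻¹ : ℝ) • ξ))
    + modulus (K ^ 3) (matrixForm (σ (m + (-4⁻¹ : ℝ) • ξ)) ((2⁻¹ : ℝ) • ξ) ((2⁻¹ : ℝ) • ξ))
    + 10⁻¹ * K ^ 3 * √(matrixForm (σ m) ξ ξ) ^ 3 ≤ modulus (K ^ 3) (matrixForm (σ m) ξ ξ) := hmid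
  linarith

theorem isLocalMax_twoPoint {ψ : ℝ → ℝ} {d : ℝ} {f : EuclideanSpace ℝ (Fin n) → ℝ}
    {m ξ : EuclideanSpace ℝ (Fin n)} (hy : ‖m + (2⁻¹ : ℝ) • ξ‖ < ρ)
    (hx : ‖m + (-2⁻¹ : ℝ) • ξ‖ < ρ) (hξ : ‖ξ‖ < d)
    (hmax : ∀ q ∈ shortPairs n ρ d, twoPoint σ H ψ f q ≤ twoPoint σ H ψ f (m, ξ))
    (V W : EuclideanSpace ℝ (Fin n)) :
    IsLocalMax (fun s : ℝ => H (f (m + (2⁻¹ : ℝ) • ξ + s • V))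
        - H (f (m + (-2⁻¹ : ℝ) • ξ + s • W))
        - ψ (matrixForm (σ (m + s • ((2⁻¹ : ℝ) • (V + W)))) (ξ + s • (V - W))
          (ξ + s • (V - W)))) 0 := by
  have key : ∀ (a b : EuclideanSpace ℝ (Fin n)) (r : ℝ), ‖a‖ < r →
      ∀ᶠ s in nhds (0 : ℝ), ‖a + s • b‖ < r := fun a b r h => by
    have hc : Continuous fun s : ℝ => ‖a + s • b‖ := by fun_prop
    exact hc.continuousAt.eventually_lt continuousAt_const (by simpa using h)
  filter_upwards [key _ V _ hy, key _ W _ hx, key _ (V - W) _ hξ] with s h1 h2 h3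
  have e1 : m + s • ((2⁻¹ : ℝ) • (V + W)) + (2⁻¹ : ℝ) • (ξ + s • (V - W))
      = m + (2⁻¹ : ℝ) • ξ + s • V := by module
  have e2 : m + s • ((2⁻¹ : ℝ) • (V + W)) + (-2⁻¹ : ℝ) • (ξ + s • (V - W))
      = m + (-2⁻¹ : ℝ) • ξ + s • W := by module
  have h4 := hmax (m + s • ((2⁻¹ : ℝ) • (V + W)), ξ + s • (V - W))
    ⟨by rw [e1]; exact h1.le, by rw [e2]; exact h2.le, h3.le⟩
  simp only [twoPoint, e1, e2] at h4
  simpa using h4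

end TwoPoint

section Flow

variable {n : ℕ} {σ : EuclideanSpace ℝ (Fin n) → Matrix (Fin n) (Fin n) ℝ} {ρ K δ C₀ h G₀ : ℝ}
  {H G : ℝ → ℝ}

set_option maxHeartbeats 1000000 in
/-- Along the flow, `H ∘ u` is nonexpanding with respect to a modulus of the midpoint distance, at a
scale that depends on the metric and on the radius. -/
theorem IsGraphicalFlow.exists_twoPoint_nonpos (hσ : ∀ i j, ContDiff ℝ (⊤ : ℕ∞) fun x => σ x i j)
    (hpos : ∀ x, (σ x).PosDef) (hU : (metricPair σ hσ hpos).IsUniform ρ K δ)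
    (hP : IsProfile H G C₀ h G₀) (hC₀ : 0 < C₀) (hh : 0 ≤ h)
    (hRic : ∀ (x : EuclideanSpace ℝ (Fin n)) (w : Fin n → ℝ),
      |∑ j, ∑ l, ricci σ j l x * w j * w l| ≤ C₀ * ∑ j, ∑ l, σ x j l * w j * w l)
    {ε : ℝ} (hε : 0 < ε) (hε1 : ε ≤ 1) (hGε : ∀ r, G r ≤ 1 + ε)
    {R : ℝ} (hflat : ∀ x, R ≤ ‖x‖ → σ x = 1) (hRρ : R + 1 ≤ ρ) :
    ∃ d > 0, ∀ {t₁ : ℝ} {u : ℝ → EuclideanSpace ℝ (Fin n) → ℝ} {f : EuclideanSpace ℝ (Fin n) → ℝ},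
      IsGraphicalFlow σ ρ t₁ u → Differentiable ℝ f → (∀ x, √(gradSq σ f x) ≤ 1 - ε) →
      (∀ x, ‖x‖ ≤ ρ → u 0 x = f x) → (∀ t ∈ Icc 0 t₁, ∀ x, ‖x‖ ≤ ρ → |u t x| ≤ h) →
      (∀ t ∈ Icc 0 t₁, ∀ x, ‖x‖ ≤ ρ → |u t x| ≤ 4⁻¹ * (ρ - ‖x‖)) →
      ∀ t ∈ Icc 0 t₁, ∀ p ∈ shortPairs n ρ d, twoPoint σ H (modulus (K ^ 3)) (u t) p ≤ 0 := by
  have hK := hU.K_pos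
  have hδ := hU.δ_pos
  obtain ⟨d₀, hd₀, hinner⟩ := exists_interior_bound hσ hpos hU hP hC₀ hh hRic
  obtain ⟨d, hd⟩ : ∃ d, d = min (min d₀ δ) (min 1 (min (1 / (5 * K ^ 2)) (ε ^ 2 / K ^ 2))) := ⟨_,
      rfl⟩
  have hdpos : 0 < d := by rw [hd]; positivity
  obtain ⟨⟨hdd₀, hdδ⟩, hd1, hdK, hdε⟩ : (d ≤ d₀ ∧ d ≤ δ) ∧ d ≤ 1 ∧ d ≤ 1 / (5 * K ^ 2) ∧
      d ≤ ε ^ 2 / K ^ 2 := by simpa only [le_min_iff] using hd.le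
  rw [le_div_iff₀ (by positivity)] at hdK hdε
  refine ⟨d, hdpos, fun {t₁ u f} hu hf hgrad h0 hheight hbar => ?_⟩
  obtain ⟨γ, hγ⟩ : ∃ γ, γ = 10⁻¹ * K ^ 3 * √(d ^ 2 / K) ^ 3 := ⟨_, rfl⟩
  have hγ0 : 0 < γ := by rw [hγ]; positivity
  refine nonpos_of_forall_max_nonincreasing (isCompact_shortPairs ρ d) (κ := γ / 2) (by positivity)
    (continuousOn_twoPoint hσ (continuous_iff_continuousAt.2 fun r =>
        (hP.hasDerivAt r).continuousAt)
      (continuous_modulus _) hu.continuousOn) ?_ ?_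
  · rintro ⟨m, ξ⟩ ⟨h1, h2, h3⟩
    have hm := norm_midpoint_le h1 h2
    have := twoPoint_initial_le hσ hpos hU hP hε hε1 hGε hf hgrad hm (h3.trans hdδ)
      (by nlinarith [pow_pos hK 2])
    rw [twoPoint] at this ⊢
    rwa [h0 _ h1, h0 _ h2]
  · rintro t ht ⟨m, ξ⟩ ⟨h1, h2, h3⟩ hmax hpos' hle
    have hm : ‖m‖ ≤ ρ := norm_midpoint_le h1 h2
    have htI : t ∈ Icc 0 t₁ := ⟨ht.1.le, ht.2⟩
    dsimp only at h1 h2 h3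
    have hξ0 : ξ ≠ 0 := by
      rintro rfl
      simp [twoPoint, modulus] at hpos'
    have hξpos := norm_pos_iff.2 hξ0
    have hb : ¬(‖m + (2⁻¹ : ℝ) • ξ‖ = ρ ∨ ‖m + (-2⁻¹ : ℝ) • ξ‖ = ρ) := fun hb =>
      hpos'.not_ge (twoPoint_boundary_le hP (by positivity) hflat hRρ (hbar t htI) h1 h2
        (h3.trans hd1) hb)
    rw [not_or] at hb
    have hy := lt_of_le_of_ne h1 hb.1
    have hx := lt_of_le_of_ne h2 hb.2
    have hξd : ‖ξ‖ < d := by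
      refine lt_of_le_of_ne h3 fun hξd => ?_
      have hg := twoPoint_midpoint_gain (H := H) hσ hpos hU (u t) hm hξpos (h3.trans hdδ)
        (by rw [hξd]; linarith)
      have hn : ‖(2⁻¹ : ℝ) • ξ‖ ≤ d := by
        rw [norm_smul, hξd]; norm_num; linarith
      have e1 : m + (4⁻¹ : ℝ) • ξ + (2⁻¹ : ℝ) • (2⁻¹ : ℝ) • ξ = m + (2⁻¹ : ℝ) • ξ := by module
      have e2 : m + (4⁻¹ : ℝ) • ξ + (-2⁻¹ : ℝ) • (2⁻¹ : ℝ) • ξ = m := by module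
      have e3 : m + (-4⁻¹ : ℝ) • ξ + (2⁻¹ : ℝ) • (2⁻¹ : ℝ) • ξ = m := by module
      have e4 : m + (-4⁻¹ : ℝ) • ξ + (-2⁻¹ : ℝ) • (2⁻¹ : ℝ) • ξ = m + (-2⁻¹ : ℝ) • ξ := by module
      have g1 := hmax (m + (4⁻¹ : ℝ) • ξ, (2⁻¹ : ℝ) • ξ)
        ⟨by rw [e1]; exact h1, by rw [e2]; exact hm, hn⟩
      have g2 := hmax (m + (-4⁻¹ : ℝ) • ξ, (2⁻¹ : ℝ) • ξ)
        ⟨by rw [e3]; exact hm, by rw [e4]; exact h2, hn⟩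
      have g3 : γ ≤ 10⁻¹ * K ^ 3 * √(matrixForm (σ m) ξ ξ) ^ 3 := by
        have g4 : ‖ξ‖ ^ 2 ≤ K * matrixForm (σ m) ξ ξ := hU.sq_le m ξ hm
        rw [hγ, ← hξd]
        gcongr
        rwa [div_le_iff₀' hK]
      linarith
    have hyb : m + (2⁻¹ : ℝ) • ξ ∈ ball (0 : EuclideanSpace ℝ (Fin n)) ρ := by simpa using hy
    have hxb : m + (-2⁻¹ : ℝ) • ξ ∈ ball (0 : EuclideanSpace ℝ (Fin n)) ρ := by simpa using hx
    refine ⟨_, hinner (u t) m ξ hm hξpos (h3.trans hdd₀) (hu.contDiffAt ht hyb)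
        (hu.contDiffAt ht hxb)
      (hheight t htI _ h1) (hheight t htI _ h2) (by rw [twoPoint] at hpos'; linarith)
      (isLocalMax_twoPoint hy hx hξd hmax), ?_⟩
    exact (((hP.hasDerivAt _).comp t (hu.hasDerivAt t ht _ hyb)).sub
      ((hP.hasDerivAt _).comp t (hu.hasDerivAt t ht _ hxb))).sub_const _

/-- If `H ∘ f` is nonexpanding at short scales then the slope of `f` is at most `1 / G₀`. -/
theorem gradSq_le_of_twoPoint_nonpos (hσ : ∀ i j, ContDiff ℝ (⊤ : ℕ∞) fun x => σ x i j)
    (hpos : ∀ x, (σ x).PosDef) (hP : IsProfile H G C₀ h G₀) {ζ d : ℝ} (hd : 0 < d) (hρ : 0 < ρ)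
    {f : EuclideanSpace ℝ (Fin n) → ℝ}
    (hf : ∀ p ∈ shortPairs n ρ d, twoPoint σ H (modulus ζ) f p ≤ 0)
    {x : EuclideanSpace ℝ (Fin n)} (hx : ‖x‖ ≤ ρ) : gradSq σ f x ≤ 1 / G₀ ^ 2 := by
  have hG₀ := hP.one_lt
  by_cases hdf : DifferentiableAt ℝ f x
  swap
  · rw [gradSq_eq, fderiv_zero_of_not_differentiableAt hdf]
    simp only [zero_apply]
    positivity
  have hG := hP.pos (f x)
  have hseg : ∀ v : EuclideanSpace ℝ (Fin n), (∀ᶠ s in nhdsWithin (0 : ℝ) (Ioi 0), ‖x + s • v‖ ≤ ρ)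
      →
      |G (f x) * fderiv ℝ f x v| ≤ √(matrixForm (σ x) v v) := by
    intro v hv
    have hD : HasDerivAt (fun s : ℝ => H (f (x + s • v))) (G (f x) * fderiv ℝ f x v) 0 := by
      have h1 : HasDerivAt (fun s : ℝ => x + s • v) v 0 := by
        simpa using ((hasDerivAt_id (0 : ℝ)).smul_const v).const_add x
      have h2 : HasDerivAt (fun s : ℝ => f (x + s • v)) (fderiv ℝ f x v) 0 := by
        have h3 : HasFDerivAt f (fderiv ℝ f x) (x + (0 : ℝ) • v) := by
          simpa using hdf.hasFDerivAt
        exact h3.comp_hasDerivAt (0 : ℝ) h1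
      have h4 : HasDerivAt H (G (f x)) (f (x + (0 : ℝ) • v)) := by simpa using hP.hasDerivAt (f x)
      exact h4.comp (0 : ℝ) h2
    have hl := hD.tendsto_slope_zero_right.abs
    have hr : Tendsto (fun s : ℝ => √(matrixForm (σ (x + (s / 2) • v)) v v) *
        (1 + ζ * (s ^ 2 * matrixForm (σ (x + (s / 2) • v)) v v))) (nhdsWithin 0 (Ioi 0))
        (nhds (√(matrixForm (σ x) v v))) := by
      have hc : Continuous fun s : ℝ => matrixForm (σ (x + (s / 2) • v)) v v := by
        simp only [matrixForm_apply]
        refine continuous_finsetSum _ fun i _ => continuous_finsetSum _ fun j _ => ?_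
        have := (hσ i j).continuous
        fun_prop
      have hc' : Continuous fun s : ℝ => √(matrixForm (σ (x + (s / 2) • v)) v v) *
        (1 + ζ * (s ^ 2 * matrixForm (σ (x + (s / 2) • v)) v v)) := by fun_prop
      have := (hc'.tendsto 0).mono_left (nhdsWithin_le_nhds (s := Ioi 0))
      simpa using this
    refine le_of_tendsto_of_tendsto hl hr ?_
    have hsm : ∀ᶠ s in nhdsWithin (0 : ℝ) (Ioi 0), ‖s • v‖ ≤ d := by
      have hc : Continuous fun s : ℝ => ‖s • v‖ := by fun_prop
      have := hc.continuousAt.eventually_lt (continuousAt_const (x := (0 : ℝ)) (y := d))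
        (by simpa using hd)
      exact (this.filter_mono nhdsWithin_le_nhds).mono fun s hs => hs.le
    filter_upwards [hv, hsm, self_mem_nhdsWithin] with s hs1 hs2 hs3
    have hs3 : 0 < s := hs3
    have e1 : x + (s / 2) • v + (2⁻¹ : ℝ) • s • v = x + s • v := by module
    have e2 : x + (s / 2) • v + (-2⁻¹ : ℝ) • s • v = x := by module
    have e3 : x + (s / 2) • v + (2⁻¹ : ℝ) • -(s • v) = x := by module
    have e4 : x + (s / 2) • v + (-2⁻¹ : ℝ) • -(s • v) = x + s • v := by module
    have h1 := hf (x + (s / 2) • v, s • v) ⟨by rw [e1]; exact hs1, by rw [e2]; exact hx, hs2⟩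
    have h2 := hf (x + (s / 2) • v, -(s • v))
      ⟨by rw [e3]; exact hx, by rw [e4]; exact hs1, by rw [norm_neg]; exact hs2⟩
    simp only [twoPoint, e1, e2, map_smul, smul_apply, smul_eq_mul, modulus] at h1
    simp only [twoPoint, e3, e4, map_neg, neg_apply, map_smul, smul_apply, smul_eq_mul,
      modulus] at h2
    have e5 : √(s * (s * matrixForm (σ (x + (s / 2) • v)) v v))
        = s * √(matrixForm (σ (x + (s / 2) • v)) v v) := by
      rw [← mul_assoc, Real.sqrt_mul (by positivity), Real.sqrt_mul_self hs3.le]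
    simp only [mul_neg, neg_neg] at h2
    rw [e5] at h1 h2
    simp only [zero_add, zero_smul, add_zero, smul_eq_mul]
    rw [abs_mul, abs_of_pos (inv_pos.2 hs3), inv_mul_le_iff₀ hs3]
    refine (abs_sub_le_iff.2 ⟨sub_nonpos.1 h1, sub_nonpos.1 h2⟩).trans (le_of_eq ?_)
    ring
  have hin : ∀ v : EuclideanSpace ℝ (Fin n), inner ℝ x v < 0 ∨ x = 0 →
      ∀ᶠ s in nhdsWithin (0 : ℝ) (Ioi 0), ‖x + s • v‖ ≤ ρ := by
    rintro v (hv | rfl)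
    · have hc : Continuous fun s : ℝ => 2 * inner ℝ x v + s * ‖v‖ ^ 2 := by fun_prop
      have h1 := hc.continuousAt.eventually_lt (continuousAt_const (x := (0 : ℝ)) (y := (0 : ℝ)))
        (by simp only [zero_mul, add_zero]; linarith)
      filter_upwards [h1.filter_mono nhdsWithin_le_nhds, self_mem_nhdsWithin] with s hs1 hs2
      have hs2 : 0 < s := hs2
      refine le_trans (le_of_sq_le_sq ?_ (norm_nonneg x)) hx
      rw [norm_add_sq_real, norm_smul, real_inner_smul_right, Real.norm_eq_abs, mul_pow, sq_abs]
      nlinarith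
    · have hc : Continuous fun s : ℝ => ‖(0 : EuclideanSpace ℝ (Fin n)) + s • v‖ := by fun_prop
      have h1 := hc.continuousAt.eventually_lt (continuousAt_const (x := (0 : ℝ)) (y := ρ))
        (by simpa using hρ)
      exact (h1.filter_mono nhdsWithin_le_nhds).mono fun s hs => hs.le
  have hSc : Continuous fun v : EuclideanSpace ℝ (Fin n) => √(matrixForm (σ x) v v) := by fun_prop
  have hsq : ∀ v : EuclideanSpace ℝ (Fin n), inner ℝ x v ≤ 0 →
      |G (f x) * fderiv ℝ f x v| ≤ √(matrixForm (σ x) v v) := by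
    intro v hv
    have hc1 : Continuous fun η : ℝ => |G (f x) * fderiv ℝ f x (v + η • -x)| := by fun_prop
    have hc2 : Continuous fun η : ℝ => √(matrixForm (σ x) (v + η • -x) (v + η • -x)) := by fun_prop
    have t1 := (hc1.tendsto 0).mono_left (nhdsWithin_le_nhds (s := Ioi 0))
    have t2 := (hc2.tendsto 0).mono_left (nhdsWithin_le_nhds (s := Ioi 0))
    rw [zero_smul, add_zero] at t1 t2
    refine le_of_tendsto_of_tendsto t1 t2 ?_
    filter_upwards [self_mem_nhdsWithin] with η hη
    have hη : 0 < η := hη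
    refine hseg _ (hin _ ?_)
    by_cases h0 : x = 0
    · exact Or.inr h0
    · left
      rw [inner_add_right, real_inner_smul_right, inner_neg_right, real_inner_self_eq_norm_sq]
      have : 0 < η * ‖x‖ ^ 2 := by have := norm_pos_iff.2 h0; positivity
      linarith
  have hall : ∀ v, |G (f x) * fderiv ℝ f x v| ≤ √(matrixForm (σ x) v v) := by
    intro v
    rcases le_total (inner ℝ x v) 0 with hv | hv
    · exact hsq v hv
    · simpa using hsq (-v) (by rw [inner_neg_right]; linarith)
  have hq := hall (sharp (σ x) (fderiv ℝ f x))
  rw [matrixForm_sharp (hpos x), ← gradSq_eq] at hq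
  have hq0 : 0 ≤ gradSq σ f x := by
    rw [gradSq_eq, ← matrixForm_sharp (hpos x)]
    exact matrixForm_self_nonneg (hpos x) _
  rcases hq0.eq_or_lt with h0 | h0
  · rw [← h0]; positivity
  have h1 := (Real.le_sqrt (abs_nonneg _) hq0).1 hq
  rw [sq_abs, mul_pow, sq (gradSq σ f x), ← mul_assoc] at h1
  have h2 : G (f x) ^ 2 * gradSq σ f x ≤ 1 := le_of_mul_le_mul_right (by linarith) h0
  rw [le_div_iff₀ (by positivity), mul_comm]
  exact (mul_le_mul_of_nonneg_right (pow_le_pow_left₀ (by linarith) (hP.le _) 2) hq0).trans h2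

end Flow

section Flow

variable {n : ℕ} {σ : EuclideanSpace ℝ (Fin n) → Matrix (Fin n) (Fin n) ℝ} {ρ t₁ : ℝ}
  {u : ℝ → EuclideanSpace ℝ (Fin n) → ℝ}

theorem IsGraphicalFlow.le_slope (hu : IsGraphicalFlow σ ρ t₁ u) (hpos : ∀ x, (σ x).PosDef)
    {h R : ℝ} (hh : 0 ≤ h) (hflat : ∀ x, R ≤ ‖x‖ → σ x = 1) (h0 : ∀ x, ‖x‖ ≤ ρ → u 0 x ≤ h)
    (h0' : ∀ x, R ≤ ‖x‖ → ‖x‖ ≤ ρ → u 0 x = 0) (hρ : 0 < ρ)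
    (hRρ : 8 * ρ * h ≤ ρ ^ 2 - R ^ 2) :
    ∀ t ∈ Icc 0 t₁, ∀ x, ‖x‖ ≤ ρ → u t x ≤ 4⁻¹ * (ρ - ‖x‖) := by
  intro t ht x hx
  refine (hu.le_barrier hpos hh hflat h0 h0' (k := 1 / (8 * ρ)) (by positivity) ?_ ?_
    t ht x hx).trans ?_
  · rw [one_div, ← div_eq_inv_mul, le_div_iff₀ (by positivity)]
    linarith
  · field_simp
    norm_num
  · rw [one_div, ← div_eq_inv_mul, div_le_iff₀ (by positivity)]
    nlinarith [sq_nonneg (ρ - ‖x‖)]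

end Flow

/- STATEMENT 12: Uniform gradient (tilt) estimate: for the modified Dirichlet problem on
B_{R²}(0) × (0,T) with modified metric σ_R having Ricci curvature bounded by C₀ and
uniformly spacelike initial data u_{0,R} (|u_{0,R}| ≤ h, |∇u_{0,R}|_{σ_R} ≤ 1−ε, vanishing
outside B_R(0)), the quantity v = (1 − |∇u_R|²_{σ_R})^{−1/2} is bounded by a constant
c ≥ 1 independent of R and T. -/
theorem stmt_12 (n : ℕ) (hn : 3 ≤ n)
    (σ : EuclideanSpace ℝ (Fin n) → Matrix (Fin n) (Fin n) ℝ) (R₀ C : ℝ) (ω : ℝ → ℝ)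
    (hσ : IsAsympFlat σ R₀ C ω)
    (h ε C₀ : ℝ) (hh : 0 < h) (hε : 0 < ε) (hC₀ : 0 < C₀) :
    ∃ c : ℝ, 1 ≤ c ∧ ∃ Rstar : ℝ, 0 < Rstar ∧
      ∀ R : ℝ, Rstar ≤ R → ∀ T : ℝ≥0∞, 0 < T →
      ∀ σR : EuclideanSpace ℝ (Fin n) → Matrix (Fin n) (Fin n) ℝ,
        (∀ i j, ContDiff ℝ (⊤ : ℕ∞) fun x => σR x i j) →
        (∀ x, (σR x).PosDef) →
        (∀ x : EuclideanSpace ℝ (Fin n), ‖x‖ ≤ R - 1 → σR x = σ x) →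
        (∀ x : EuclideanSpace ℝ (Fin n), R ≤ ‖x‖ → σR x = (1 : Matrix (Fin n) (Fin n) ℝ)) →
        -- bounded Ricci curvature: |Ric_{σ_R}(w,w)| ≤ C₀ |w|²_{σ_R}
        (∀ (x : EuclideanSpace ℝ (Fin n)) (w : Fin n → ℝ),
          |∑ j, ∑ l, ricci σR j l x * w j * w l| ≤ C₀ * ∑ j, ∑ l, σR x j l * w j * w l) →
      ∀ u0R : EuclideanSpace ℝ (Fin n) → ℝ,
        ContDiff ℝ 1 u0R → (∀ x, |u0R x| ≤ h) →
        (∀ x, Real.sqrt (gradSq σR u0R x) ≤ 1 - ε) →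
        (∀ x : EuclideanSpace ℝ (Fin n), R ≤ ‖x‖ → u0R x = 0) →
      ∀ u : ℝ → EuclideanSpace ℝ (Fin n) → ℝ,
        ContinuousOn (fun p : ℝ × EuclideanSpace ℝ (Fin n) => u p.1 p.2)
          ({t | 0 ≤ t ∧ ENNReal.ofReal t < T} ×ˢ Metric.closedBall 0 (R ^ 2)) →
        (∀ t : ℝ, 0 < t → ENNReal.ofReal t < T →
          ContDiffOn ℝ 2 (u t) (Metric.ball (0 : EuclideanSpace ℝ (Fin n)) (R ^ 2))) →
        (∀ x ∈ Metric.ball (0 : EuclideanSpace ℝ (Fin n)) (R ^ 2),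
          ∀ t : ℝ, 0 < t → ENNReal.ofReal t < T →
            HasDerivAt (fun s => u s x) (mcfOp σR (u t) x) t) →
        (∀ x : EuclideanSpace ℝ (Fin n), ‖x‖ ≤ R ^ 2 → u 0 x = u0R x) →
        (∀ t : ℝ, 0 ≤ t → ENNReal.ofReal t < T →
          ∀ x : EuclideanSpace ℝ (Fin n), ‖x‖ = R ^ 2 → u t x = 0) →
        -- conclusion: sup of v = (1 − |∇u_R|²_{σ_R})^{−1/2} is at most c
        ∀ t : ℝ, 0 ≤ t → ENNReal.ofReal t < T →
          ∀ x : EuclideanSpace ℝ (Fin n), ‖x‖ ≤ R ^ 2 →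
            (Real.sqrt (1 - gradSq σR (u t) x))⁻¹ ≤ c := by
  obtain ⟨H, G, G₀, hG₀, hH, hG, hG2, hGε, hG'⟩ :=
    exists_profile (h := (h + 1) ^ 2) (l := 4 * C₀) hε (by positivity)
  have hP : IsProfile H G C₀ h G₀ := ⟨hG₀, hH, hG, hG2, hG'⟩
  have hpos₀ : 0 < 1 - 1 / G₀ ^ 2 := by
    rw [sub_pos, div_lt_one (by positivity)]
    exact one_lt_pow₀ hG₀ two_ne_zero
  refine ⟨(√(1 - 1 / G₀ ^ 2))⁻¹, ?_, 8 * h + 2, by positivity, ?_⟩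
  · refine (one_le_inv₀ (Real.sqrt_pos.2 hpos₀)).2 (Real.sqrt_le_one.2 ?_)
    have : 0 ≤ 1 / G₀ ^ 2 := by positivity
    linarith
  intro R hR T _ σR hσR hposR _ hflat hRic u0R hu0 hu0h hgrad hu0' u hcont hdiff hderiv hstart hbdry
    t ht htT x hx
  have hε1 : ε ≤ 1 := by linarith [hgrad 0, Real.sqrt_nonneg (gradSq σR u0R 0)]
  have hR2 : 2 ≤ R := by linarith
  have hRR : R + 1 ≤ R ^ 2 := by nlinarith
  have hlt : ∀ s, s ≤ t → ENNReal.ofReal s < T := fun s hs =>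
    (ENNReal.ofReal_le_ofReal hs).trans_lt htT
  have hu : IsGraphicalFlow σR (R ^ 2) t u :=
    { continuousOn := hcont.mono (prod_mono (fun s hs => ⟨hs.1, hlt s hs.2⟩) subset_rfl)
      contDiffOn := fun s hs => hdiff s hs.1 (hlt s hs.2)
      hasDerivAt := fun s hs y hy => hderiv y hy s hs.1 (hlt s hs.2)
      boundary := fun s hs => hbdry s hs.1 (hlt s hs.2) }
  have hle : ∀ y, ‖y‖ ≤ R ^ 2 → u 0 y ≤ h := fun y hy => by
    rw [hstart y hy]; exact (abs_le.1 (hu0h y)).2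
  have hle' : ∀ y, ‖y‖ ≤ R ^ 2 → -u 0 y ≤ h := fun y hy => by
    rw [hstart y hy]; linarith [(abs_le.1 (hu0h y)).1]
  have hzero : ∀ y, R ≤ ‖y‖ → ‖y‖ ≤ R ^ 2 → u 0 y = 0 := fun y hy hy' => by
    rw [hstart y hy', hu0' y hy]
  have hbar : 8 * R ^ 2 * h ≤ (R ^ 2) ^ 2 - R ^ 2 := by
    have : 8 * h ≤ R ^ 2 - 1 := by nlinarith
    nlinarith [sq_nonneg R]
  obtain ⟨K, δ, hU⟩ := (metricPair σR hσR hposR).exists_isUniform (R ^ 2)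
  obtain ⟨d, hd, hkey⟩ := IsGraphicalFlow.exists_twoPoint_nonpos hσR hposR hU hP hC₀ hh.le hRic hε
    hε1 hGε hflat hRR
  have hslope := gradSq_le_of_twoPoint_nonpos hσR hposR hP hd (by positivity)
    (hkey hu (hu0.differentiable one_ne_zero) hgrad hstart
      (fun s hs y hy => abs_le'.2 ⟨hu.le_of_initial_le hposR hh.le hle s hs y hy,
        hu.neg.le_of_initial_le hposR hh.le hle' s hs y hy⟩)
      (fun s hs y hy => abs_le'.2
        ⟨hu.le_slope hposR hh.le hflat hle hzero (by positivity) hbar s hs y hy,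
          hu.neg.le_slope hposR hh.le hflat hle' (fun z hz hz' => by simp [hzero z hz hz'])
            (by positivity) hbar s hs y hy⟩) t ⟨ht, le_rfl⟩) hx
  exact inv_anti₀ (Real.sqrt_pos.2 hpos₀) (Real.sqrt_le_sqrt (by linarith))
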